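/- Assume p = 2r+1 < p_B(N). There exists a constant C = C(N,p,B) > 0 such that for every positive classical solution U = (u_1,…,u_m) of (S) on all of ℝ^N × ℝ and every R > 0, ∫_{|s|<R^2/2} ∫_{|y|<R/2} Σ_{i=1}^m ( Σ_{j=1}^m β_{ij} u_i^r u_j^{r+1} )^2 (y,s) dy ds ≤ C R^{N+2−4p/(p−1)}. -/

import Mathlib

open Real Set Metric MeasureTheory

/-- The Laplacian in the space variable, as the sum of second derivatives in
the coordinate directions. -/
noncomputable def lap {N : ℕ} (f : EuclideanSpace ℝ (Fin N) → ℝ)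
    (x : EuclideanSpace ℝ (Fin N)) : ℝ :=
  ∑ i, iteratedFDeriv ℝ 2 f x ![EuclideanSpace.single i 1, EuclideanSpace.single i 1]

section HeatExtension

open Filter Topology

/-- The total mass of the Gaussian. -/
noncomputable def gaussMass (N : ℕ) : ℝ :=
  ∫ z : EuclideanSpace ℝ (Fin N), rexp (-‖z‖ ^ 2)

lemma integrable_gauss (N : ℕ) :
    Integrable (fun z : EuclideanSpace ℝ (Fin N) => rexp (-‖z‖ ^ 2)) := by
  by_contra h
  have h1 := GaussianFourier.integral_rexp_neg_mul_sq_norm (V := EuclideanSpace ℝ (Fin N))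
    (b := 1) one_pos
  simp only [neg_mul, one_mul, div_one] at h1
  rw [integral_undef h] at h1
  have : 0 < π ^ ((Module.finrank ℝ (EuclideanSpace ℝ (Fin N)) : ℝ) / 2) := by positivity
  linarith

lemma gaussMass_pos (N : ℕ) : 0 < gaussMass N := by
  have h1 := GaussianFourier.integral_rexp_neg_mul_sq_norm (V := EuclideanSpace ℝ (Fin N))
    (b := 1) one_pos
  simp only [neg_mul, one_mul, div_one] at h1
  rw [gaussMass, h1]; positivity

/-- The heat extension of an initial datum. -/
noncomputable def heatExt {N : ℕ} (g : EuclideanSpace ℝ (Fin N) → ℝ)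
    (x : EuclideanSpace ℝ (Fin N)) (τ : ℝ) : ℝ :=
  (gaussMass N)⁻¹ * ∫ z : EuclideanSpace ℝ (Fin N), rexp (-‖z‖ ^ 2) * g (x + (2 * √τ) • z)

/-- The heat kernel. -/
noncomputable def heatKer (N : ℕ) (τ : ℝ) (y : EuclideanSpace ℝ (Fin N)) : ℝ :=
  (gaussMass N)⁻¹ * ((4 * τ) ^ (-(N : ℝ) / 2) * rexp (-(‖y‖ ^ 2 / (4 * τ))))

variable {N : ℕ} {g : EuclideanSpace ℝ (Fin N) → ℝ}

lemma heatExt_zero (g : EuclideanSpace ℝ (Fin N) → ℝ) (x : EuclideanSpace ℝ (Fin N)) :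
    heatExt g x 0 = g x := by
  have := (gaussMass_pos N).ne'
  simp only [heatExt, sqrt_zero, mul_zero, zero_smul, add_zero]
  rw [integral_mul_const]
  change (gaussMass N)⁻¹ * (gaussMass N * g x) = g x
  field_simp

lemma heatExt_nonneg (hg : ∀ x, 0 ≤ g x) (x : EuclideanSpace ℝ (Fin N)) (τ : ℝ) :
    0 ≤ heatExt g x τ := by
  refine mul_nonneg (inv_nonneg.2 (gaussMass_pos N).le) (integral_nonneg fun z => ?_)
  exact mul_nonneg (exp_pos _).le (hg _)

lemma continuous_heatExt (hg : Continuous g) (hc : HasCompactSupport g) :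
    Continuous (Function.uncurry (heatExt g)) := by
  obtain ⟨M, hM⟩ := hg.bounded_above_of_compact_support hc
  unfold Function.uncurry heatExt
  refine continuous_const.mul ?_
  refine continuous_of_dominated (bound := fun z => rexp (-‖z‖ ^ 2) * M) ?_ ?_
    ((integrable_gauss N).mul_const M) ?_
  · intro p
    apply Continuous.aestronglyMeasurable
    fun_prop
  · intro p
    filter_upwards with z
    rw [norm_mul, norm_of_nonneg (exp_pos _).le]
    exact mul_le_mul_of_nonneg_left (hM _) (exp_pos _).le
  · filter_upwards with z
    fun_prop

lemma heatExt_eq_integral (g : EuclideanSpace ℝ (Fin N) → ℝ) (x : EuclideanSpace ℝ (Fin N))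
    {τ : ℝ} (hτ : 0 < τ) : heatExt g x τ = ∫ y, heatKer N τ (y - x) * g y := by
  have hs : 0 < 2 * √τ := by positivity
  have h1 := Measure.integral_comp_smul (volume : Measure (EuclideanSpace ℝ (Fin N)))
    (fun w => rexp (-(‖w‖ ^ 2 / (4 * τ))) * g (x + w)) (2 * √τ)
  have h2 : ∀ z : EuclideanSpace ℝ (Fin N),
      rexp (-(‖(2 * √τ) • z‖ ^ 2 / (4 * τ))) = rexp (-‖z‖ ^ 2) := by
    intro z
    congr 1
    rw [norm_smul, norm_of_nonneg hs.le, mul_pow, mul_pow, sq_sqrt hτ.le]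
    field_simp; ring
  simp only [h2] at h1
  have h3 := integral_sub_right_eq_self (μ := (volume : Measure (EuclideanSpace ℝ (Fin N))))
    (fun w => rexp (-(‖w‖ ^ 2 / (4 * τ))) * g (x + w)) x
  rw [heatExt, h1, ← h3, smul_eq_mul, ← integral_const_mul, ← integral_const_mul]
  congr 1; ext y
  simp only [heatKer, add_sub_cancel]
  have h4 : |((2 * √τ) ^ Module.finrank ℝ (EuclideanSpace ℝ (Fin N)))⁻¹|
      = (4 * τ) ^ (-(N : ℝ) / 2) := by
    rw [abs_of_pos (by positivity), finrank_euclideanSpace_fin]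
    have : (4 * τ) = (2 * √τ) ^ (2 : ℝ) := by
      rw [rpow_two, mul_pow, sq_sqrt hτ.le]; norm_num
    rw [this, ← rpow_mul hs.le, ← rpow_natCast, ← rpow_neg hs.le]
    congr 1; ring
  rw [h4]; ring

lemma hasDerivAt_integral_mul_of_compactSupport (hg : Continuous g) (hc : HasCompactSupport g)
    {I : Set ℝ} (hI : IsOpen I) {K K' : ℝ → EuclideanSpace ℝ (Fin N) → ℝ}
    (hK : ∀ h ∈ I, Continuous (K h))
    (hK' : ContinuousOn (Function.uncurry K') (I ×ˢ univ))
    (hd : ∀ h ∈ I, ∀ y, HasDerivAt (fun h => K h y) (K' h y) h) {h₀ : ℝ} (hh : h₀ ∈ I) :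
    HasDerivAt (fun h => ∫ y, K h y * g y) (∫ y, K' h₀ y * g y) h₀ := by
  obtain ⟨ε, hε, hεI⟩ := Metric.nhds_basis_closedBall.mem_iff.1 (hI.mem_nhds hh)
  obtain ⟨C, hC⟩ := ((isCompact_closedBall h₀ ε).prod hc.isCompact).exists_bound_of_continuousOn
    (hK'.mono (prod_mono hεI (subset_univ _)))
  obtain ⟨M, hM⟩ := hg.bounded_above_of_compact_support hc
  have hK'c : ∀ h ∈ I, Continuous (K' h) := fun h hhI => by
    have : ContinuousOn (fun y => Function.uncurry K' (h, y)) univ :=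
      hK'.comp (by fun_prop) (fun y _ => ⟨hhI, mem_univ _⟩)
    exact continuousOn_univ.1 this
  refine (hasDerivAt_integral_of_dominated_loc_of_deriv_le
    (s := closedBall h₀ ε) (F' := fun h y => K' h y * g y)
    (bound := fun y => C * ‖g y‖) (closedBall_mem_nhds h₀ hε) ?_ ?_ ?_ ?_ ?_ ?_).2
  · filter_upwards [closedBall_mem_nhds h₀ hε] with h hh'
    exact ((hK h (hεI hh')).mul hg).aestronglyMeasurable
  · exact ((hK h₀ hh).mul hg).integrable_of_hasCompactSupport hc.mul_left
  · exact ((hK'c h₀ hh).mul hg).aestronglyMeasurable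
  · filter_upwards with y h hh'
    rw [norm_mul]
    by_cases hy : y ∈ tsupport g
    · exact mul_le_mul_of_nonneg_right (hC (h, y) ⟨hh', hy⟩) (norm_nonneg _)
    · simp [image_eq_zero_of_notMem_tsupport hy]
  · exact (hg.integrable_of_hasCompactSupport hc).norm.const_mul C
  · filter_upwards with y h hh'
    exact (hd h (hεI hh') y).mul_const _

/-- The directional derivative of the heat kernel integrand along `x + h e`. -/
noncomputable def heatKerLine (N : ℕ) (τ : ℝ) (x e : EuclideanSpace ℝ (Fin N)) (h : ℝ)
    (y : EuclideanSpace ℝ (Fin N)) : ℝ :=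
  heatKer N τ (y - (x + h • e)) * (inner ℝ (y - (x + h • e)) e / (2 * τ))

lemma hasDerivAt_heatKer_line {τ : ℝ} (hτ : 0 < τ) (x e y : EuclideanSpace ℝ (Fin N)) (h : ℝ) :
    HasDerivAt (fun h : ℝ => heatKer N τ (y - (x + h • e))) (heatKerLine N τ x e h y) h := by
  have h0 : HasDerivAt (fun h : ℝ => y - (x + h • e)) (-e) h := by
    have := ((hasDerivAt_id h).smul_const e).const_add x |>.const_sub y
    simpa using this
  have h1 := h0.norm_sq
  have h2 := (((h1.div_const (4 * τ)).neg.exp.const_mul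
    ((4 * τ) ^ (-(N : ℝ) / 2))).const_mul (gaussMass N)⁻¹)
  convert! h2 using 1
  simp only [heatKerLine, heatKer, inner_neg_right, Pi.neg_apply]
  field_simp; ring

lemma hasDerivAt_heatKerLine {τ : ℝ} (hτ : 0 < τ) (x e y : EuclideanSpace ℝ (Fin N))
    (he : ‖e‖ = 1) (h : ℝ) :
    HasDerivAt (fun h : ℝ => heatKerLine N τ x e h y)
      (heatKer N τ (y - (x + h • e)) *
        ((inner ℝ (y - (x + h • e)) e / (2 * τ)) ^ 2 - 1 / (2 * τ))) h := by
  have h0 : HasDerivAt (fun h : ℝ => y - (x + h • e)) (-e) h := by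
    have := ((hasDerivAt_id h).smul_const e).const_add x |>.const_sub y
    simpa using this
  have h1 : HasDerivAt (fun h : ℝ => (inner ℝ (y - (x + h • e)) e : ℝ)) (-1) h := by
    have := h0.inner ℝ (hasDerivAt_const h e)
    simpa [inner_neg_left, he] using this
  convert! (hasDerivAt_heatKer_line hτ x e y h).mul (h1.div_const (2 * τ)) using 1
  simp only [heatKerLine]
  field_simp; ring

lemma hasDerivAt_heatKer_time {τ : ℝ} (hτ : 0 < τ) (y : EuclideanSpace ℝ (Fin N)) :
    HasDerivAt (fun τ : ℝ => heatKer N τ y)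
      (heatKer N τ y * (‖y‖ ^ 2 / (4 * τ ^ 2) - N / (2 * τ))) τ := by
  have h0 : HasDerivAt (fun τ : ℝ => 4 * τ) 4 τ := by
    simpa using (hasDerivAt_id τ).const_mul (4 : ℝ)
  have h1 := h0.rpow_const (p := -(N : ℝ) / 2) (Or.inl (by positivity))
  have h2 := ((hasDerivAt_const τ (‖y‖ ^ 2)).div h0 (by positivity)).neg.exp
  convert! (h1.mul h2).const_mul (gaussMass N)⁻¹ using 1
  simp only [heatKer, Pi.div_apply, Pi.neg_apply]
  rw [rpow_sub_one (by positivity)]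
  field_simp; ring

lemma continuousOn_heatKer :
    ContinuousOn (Function.uncurry (heatKer N)) (Ioi 0 ×ˢ univ) := by
  unfold Function.uncurry heatKer
  intro p hp
  have hp : 0 < p.1 := hp.1
  have : (4 * p.1) ≠ 0 := by positivity
  apply ContinuousAt.continuousWithinAt
  refine continuousAt_const.mul (ContinuousAt.mul ?_ ?_)
  · exact ContinuousAt.rpow_const (by fun_prop) (Or.inl this)
  · refine ContinuousAt.rexp ?_
    exact ContinuousAt.neg (ContinuousAt.div (by fun_prop) (by fun_prop) this)

lemma continuous_heatKer {τ : ℝ} : Continuous (heatKer N τ) := by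
  unfold heatKer; fun_prop

/-- `w` solves `∂ₜ w - Σ ∂ᵢᵢ w = d` at `(x, σ)` in the sense of classical derivatives along the
coordinate lines. -/
def HasHeatOpAt (w : EuclideanSpace ℝ (Fin N) → ℝ → ℝ) (d : ℝ) (x : EuclideanSpace ℝ (Fin N))
    (σ : ℝ) : Prop :=
  ∃ (wt : ℝ) (w1 : Fin N → ℝ → ℝ) (w2 : Fin N → ℝ),
    HasDerivAt (fun s => w x s) wt σ ∧
    (∀ i, ∀ h, HasDerivAt (fun h : ℝ => w (x + h • EuclideanSpace.single i 1) σ) (w1 i h) h) ∧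
    (∀ i, HasDerivAt (w1 i) (w2 i) 0) ∧ wt - ∑ i, w2 i = d

lemma HasHeatOpAt.add {w v : EuclideanSpace ℝ (Fin N) → ℝ → ℝ} {d d' : ℝ}
    {x : EuclideanSpace ℝ (Fin N)} {σ : ℝ} (hw : HasHeatOpAt w d x σ)
    (hv : HasHeatOpAt v d' x σ) : HasHeatOpAt (fun x s => w x s + v x s) (d + d') x σ := by
  obtain ⟨wt, w1, w2, h1, h2, h3, h4⟩ := hw
  obtain ⟨vt, v1, v2, k1, k2, k3, k4⟩ := hv
  refine ⟨wt + vt, fun i h => w1 i h + v1 i h, fun i => w2 i + v2 i, h1.add k1,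
    fun i h => (h2 i h).add (k2 i h), fun i => (h3 i).add (k3 i), ?_⟩
  rw [Finset.sum_add_distrib]; linarith

lemma HasHeatOpAt.const_mul {w : EuclideanSpace ℝ (Fin N) → ℝ → ℝ} {d : ℝ}
    {x : EuclideanSpace ℝ (Fin N)} {σ : ℝ} (c : ℝ) (hw : HasHeatOpAt w d x σ) :
    HasHeatOpAt (fun x s => c * w x s) (c * d) x σ := by
  obtain ⟨wt, w1, w2, h1, h2, h3, h4⟩ := hw
  refine ⟨c * wt, fun i h => c * w1 i h, fun i => c * w2 i, h1.const_mul c,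
    fun i h => (h2 i h).const_mul c, fun i => (h3 i).const_mul c, ?_⟩
  rw [← Finset.mul_sum, ← h4]; ring

lemma HasHeatOpAt.sub {w v : EuclideanSpace ℝ (Fin N) → ℝ → ℝ} {d d' : ℝ}
    {x : EuclideanSpace ℝ (Fin N)} {σ : ℝ} (hw : HasHeatOpAt w d x σ)
    (hv : HasHeatOpAt v d' x σ) : HasHeatOpAt (fun x s => w x s - v x s) (d - d') x σ := by
  have := hw.add (hv.const_mul (-1))
  simpa [sub_eq_add_neg] using this

lemma hasHeatOpAt_time (a b s₀ : ℝ) (x : EuclideanSpace ℝ (Fin N)) (σ : ℝ) :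
    HasHeatOpAt (fun _ s => a + b * (s - s₀)) b x σ := by
  refine ⟨b, fun _ _ => 0, fun _ => 0, ?_, fun i h => hasDerivAt_const _ _,
    fun i => hasDerivAt_const _ _, by simp⟩
  simpa using (((hasDerivAt_id σ).sub_const s₀).const_mul b).const_add a

lemma hasHeatOpAt_normSq (x₀ x : EuclideanSpace ℝ (Fin N)) (σ : ℝ) :
    HasHeatOpAt (fun y _ => ‖y - x₀‖ ^ 2) (-(2 * N)) x σ := by
  refine ⟨0, fun i h => 2 * inner ℝ (x + h • EuclideanSpace.single i 1 - x₀)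
    (EuclideanSpace.single i 1), fun _ => 2, hasDerivAt_const _ _, fun i h => ?_, fun i => ?_,
    by simp; ring⟩
  · have : HasDerivAt (fun h : ℝ => x + h • EuclideanSpace.single i (1 : ℝ) - x₀)
        (EuclideanSpace.single i (1 : ℝ)) h := by
      simpa using (((hasDerivAt_id h).smul_const _).const_add x).sub_const x₀
    simpa using this.norm_sq
  · have : HasDerivAt (fun h : ℝ => x + h • EuclideanSpace.single i (1 : ℝ) - x₀)
        (EuclideanSpace.single i (1 : ℝ)) 0 := by
      simpa using (((hasDerivAt_id (0 : ℝ)).smul_const _).const_add x).sub_const x₀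
    simpa using (this.inner ℝ (hasDerivAt_const (0 : ℝ) (EuclideanSpace.single i (1 : ℝ)))).const_mul 2

lemma hasHeatOpAt_linear (ℓ : EuclideanSpace ℝ (Fin N) →L[ℝ] ℝ) (x₀ x : EuclideanSpace ℝ (Fin N))
    (σ : ℝ) : HasHeatOpAt (fun y _ => ℓ (y - x₀)) 0 x σ := by
  refine ⟨0, fun i h => ℓ (EuclideanSpace.single i 1), fun _ => 0, hasDerivAt_const _ _,
    fun i h => ?_, fun i => hasDerivAt_const _ _, by simp⟩
  have : HasDerivAt (fun h : ℝ => x + h • EuclideanSpace.single i (1 : ℝ) - x₀)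
      (EuclideanSpace.single i (1 : ℝ)) h := by
    simpa using (((hasDerivAt_id h).smul_const _).const_add x).sub_const x₀
  exact ℓ.hasFDerivAt.comp_hasDerivAt h this

lemma hasHeatOpAt_heatExt (hg : Continuous g) (hc : HasCompactSupport g) (s : ℝ)
    (x : EuclideanSpace ℝ (Fin N)) {σ : ℝ} (hσ : s < σ) :
    HasHeatOpAt (fun x σ => heatExt g x (σ - s)) 0 x σ := by
  have hτ : 0 < σ - s := by linarith
  set τ := σ - s with hτdef
  refine ⟨∫ y, heatKer N τ (y - x) * (‖y - x‖ ^ 2 / (4 * τ ^ 2) - N / (2 * τ)) * g y,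
    fun i h => ∫ y, heatKerLine N τ x (EuclideanSpace.single i 1) h y * g y,
    fun i => ∫ y, heatKer N τ (y - (x + (0 : ℝ) • EuclideanSpace.single i (1 : ℝ))) *
        ((inner ℝ (y - (x + (0 : ℝ) • EuclideanSpace.single i (1 : ℝ)))
          (EuclideanSpace.single i (1 : ℝ)) / (2 * τ)) ^ 2 - 1 / (2 * τ)) * g y, ?_, ?_, ?_, ?_⟩
  · have h1 : HasDerivAt (fun τ => ∫ y, heatKer N τ (y - x) * g y)
        (∫ y, heatKer N τ (y - x) * (‖y - x‖ ^ 2 / (4 * τ ^ 2) - N / (2 * τ)) * g y) τ := by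
      refine hasDerivAt_integral_mul_of_compactSupport hg hc isOpen_Ioi
        (K := fun τ y => heatKer N τ (y - x))
        (K' := fun τ y => heatKer N τ (y - x) * (‖y - x‖ ^ 2 / (4 * τ ^ 2) - N / (2 * τ)))
        (fun h _ => continuous_heatKer.comp (by fun_prop)) ?_
        (fun h hh y => hasDerivAt_heatKer_time hh _) hτ
      have h2 : ContinuousOn (fun p : ℝ × EuclideanSpace ℝ (Fin N) =>
          Function.uncurry (heatKer N) (p.1, p.2 - x)) (Ioi 0 ×ˢ univ) :=
        continuousOn_heatKer.comp (by fun_prop) (fun p hp => ⟨hp.1, mem_univ _⟩)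
      refine h2.mul (ContinuousOn.sub (ContinuousOn.div (by fun_prop) (by fun_prop) ?_)
        (ContinuousOn.div (by fun_prop) (by fun_prop) ?_)) <;>
      · rintro p ⟨hp, -⟩
        have : 0 < p.1 := hp
        positivity
    have h2 : HasDerivAt (fun τ => heatExt g x τ)
        (∫ y, heatKer N τ (y - x) * (‖y - x‖ ^ 2 / (4 * τ ^ 2) - N / (2 * τ)) * g y) τ := by
      refine h1.congr_of_eventuallyEq ?_
      filter_upwards [lt_mem_nhds hτ] with a ha
      exact heatExt_eq_integral g x ha
    have h3 : HasDerivAt (fun σ : ℝ => σ - s) 1 σ := (hasDerivAt_id σ).sub_const s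
    have h4 := h2.comp σ h3
    rw [mul_one] at h4
    exact h4
  · intro i h
    have : HasDerivAt (fun h : ℝ => ∫ y, heatKer N τ (y - (x + h • EuclideanSpace.single i (1:ℝ))) * g y)
        (∫ y, heatKerLine N τ x (EuclideanSpace.single i 1) h y * g y) h := by
      refine hasDerivAt_integral_mul_of_compactSupport hg hc isOpen_univ
        (K := fun h y => heatKer N τ (y - (x + h • EuclideanSpace.single i (1:ℝ))))
        (K' := fun h y => heatKerLine N τ x (EuclideanSpace.single i 1) h y)
        (fun h _ => continuous_heatKer.comp (by fun_prop)) ?_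
        (fun h hh y => hasDerivAt_heatKer_line hτ _ _ _ _) (mem_univ h)
      apply Continuous.continuousOn
      unfold Function.uncurry heatKerLine
      exact (continuous_heatKer.comp (by fun_prop)).mul (by fun_prop)
    refine this.congr_of_eventuallyEq ?_
    filter_upwards with a
    exact heatExt_eq_integral g _ hτ
  · intro i
    refine hasDerivAt_integral_mul_of_compactSupport hg hc isOpen_univ
        (K := fun h y => heatKerLine N τ x (EuclideanSpace.single i 1) h y)
        (K' := fun h y => heatKer N τ (y - (x + h • EuclideanSpace.single i (1 : ℝ))) *
        ((inner ℝ (y - (x + h • EuclideanSpace.single i (1 : ℝ)))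
          (EuclideanSpace.single i (1 : ℝ)) / (2 * τ)) ^ 2 - 1 / (2 * τ)))
        (fun h _ => ?_) ?_
        (fun h hh y => hasDerivAt_heatKerLine hτ _ _ _ (by simp) _) (mem_univ 0)
    · unfold heatKerLine
      exact (continuous_heatKer.comp (by fun_prop)).mul (by fun_prop)
    · apply Continuous.continuousOn
      unfold Function.uncurry
      exact (continuous_heatKer.comp (by fun_prop)).mul (by fun_prop)
  · simp only [zero_smul, add_zero]
    rw [← integral_finsetSum, sub_eq_zero]
    · congr 1; ext y
      rw [← Finset.sum_mul, ← Finset.mul_sum]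
      congr 2
      rw [Finset.sum_sub_distrib, Finset.sum_const, Finset.card_univ, Fintype.card_fin]
      simp only [div_pow, ← Finset.sum_div, EuclideanSpace.inner_single_right, nsmul_eq_mul]
      rw [EuclideanSpace.norm_sq_eq]
      simp
      ring
    · intro i _
      refine Continuous.integrable_of_hasCompactSupport ?_ hc.mul_left
      exact ((continuous_heatKer.comp (by fun_prop)).mul (by fun_prop)).mul hg

end HeatExtension

section Comparison

open Filter Topology

variable {N : ℕ}

lemma heatKer_le {τ : ℝ} (hτ : 0 < τ) (y : EuclideanSpace ℝ (Fin N)) :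
    heatKer N τ y ≤ (gaussMass N)⁻¹ * (4 * τ) ^ (-(N : ℝ) / 2) := by
  have := gaussMass_pos N
  unfold heatKer
  gcongr
  refine mul_le_of_le_one_right (by positivity) (exp_le_one_iff.2 ?_)
  have : 0 ≤ ‖y‖ ^ 2 / (4 * τ) := by positivity
  linarith

lemma heatExt_le_of_heatKer_le {g : EuclideanSpace ℝ (Fin N) → ℝ} (hg : Continuous g)
    (hc : HasCompactSupport g) (h0 : ∀ x, 0 ≤ g x) {τ c : ℝ} (hτ : 0 < τ)
    (x : EuclideanSpace ℝ (Fin N)) (hle : ∀ y ∈ tsupport g, heatKer N τ (y - x) ≤ c) :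
    heatExt g x τ ≤ c * ∫ y, g y := by
  rw [heatExt_eq_integral g x hτ, ← integral_const_mul]
  refine integral_mono ?_ ((hg.integrable_of_hasCompactSupport hc).const_mul _) fun y => ?_
  · exact ((continuous_heatKer.comp (by fun_prop)).mul hg).integrable_of_hasCompactSupport
      hc.mul_left
  · by_cases hy : y ∈ tsupport g
    · exact mul_le_mul_of_nonneg_right (hle y hy) (h0 y)
    · simp [image_eq_zero_of_notMem_tsupport hy]

lemma le_heatExt_of_le_heatKer {g : EuclideanSpace ℝ (Fin N) → ℝ} (hg : Continuous g)
    (hc : HasCompactSupport g) (h0 : ∀ x, 0 ≤ g x) {τ c : ℝ} (hτ : 0 < τ)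
    (x : EuclideanSpace ℝ (Fin N)) (hle : ∀ y ∈ tsupport g, c ≤ heatKer N τ (y - x)) :
    c * ∫ y, g y ≤ heatExt g x τ := by
  rw [heatExt_eq_integral g x hτ, ← integral_const_mul]
  refine integral_mono ((hg.integrable_of_hasCompactSupport hc).const_mul _) ?_ fun y => ?_
  · exact ((continuous_heatKer.comp (by fun_prop)).mul hg).integrable_of_hasCompactSupport
      hc.mul_left
  · by_cases hy : y ∈ tsupport g
    · exact mul_le_mul_of_nonneg_right (hle y hy) (h0 y)
    · simp [image_eq_zero_of_notMem_tsupport hy]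

lemma hasHeatOpAt_of_contDiff {U : EuclideanSpace ℝ (Fin N) → ℝ → ℝ}
    (hx : ∀ t, ContDiff ℝ 2 (fun x => U x t)) (ht : ∀ x, ContDiff ℝ 1 (fun t => U x t))
    (x : EuclideanSpace ℝ (Fin N)) (t : ℝ) :
    HasHeatOpAt U (deriv (fun s => U x s) t - lap (fun y => U y t) x) x t := by
  have hf := hx t
  have hd : Differentiable ℝ (fun y => U y t) := hf.differentiable (by norm_num)
  have hd2 : Differentiable ℝ (fderiv ℝ (fun y => U y t)) :=
    (hf.fderiv_right (m := 1) (by norm_num)).differentiable (by norm_num)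
  have hl : ∀ (e : EuclideanSpace ℝ (Fin N)) (h : ℝ), HasDerivAt (fun h : ℝ => x + h • e) e h := by
    intro e h
    simpa using ((hasDerivAt_id h).smul_const e).const_add x
  refine ⟨deriv (fun s => U x s) t,
    fun i h => fderiv ℝ (fun y => U y t) (x + h • EuclideanSpace.single i 1)
      (EuclideanSpace.single i 1),
    fun i => iteratedFDeriv ℝ 2 (fun y => U y t) x
      ![EuclideanSpace.single i 1, EuclideanSpace.single i 1],
    ((ht x).differentiable (by norm_num) t).hasDerivAt, fun i h => ?_, fun i => ?_, rfl⟩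
  · exact (hd _).hasFDerivAt.comp_hasDerivAt h (hl _ h)
  · simp only [iteratedFDeriv_two_apply]
    have h1 := (hd2 (x + (0 : ℝ) • EuclideanSpace.single i (1:ℝ))).hasFDerivAt.comp_hasDerivAt 0
      (hl (EuclideanSpace.single i 1) 0)
    have h2 := h1.clm_apply (hasDerivAt_const (0 : ℝ) (EuclideanSpace.single i (1:ℝ)))
    simpa using h2

lemma nonneg_second_deriv_of_isLocalMin {f f1 : ℝ → ℝ} {c : ℝ} (h1 : ∀ h, HasDerivAt f (f1 h) h)
    (h2 : HasDerivAt f1 c 0) (hmin : IsLocalMin f 0) : 0 ≤ c := by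
  by_contra! hc
  have hdf : deriv f = f1 := funext fun h => (h1 h).deriv
  have h3 : IsLocalMax f 0 := isLocalMax_of_deriv_deriv_neg (by rw [hdf, h2.deriv]; exact hc)
    hmin.deriv_eq_zero (h1 0).continuousAt
  have h4 : f =ᶠ[𝓝 0] fun _ => f 0 := by
    filter_upwards [hmin, h3] with y hy hy' using le_antisymm hy' hy
  have h5 : f1 =ᶠ[𝓝 0] fun _ => 0 := by
    have := h4.deriv
    rw [hdf] at this
    simpa using this
  have h6 := h5.deriv_eq
  rw [h2.deriv] at h6
  simp at h6
  linarith

/-- Strict classical subsolutions of the heat equation on a parabolic cylinder, nonpositive on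
the lateral boundary. -/
structure StrictSub (x₀ : EuclideanSpace ℝ (Fin N)) (ρ s t : ℝ)
    (w : EuclideanSpace ℝ (Fin N) → ℝ → ℝ) : Prop where
  cont : ContinuousOn (Function.uncurry w) (closedBall x₀ ρ ×ˢ Icc s t)
  bdry : ∀ x ∈ sphere x₀ ρ, ∀ σ ∈ Icc s t, w x σ ≤ 0
  op : ∀ σ ∈ Ioc s t, ∀ x ∈ ball x₀ ρ, ∃ d < 0, HasHeatOpAt w d x σ

/-- Positive supersolutions of the heat equation on a parabolic cylinder, with separate
regularity only. -/
structure PosSuper (x₀ : EuclideanSpace ℝ (Fin N)) (ρ a b : ℝ)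
    (U : EuclideanSpace ℝ (Fin N) → ℝ → ℝ) : Prop where
  c2 : ∀ t, ContDiff ℝ 2 (fun x => U x t)
  c1 : ∀ x, ContDiff ℝ 1 (fun t => U x t)
  pos : ∀ x ∈ closedBall x₀ ρ, ∀ t ∈ Icc a b, 0 < U x t
  super : ∀ x ∈ closedBall x₀ ρ, ∀ t ∈ Icc a b, ∃ d, 0 ≤ d ∧ HasHeatOpAt U d x t

variable {x₀ : EuclideanSpace ℝ (Fin N)} {ρ a b : ℝ} {U : EuclideanSpace ℝ (Fin N) → ℝ → ℝ}

lemma StrictSub.mono {s t s' t' : ℝ} {w : EuclideanSpace ℝ (Fin N) → ℝ → ℝ}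
    (h : StrictSub x₀ ρ s t w) (hs : s ≤ s') (ht : t' ≤ t) : StrictSub x₀ ρ s' t' w where
  cont := h.cont.mono (prod_mono le_rfl (Icc_subset_Icc hs ht))
  bdry x hx σ hσ := h.bdry x hx σ (Icc_subset_Icc hs ht hσ)
  op σ hσ x hx := h.op σ (Ioc_subset_Ioc hs ht hσ) x hx

lemma StrictSub.false_of_touching {s t : ℝ} {w : EuclideanSpace ℝ (Fin N) → ℝ → ℝ}
    (hU : PosSuper x₀ ρ a b U) (hw : StrictSub x₀ ρ s t w) (has : a ≤ s) (htb : t ≤ b)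
    {x : EuclideanSpace ℝ (Fin N)} (hx : x ∈ closedBall x₀ ρ) {σ : ℝ} (hσ : σ ∈ Ioc s t)
    (hle : U x σ ≤ w x σ) (hge : ∀ y ∈ closedBall x₀ ρ, w y σ ≤ U y σ)
    (hpast : ∀ᶠ τ in 𝓝[<] σ, w x τ ≤ U x τ) : False := by
  have hσ' : σ ∈ Icc a b := ⟨has.trans hσ.1.le, hσ.2.trans htb⟩
  have hxb : x ∈ ball x₀ ρ := by
    rcases (mem_closedBall.1 hx).lt_or_eq with h | h
    · exact h
    · have := hw.bdry x h σ ⟨hσ.1.le, hσ.2⟩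
      have := hU.pos x hx σ hσ'
      linarith
  obtain ⟨d, hd, hop⟩ := hw.op σ hσ x hxb
  obtain ⟨d', h5, hopU⟩ := hU.super x hx σ hσ'
  obtain ⟨Dt, D1, D2, h1, h2, h3, h4⟩ := hopU.sub hop
  have heq : U x σ - w x σ = 0 := by have := hge x hx; linarith
  have hDt : Dt ≤ 0 := by
    have h6 := (hasDerivAt_iff_tendsto_slope_left_right.1 h1).1
    refine le_of_tendsto h6 ?_
    filter_upwards [hpast, self_mem_nhdsWithin] with τ h7 h8
    rw [slope_def_field, heq]
    have : τ < σ := h8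
    exact div_nonpos_of_nonneg_of_nonpos (by linarith) (by linarith)
  have hD2 : ∀ i, 0 ≤ D2 i := by
    intro i
    refine nonneg_second_deriv_of_isLocalMin (h2 i) (h3 i) ?_
    have hcont : Tendsto (fun h : ℝ => x + h • EuclideanSpace.single i (1 : ℝ)) (𝓝 0) (𝓝 x) := by
      have : Continuous (fun h : ℝ => x + h • EuclideanSpace.single i (1 : ℝ)) := by fun_prop
      simpa using this.tendsto 0
    filter_upwards [hcont (isOpen_ball.mem_nhds hxb)] with h hh
    have := hge _ (ball_subset_closedBall hh)
    simp only [zero_smul, add_zero, heq]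
    linarith
  have := Finset.sum_nonneg fun i (_ : i ∈ Finset.univ) => hD2 i
  linarith

/-- The comparison principle holds on all subcylinders with times in `I`. -/
def ComparisonOn (x₀ : EuclideanSpace ℝ (Fin N)) (ρ a b : ℝ)
    (U : EuclideanSpace ℝ (Fin N) → ℝ → ℝ) (I : Set ℝ) : Prop :=
  ∀ s t, s ∈ I → t ∈ I → s ≤ t → a ≤ s → t ≤ b → ∀ w, StrictSub x₀ ρ s t w →
    (∀ x ∈ closedBall x₀ ρ, w x s < U x s) →
    ∀ σ ∈ Icc s t, ∀ x ∈ closedBall x₀ ρ, w x σ < U x σ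

lemma StrictSub.exists_first_failure {s t : ℝ} {w : EuclideanSpace ℝ (Fin N) → ℝ → ℝ}
    (hU : PosSuper x₀ ρ a b U) (hw : StrictSub x₀ ρ s t w) (has : a ≤ s) (htb : t ≤ b)
    (hini : ∀ x ∈ closedBall x₀ ρ, w x s < U x s)
    (hfail : ¬ ∀ σ ∈ Icc s t, ∀ x ∈ closedBall x₀ ρ, w x σ < U x σ) :
    ∃ t' ∈ Ico s t, (∀ σ ∈ Icc s t', ∀ x ∈ closedBall x₀ ρ, w x σ < U x σ) ∧
      ∀ δ > 0, ∃ σ ∈ Ioo t' (t' + δ), σ ≤ t ∧ ∃ x ∈ closedBall x₀ ρ, U x σ ≤ w x σ := by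
  set F : Set ℝ := {σ | σ ∈ Icc s t ∧ ∃ x ∈ closedBall x₀ ρ, U x σ ≤ w x σ} with hF
  have hne : F.Nonempty := by
    push Not at hfail
    obtain ⟨σ, hσ, x, hx, h⟩ := hfail
    exact ⟨σ, hσ, x, hx, h⟩
  have hbdd : BddBelow F := ⟨s, fun σ hσ => hσ.1.1⟩
  have hs' : s ≤ sInf F := le_csInf hne fun σ hσ => hσ.1.1
  have hbefore : ∀ σ, s ≤ σ → σ < sInf F → ∀ x ∈ closedBall x₀ ρ, w x σ < U x σ := by
    intro σ h1 h2 x hx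
    by_contra! h
    obtain ⟨σ', hσ'⟩ := hne
    have h3 : σ ≤ t := (h2.le.trans (csInf_le hbdd hσ')).trans hσ'.1.2
    exact absurd (csInf_le hbdd ⟨⟨h1, h3⟩, x, hx, h⟩) (not_le.2 h2)
  have ht' : sInf F ≤ t := by
    obtain ⟨σ', hσ'⟩ := hne
    exact (csInf_le hbdd hσ').trans hσ'.1.2
  have hnot : sInf F ∉ F := by
    rintro ⟨-, x, hx, hle⟩
    have hlt : s < sInf F := by
      rcases hs'.lt_or_eq with h | h
      · exact h
      · rw [← h] at hle
        exact absurd (hini x hx) (not_lt.2 hle)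
    have hev : ∀ᶠ τ in 𝓝[<] (sInf F), τ ∈ Ioo s (sInf F) := Ioo_mem_nhdsLT hlt
    refine hw.false_of_touching hU has htb hx ⟨hlt, ht'⟩ hle (fun y hy => ?_) ?_
    · have hwc : ContinuousWithinAt (fun τ => w y τ) (Icc s t) (sInf F) :=
        (hw.cont (y, sInf F) ⟨hy, hs', ht'⟩).comp (f := fun τ => (y, τ)) (by fun_prop)
          (fun τ hτ => ⟨hy, hτ⟩)
      have hwl : Tendsto (fun τ => w y τ) (𝓝[<] (sInf F)) (𝓝 (w y (sInf F))) := by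
        refine hwc.mono_left ?_
        rw [← nhdsWithin_Ioo_eq_nhdsLT hlt]
        exact nhdsWithin_mono _ fun τ hτ => ⟨hτ.1.le, hτ.2.le.trans ht'⟩
      have hul : Tendsto (fun τ => U y τ) (𝓝[<] (sInf F)) (𝓝 (U y (sInf F))) :=
        ((hU.c1 y).continuous.tendsto _).mono_left nhdsWithin_le_nhds
      refine le_of_tendsto_of_tendsto hwl hul ?_
      filter_upwards [hev] with τ hτ
      exact (hbefore τ hτ.1.le hτ.2 y hy).le
    · filter_upwards [hev] with τ hτ
      exact (hbefore τ hτ.1.le hτ.2 x hx).le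
  have hlt' : ∀ δ > 0, ∃ σ ∈ Ioo (sInf F) (sInf F + δ), σ ≤ t ∧
      ∃ x ∈ closedBall x₀ ρ, U x σ ≤ w x σ := by
    intro δ hδ
    obtain ⟨σ, hσ, hlt⟩ := exists_lt_of_csInf_lt hne (lt_add_of_pos_right (sInf F) hδ)
    refine ⟨σ, ⟨lt_of_le_of_ne (csInf_le hbdd hσ) ?_, hlt⟩, hσ.1.2, hσ.2⟩
    rintro h
    exact hnot (h ▸ hσ)
  refine ⟨sInf F, ⟨hs', ?_⟩, fun σ hσ x hx => ?_, hlt'⟩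
  · obtain ⟨σ, hσ, h, -⟩ := hlt' 1 one_pos
    exact hσ.1.trans_le h
  · rcases hσ.2.lt_or_eq with h | h
    · exact hbefore σ hσ.1 h x hx
    · by_contra! hc
      exact hnot (h ▸ ⟨⟨hσ.1, h ▸ ht'⟩, x, hx, hc⟩)

lemma StrictSub.lt_of_locally {s t : ℝ} {w : EuclideanSpace ℝ (Fin N) → ℝ → ℝ}
    (hU : PosSuper x₀ ρ a b U) (hw : StrictSub x₀ ρ s t w) (has : a ≤ s) (htb : t ≤ b)
    (hini : ∀ x ∈ closedBall x₀ ρ, w x s < U x s)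
    (hloc : ∀ τ ∈ Icc s t, ∃ δ > 0, ComparisonOn x₀ ρ a b U (Ioo (τ - δ) (τ + δ))) :
    ∀ σ ∈ Icc s t, ∀ x ∈ closedBall x₀ ρ, w x σ < U x σ := by
  by_contra hfail
  obtain ⟨t', ht', h1, h2⟩ := hw.exists_first_failure hU has htb hini hfail
  obtain ⟨δ, hδ, hcomp⟩ := hloc t' ⟨ht'.1, ht'.2.le⟩
  obtain ⟨σ, hσ, hσt, x, hx, hle⟩ := h2 δ hδ
  have := hcomp t' σ ⟨by linarith, by linarith⟩ ⟨by linarith [hσ.1], hσ.2⟩ hσ.1.le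
    (has.trans ht'.1) (hσt.trans htb) w (hw.mono ht'.1 hσt) (h1 t' ⟨ht'.1, le_rfl⟩) σ
    ⟨hσ.1.le, le_rfl⟩ x hx
  linarith

lemma StrictSub.le_of_tendsto_initial {α σ t s : ℝ} {w : EuclideanSpace ℝ (Fin N) → ℝ → ℝ}
    (hU : PosSuper x₀ ρ a b U) (hw : StrictSub x₀ ρ s t w) (has : a ≤ s) (htb : t ≤ b)
    (hα : s ≤ α) (hασ : α < σ) (hσ : σ ≤ t)
    (hini : ∀ x ∈ closedBall x₀ ρ, w x α < U x α)
    (hloc : ∀ τ ∈ Ioc α σ, ∃ δ > 0, ComparisonOn x₀ ρ a b U (Ioo (τ - δ) (τ + δ))) :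
    ∀ x ∈ closedBall x₀ ρ, w x σ ≤ U x σ := by
  intro x hx
  set g : ℝ → EuclideanSpace ℝ (Fin N) → ℝ :=
    fun s' => (closedBall x₀ ρ).indicator (fun y => max (w y s' - U y s') 0) with hgdef
  have hcpt : IsCompact (closedBall x₀ ρ) := isCompact_closedBall x₀ ρ
  have hst : ∀ s' ∈ Icc α σ, s' ∈ Icc s t := fun s' h => ⟨hα.trans h.1, h.2.trans hσ⟩
  have hab : ∀ s' ∈ Icc α σ, s' ∈ Icc a b :=
    fun s' h => ⟨has.trans (hst s' h).1, (hst s' h).2.trans htb⟩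
  have hwc : ∀ s' ∈ Icc α σ, ContinuousOn (fun y => w y s') (closedBall x₀ ρ) := fun s' h =>
    hw.cont.comp (f := fun y => (y, s')) (by fun_prop) (fun y hy => ⟨hy, hst s' h⟩)
  have hg0 : ∀ s' y, 0 ≤ g s' y := fun s' y => indicator_nonneg (fun _ _ => le_max_right _ _) _
  have hgc : ∀ s' ∈ Icc α σ, Continuous (g s') := by
    intro s' h
    refine continuous_indicator (fun y hy => ?_) ?_
    · have hy' := frontier_closedBall_subset_sphere hy
      have h1 := hw.bdry y hy' s' (hst s' h)
      have h2 := hU.pos y (sphere_subset_closedBall hy') s' (hab s' h)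
      exact max_eq_right (by linarith)
    · rw [isClosed_closedBall.closure_eq]
      exact ((hwc s' h).sub (hU.c2 s').continuous.continuousOn).sup continuousOn_const
  have hgs : ∀ s', HasCompactSupport (g s') := fun s' =>
    HasCompactSupport.intro hcpt fun y hy => indicator_of_notMem hy _
  have hmain : ∀ s' ∈ Ioo α σ, w x σ ≤ U x σ + heatExt (g s') x (σ - s') := by
    intro s' hs'
    have hs'' : s' ∈ Icc α σ := ⟨hs'.1.le, hs'.2.le⟩
    refine le_of_forall_pos_le_add fun ε hε => ?_
    have hsub : StrictSub x₀ ρ s' σ (fun y τ => w y τ - heatExt (g s') y (τ - s') - ε) := by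
      refine ⟨?_, ?_, ?_⟩
      · refine ((hw.mono (hα.trans hs'.1.le) hσ).cont.sub ?_).sub continuousOn_const
        exact ((continuous_heatExt (hgc s' hs'') (hgs s')).comp
          (f := fun p : EuclideanSpace ℝ (Fin N) × ℝ => (p.1, p.2 - s'))
          (by fun_prop)).continuousOn
      · intro y hy τ hτ
        have h1 := hw.bdry y hy τ ⟨(hα.trans hs'.1.le).trans hτ.1, hτ.2.trans hσ⟩
        have h2 := heatExt_nonneg (hg0 s') y (τ - s')
        linarith
      · intro τ hτ y hy
        obtain ⟨d, hd, hop⟩ := hw.op τ ⟨(hα.trans hs'.1.le).trans_lt hτ.1, hτ.2.trans hσ⟩ y hy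
        refine ⟨d - 0 - 0, by linarith, (hop.sub (hasHeatOpAt_heatExt (hgc s' hs'') (hgs s') s'
          y hτ.1)).sub ?_⟩
        simpa using hasHeatOpAt_time ε 0 0 y τ
    have h1 := hsub.lt_of_locally hU (has.trans (hst s' hs'').1) (hσ.trans htb) (fun y hy => ?_)
      (fun τ hτ => hloc τ ⟨hs'.1.trans_le hτ.1, hτ.2⟩) σ ⟨hs'.2.le, le_rfl⟩ x hx
    · linarith
    · simp only [sub_self, heatExt_zero]
      simp only [hgdef, indicator_of_mem hy]
      have := le_max_left (w y s' - U y s') 0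
      linarith
  obtain ⟨M, hM⟩ := (hcpt.prod isCompact_Icc).exists_bound_of_continuousOn hw.cont
  have hnhds : ∀ᶠ s' in 𝓝[>] α, s' ∈ Ioo α σ := Ioo_mem_nhdsGT hασ
  have h_integrable : Tendsto (fun s' => ∫ y, g s' y) (𝓝[>] α) (𝓝 (∫ _ : EuclideanSpace ℝ (Fin N), (0 : ℝ))) := by
    refine tendsto_integral_filter_of_dominated_convergence
      (fun y => (closedBall x₀ ρ).indicator (fun _ => M) y) ?_ ?_ ?_ ?_
    · filter_upwards [hnhds] with s' hs'
      exact (hgc s' ⟨hs'.1.le, hs'.2.le⟩).aestronglyMeasurable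
    · filter_upwards [hnhds] with s' hs'
      filter_upwards with y
      rw [norm_of_nonneg (hg0 s' y)]
      by_cases hy : y ∈ closedBall x₀ ρ
      · simp only [hgdef, indicator_of_mem hy]
        have h0 := hst s' ⟨hs'.1.le, hs'.2.le⟩
        have h1 := hM (y, s') ⟨hy, h0⟩
        have h2 := hU.pos y hy s' (hab s' ⟨hs'.1.le, hs'.2.le⟩)
        have h3 := le_abs_self (w y s')
        simp only [Function.uncurry, Real.norm_eq_abs] at h1
        exact max_le (by linarith) ((abs_nonneg _).trans h1)
      · simp [hgdef, indicator_of_notMem hy]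
    · rw [integrable_indicator_iff isClosed_closedBall.measurableSet]
      exact integrableOn_const hcpt.measure_lt_top.ne
    · filter_upwards with y
      by_cases hy : y ∈ closedBall x₀ ρ
      · simp only [hgdef, indicator_of_mem hy]
        have hwl : Tendsto (fun τ => w y τ) (𝓝[>] α) (𝓝 (w y α)) := by
          have h1 : ContinuousWithinAt (fun τ => w y τ) (Icc s t) α :=
            (hw.cont (y, α) ⟨hy, hα, hασ.le.trans hσ⟩).comp (f := fun τ => (y, τ)) (by fun_prop)
              (fun τ hτ => ⟨hy, hτ⟩)
          refine h1.mono_left ?_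
          rw [← nhdsWithin_Ioo_eq_nhdsGT hασ]
          exact nhdsWithin_mono _ fun τ hτ => ⟨hα.trans hτ.1.le, hτ.2.le.trans hσ⟩
        have hul : Tendsto (fun τ => U y τ) (𝓝[>] α) (𝓝 (U y α)) :=
          ((hU.c1 y).continuous.tendsto _).mono_left nhdsWithin_le_nhds
        have h2 := (hwl.sub hul).max (tendsto_const_nhds (x := (0 : ℝ)))
        rwa [max_eq_right (by linarith [hini y hy])] at h2
      · simp only [hgdef, indicator_of_notMem hy]
        exact tendsto_const_nhds
  have hker : Tendsto (fun s' => (gaussMass N)⁻¹ * (4 * (σ - s')) ^ (-(N : ℝ) / 2)) (𝓝[>] α)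
      (𝓝 ((gaussMass N)⁻¹ * (4 * (σ - α)) ^ (-(N : ℝ) / 2))) := by
    have : ContinuousAt (fun s' : ℝ => (gaussMass N)⁻¹ * (4 * (σ - s')) ^ (-(N : ℝ) / 2)) α := by
      refine continuousAt_const.mul (ContinuousAt.rpow_const (by fun_prop) (Or.inl ?_))
      have : 0 < 4 * (σ - α) := by linarith
      exact this.ne'
    exact this.tendsto.mono_left nhdsWithin_le_nhds
  have hlim := (hker.mul h_integrable).const_add (U x σ)
  simp only [integral_zero, mul_zero, add_zero] at hlim
  refine ge_of_tendsto hlim ?_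
  filter_upwards [hnhds] with s' hs'
  have h1 := hmain s' hs'
  have h2 := heatExt_le_of_heatKer_le (hgc s' ⟨hs'.1.le, hs'.2.le⟩) (hgs s') (hg0 s')
    (sub_pos.2 hs'.2) x (fun y _ => heatKer_le (sub_pos.2 hs'.2) (y - x))
  linarith

lemma exists_lipschitz_closedBall {f : EuclideanSpace ℝ (Fin N) → ℝ} (hf : ContDiff ℝ 1 f)
    (x₀ : EuclideanSpace ℝ (Fin N)) (ρ : ℝ) :
    ∃ k : ℕ, ∀ y ∈ closedBall x₀ ρ, ∀ z ∈ closedBall x₀ ρ, |f y - f z| ≤ k * dist y z := by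
  obtain ⟨C, hC⟩ := (isCompact_closedBall x₀ ρ).exists_bound_of_continuousOn
    (hf.continuous_fderiv (by norm_num)).continuousOn
  obtain ⟨k, hk⟩ := exists_nat_ge C
  refine ⟨k, fun y hy z hz => ?_⟩
  have h1 := (convex_closedBall x₀ ρ).norm_image_sub_le_of_norm_fderiv_le (𝕜 := ℝ) (f := f)
    (fun x _ => (hf.differentiable (by norm_num)) x) (fun x hx => (hC x hx).trans hk) hz hy
  rwa [dist_eq_norm]

/-- Comparison principle between separately regular positive supersolutions and strict
classical subsolutions of the heat equation. -/
theorem PosSuper.comparison (hU : PosSuper x₀ ρ a b U) : ComparisonOn x₀ ρ a b U univ := by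
  set P : Set ℝ := {τ | τ ∈ Icc a b ∧
    ∀ δ > 0, ¬ ComparisonOn x₀ ρ a b U (Ioo (τ - δ) (τ + δ))} with hP
  have hloc : ∀ τ ∈ Icc a b, τ ∉ P → ∃ δ > 0, ComparisonOn x₀ ρ a b U (Ioo (τ - δ) (τ + δ)) := by
    intro τ hτ hn
    by_contra! h
    exact hn ⟨hτ, h⟩
  have hmono : ∀ {I J : Set ℝ}, I ⊆ J → ComparisonOn x₀ ρ a b U J → ComparisonOn x₀ ρ a b U I :=
    fun hIJ hJ s t hs ht => hJ s t (hIJ hs) (hIJ ht)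
  have hPclosed : IsClosed P := by
    rw [← isOpen_compl_iff, isOpen_iff_mem_nhds]
    intro τ hτ
    by_cases h : τ ∈ Icc a b
    · obtain ⟨δ, hδ, hc⟩ := hloc τ h hτ
      filter_upwards [Ioo_mem_nhds (show τ - δ / 2 < τ by linarith) (show τ < τ + δ / 2 by linarith)]
        with τ' hτ' hmem
      refine hmem.2 (δ / 2) (by positivity) (hmono (Ioo_subset_Ioo ?_ ?_) hc) <;>
        linarith [hτ'.1, hτ'.2]
    · filter_upwards [isClosed_Icc.isOpen_compl.mem_nhds h] with τ' hτ' hmem using hτ' hmem.1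
  rcases P.eq_empty_or_nonempty with hempty | hne
  · intro s t _ _ _ has htb w hw hini
    exact hw.lt_of_locally hU has htb hini fun τ hτ =>
      hloc τ ⟨has.trans hτ.1, hτ.2.trans htb⟩ (by simp [hempty])
  exfalso
  have : CompleteSpace P := hPclosed.completeSpace_coe
  have : Nonempty P := hne.to_subtype
  obtain ⟨k, hk⟩ := nonempty_interior_of_iUnion_of_closed
    (f := fun k : ℕ => {τ : P | ∀ y ∈ closedBall x₀ ρ, ∀ z ∈ closedBall x₀ ρ,
      |U y τ - U z τ| ≤ k * dist y z})
    (fun k => by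
      simp only [ofPred_forall]
      refine isClosed_iInter fun y => isClosed_iInter fun _ => isClosed_iInter fun z =>
        isClosed_iInter fun _ => isClosed_le ?_ continuous_const
      exact (((hU.c1 y).continuous.comp continuous_subtype_val).sub
        ((hU.c1 z).continuous.comp continuous_subtype_val)).abs)
    (by
      refine eq_univ_of_forall fun τ => mem_iUnion.2 ?_
      exact exists_lipschitz_closedBall ((hU.c2 τ).of_le (by norm_num)) x₀ ρ)
  obtain ⟨τ₀, hτ₀⟩ := hk
  obtain ⟨δ, hδ, hball⟩ := Metric.isOpen_iff.1 isOpen_interior τ₀ hτ₀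
  have hLip : ∀ τ ∈ P, |τ - τ₀| < δ → ∀ y ∈ closedBall x₀ ρ, ∀ z ∈ closedBall x₀ ρ,
      |U y τ - U z τ| ≤ k * dist y z := by
    intro τ hτ hd
    have h1 : (⟨τ, hτ⟩ : P) ∈ ball τ₀ δ := by
      rw [mem_ball, Subtype.dist_eq, Real.dist_eq]; exact hd
    exact interior_subset (hball h1)
  refine τ₀.2.2 δ hδ ?_
  intro s t hs ht hst has htb w hw hini
  by_contra hfail
  obtain ⟨t', ht', hbefore, hafter⟩ := hw.exists_first_failure hU has htb hini hfail
  have ht'ab : t' ∈ Icc a b := ⟨has.trans ht'.1, ht'.2.le.trans htb⟩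
  by_cases htP : t' ∈ P
  swap
  · obtain ⟨η, hη, hcomp⟩ := hloc t' ht'ab htP
    obtain ⟨σ, hσ, hσt, x, hx, hle⟩ := hafter η hη
    have := hcomp t' σ ⟨by linarith, by linarith⟩ ⟨by linarith [hσ.1], hσ.2⟩ hσ.1.le
      (has.trans ht'.1) (hσt.trans htb) w (hw.mono ht'.1 hσt) (hbefore t' ⟨ht'.1, le_rfl⟩) σ
      ⟨hσ.1.le, le_rfl⟩ x hx
    linarith
  have htube : ∀ᶠ τ in 𝓝 t', ∀ x ∈ closedBall x₀ ρ, x ∈ closedBall x₀ ρ → τ ∈ P →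
      τ ∈ Icc s t → w x τ < U x τ := by
    refine (isCompact_closedBall x₀ ρ).eventually_forall_of_forall_eventually fun x hx => ?_
    obtain ⟨ε, hε⟩ : ∃ ε, 3 * ε = U x t' - w x t' := ⟨(U x t' - w x t') / 3, by ring⟩
    have hε0 : 0 < ε := by
      have := hbefore t' ⟨ht'.1, le_rfl⟩ x hx
      linarith
    have h1 : ∀ᶠ z : ℝ × EuclideanSpace ℝ (Fin N) in 𝓝 (t', x), U x t' - ε < U x z.1 := by
      have : ContinuousAt (fun z : ℝ × EuclideanSpace ℝ (Fin N) => U x z.1) (t', x) :=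
        ((hU.c1 x).continuous.comp continuous_fst).continuousAt
      exact this.eventually (lt_mem_nhds (by simp; exact hε0))
    have h2 : ∀ᶠ z : ℝ × EuclideanSpace ℝ (Fin N) in 𝓝 (t', x), k * dist z.2 x < ε := by
      have : ContinuousAt (fun z : ℝ × EuclideanSpace ℝ (Fin N) => k * dist z.2 x) (t', x) := by
        fun_prop
      exact this.eventually (gt_mem_nhds (by simpa using hε0))
    have h3 : ∀ᶠ z : ℝ × EuclideanSpace ℝ (Fin N) in 𝓝 (t', x), |z.1 - τ₀| < δ := by
      have : ContinuousAt (fun z : ℝ × EuclideanSpace ℝ (Fin N) => |z.1 - τ₀|) (t', x) := by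
        fun_prop
      refine this.eventually (gt_mem_nhds ?_)
      rw [abs_lt]; constructor <;> linarith [hs.1, ht.2, ht'.1, ht'.2]
    have h4 : ∀ᶠ z : ℝ × EuclideanSpace ℝ (Fin N) in 𝓝 (t', x),
        z.2 ∈ closedBall x₀ ρ → z.1 ∈ Icc s t → w z.2 z.1 < w x t' + ε := by
      have h5 := hw.cont (x, t') ⟨hx, ht'.1, ht'.2.le⟩
      have h6 := h5.eventually (gt_mem_nhds (show w x t' < w x t' + ε by linarith))
      rw [eventually_nhdsWithin_iff] at h6
      have h7 : Tendsto (fun z : ℝ × EuclideanSpace ℝ (Fin N) => (z.2, z.1)) (𝓝 (t', x))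
          (𝓝 (x, t')) := by
        have : Continuous (fun z : ℝ × EuclideanSpace ℝ (Fin N) => (z.2, z.1)) := by fun_prop
        exact this.tendsto _
      filter_upwards [h7.eventually h6] with z hz hz1 hz2
      exact hz ⟨hz1, hz2⟩
    filter_upwards [h1, h2, h3, h4] with z h1 h2 h3 h4 hz hzP hzI
    have h5 := abs_le.1 (hLip z.1 hzP h3 z.2 hz x hx)
    have h6 := h4 hz hzI
    linarith [h5.1]
  obtain ⟨η, hη, htube⟩ := Metric.eventually_nhds_iff.1 htube
  have hall : ∀ σ ∈ Icc t' t, σ < t' + η → ∀ x ∈ closedBall x₀ ρ, w x σ ≤ U x σ := by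
    intro σ hσ hση
    have hPlt : ∀ τ ∈ P, τ ∈ Icc t' σ → ∀ x ∈ closedBall x₀ ρ, w x τ < U x τ :=
      fun τ hτ hτ' x hx => htube (by rw [Real.dist_eq, abs_lt]; constructor <;>
        linarith [hτ'.1, hτ'.2]) x hx hx hτ ⟨ht'.1.trans hτ'.1, hτ'.2.trans hσ.2⟩
    by_cases hσP : σ ∈ P
    · exact fun x hx => (hPlt σ hσP ⟨hσ.1, le_rfl⟩ x hx).le
    have hcp : IsCompact (P ∩ Icc t' σ) := isCompact_Icc.inter_left hPclosed
    have hne' : (P ∩ Icc t' σ).Nonempty := ⟨t', htP, le_rfl, hσ.1⟩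
    have hαmem := hcp.sSup_mem hne'
    set α := sSup (P ∩ Icc t' σ) with hα
    have hασ : α < σ := lt_of_le_of_ne hαmem.2.2 fun h => hσP (h ▸ hαmem.1)
    refine hw.le_of_tendsto_initial hU has htb (ht'.1.trans hαmem.2.1) hασ hσ.2
      (hPlt α hαmem.1 hαmem.2) fun τ hτ => hloc τ ⟨?_, ?_⟩ fun hτP => ?_
    · exact ht'ab.1.trans (hαmem.2.1.trans hτ.1.le)
    · exact hτ.2.trans (hσ.2.trans htb)
    · have := le_csSup hcp.bddAbove (show τ ∈ P ∩ Icc t' σ from ⟨hτP, hαmem.2.1.trans hτ.1.le, hτ.2⟩)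
      exact absurd hτ.1 (not_lt.2 this)
  obtain ⟨σ, hσ, hσt, x, hx, hle⟩ := hafter η hη
  refine hw.false_of_touching hU has htb hx ⟨ht'.1.trans_lt hσ.1, hσt⟩ hle
    (hall σ ⟨hσ.1.le, hσt⟩ hσ.2) ?_
  filter_upwards [Ioo_mem_nhdsLT hσ.1] with τ hτ
  exact hall τ ⟨hτ.1.le, hτ.2.le.trans hσt⟩ (hτ.2.trans hσ.2) x hx

end Comparison

section Barriers

open Filter Topology

variable {N : ℕ}

lemma HasHeatOpAt.unique {w : EuclideanSpace ℝ (Fin N) → ℝ → ℝ} {d d' : ℝ}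
    {x : EuclideanSpace ℝ (Fin N)} {σ : ℝ} (h : HasHeatOpAt w d x σ)
    (h' : HasHeatOpAt w d' x σ) : d = d' := by
  obtain ⟨wt, w1, w2, h1, h2, h3, h4⟩ := h
  obtain ⟨vt, v1, v2, k1, k2, k3, k4⟩ := h'
  rw [← h4, ← k4, h1.unique k1]
  congr 1
  refine Finset.sum_congr rfl fun i _ => ?_
  have : w1 i = v1 i := funext fun h => (h2 i h).unique (k2 i h)
  exact (h3 i).unique (this ▸ k3 i)

lemma hasHeatOpAt_sum {ι : Type*} (s : Finset ι) {w : ι → EuclideanSpace ℝ (Fin N) → ℝ → ℝ}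
    {d : ι → ℝ} {x : EuclideanSpace ℝ (Fin N)} {σ : ℝ}
    (h : ∀ i ∈ s, HasHeatOpAt (w i) (d i) x σ) :
    HasHeatOpAt (fun x t => ∑ i ∈ s, w i x t) (∑ i ∈ s, d i) x σ := by
  classical
  induction s using Finset.induction_on with
  | empty => simpa using hasHeatOpAt_time 0 0 0 x σ
  | insert a s ha ih =>
    simp only [Finset.sum_insert ha]
    exact (h a (Finset.mem_insert_self _ _)).add
      (ih fun i hi => h i (Finset.mem_insert_of_mem hi))

lemma HasHeatOpAt.scale {w : EuclideanSpace ℝ (Fin N) → ℝ → ℝ} {d R t₀ : ℝ}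
    {x₀ x : EuclideanSpace ℝ (Fin N)} {σ : ℝ} (h : HasHeatOpAt w d (x₀ + R • x) (t₀ + R ^ 2 * σ)) :
    HasHeatOpAt (fun x t => w (x₀ + R • x) (t₀ + R ^ 2 * t)) (R ^ 2 * d) x σ := by
  obtain ⟨wt, w1, w2, h1, h2, h3, h4⟩ := h
  refine ⟨R ^ 2 * wt, fun i h => R * w1 i (R * h), fun i => R ^ 2 * w2 i, ?_, fun i h => ?_,
    fun i => ?_, ?_⟩
  · have : HasDerivAt (fun t : ℝ => t₀ + R ^ 2 * t) (R ^ 2) σ := by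
      simpa using ((hasDerivAt_id σ).const_mul (R ^ 2)).const_add t₀
    have h5 := h1.comp σ this
    rw [mul_comm]
    exact h5
  · have : HasDerivAt (fun h : ℝ => R * h) R h := by simpa using (hasDerivAt_id h).const_mul R
    have h5 := (h2 i (R * h)).comp h this
    convert! h5 using 1
    · funext k
      simp [smul_add, smul_smul, add_assoc]
    · exact mul_comm _ _
  · have : HasDerivAt (fun h : ℝ => R * h) R 0 := by simpa using (hasDerivAt_id (0 : ℝ)).const_mul R
    have h3' : HasDerivAt (w1 i) (w2 i) (R * 0) := by simpa using h3 i
    convert! (h3'.comp (0 : ℝ) this).const_mul R using 1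
    ring
  · rw [← h4, mul_sub, Finset.mul_sum]

lemma rpow_mul_exp_le_half {n d τ ρ : ℝ} (hn : 0 ≤ n) (hd : n / 2 + 2 ≤ d) (hτ : 0 < τ)
    (hρ : τ ≤ ρ) :
    (4 * τ) ^ (-n / 2) * rexp (-(d * ρ / τ)) ≤ 2⁻¹ * ((4 * ρ) ^ (-n / 2) * rexp (-1)) := by
  have hρ0 : 0 < ρ := hτ.trans_le hρ
  set z := ρ / τ with hz
  have hz1 : 1 ≤ z := (one_le_div hτ).2 hρ
  have h1 : (4 * τ) ^ (-n / 2) = (4 * ρ) ^ (-n / 2) * z ^ (n / 2) := by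
    have : 4 * τ = 4 * ρ * z⁻¹ := by rw [hz]; field_simp
    rw [this, mul_rpow (by positivity) (by positivity), inv_rpow (by positivity),
      ← rpow_neg (by positivity)]
    congr 2; ring
  have h2 : z ^ (n / 2) ≤ rexp (z * (n / 2)) := by
    rw [exp_mul]
    exact rpow_le_rpow (by positivity) (by linarith [add_one_le_exp z]) (by positivity)
  have h3 : d * ρ / τ = d * z := by rw [hz]; ring
  have h4 : rexp (z * (n / 2)) * rexp (-(d * z)) ≤ rexp (-1) * rexp (-1) := by
    rw [← exp_add, ← exp_add]
    apply exp_le_exp.2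
    nlinarith
  have h5 : rexp (-1) ≤ 2⁻¹ := by
    rw [exp_neg]
    exact inv_anti₀ (by norm_num) (by linarith [add_one_le_exp (1 : ℝ)])
  rw [h1, h3]
  calc (4 * ρ) ^ (-n / 2) * z ^ (n / 2) * rexp (-(d * z))
      ≤ (4 * ρ) ^ (-n / 2) * rexp (z * (n / 2)) * rexp (-(d * z)) := by gcongr
    _ = (4 * ρ) ^ (-n / 2) * (rexp (z * (n / 2)) * rexp (-(d * z))) := by ring
    _ ≤ (4 * ρ) ^ (-n / 2) * (2⁻¹ * rexp (-1)) := by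
        exact mul_le_mul_of_nonneg_left (h4.trans (mul_le_mul_of_nonneg_right h5 (exp_pos _).le))
          (by positivity)
    _ = _ := by ring

/-- A weak Harnack inequality: averages of positive supersolutions are controlled by the value at
the centre at a later time. -/
lemma PosSuper.integral_le {x₀ : EuclideanSpace ℝ (Fin N)} {ρ s : ℝ}
    {U : EuclideanSpace ℝ (Fin N) → ℝ → ℝ} (hρ : 0 < ρ)
    (hU : PosSuper x₀ ((2 * N + 6) * ρ) s (s + ρ ^ 2) U) :
    ∫ y in ball x₀ ρ, U y s ≤ 2 * rexp 1 * gaussMass N * 2 ^ N * ρ ^ N * U x₀ (s + ρ ^ 2) := by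
  have hkap := gaussMass_pos N
  have hs0 : s ≤ s + ρ ^ 2 := le_add_of_nonneg_right (by positivity)
  have hL : 2 * ρ ≤ (2 * N + 6) * ρ := by
    have : (0 : ℝ) ≤ N := by positivity
    nlinarith
  set χ : EuclideanSpace ℝ (Fin N) → ℝ := fun y => max 0 (min 1 (2 - dist y x₀ / ρ)) with hχ
  have hχ1 : ∀ y, χ y ≤ 1 := fun y => max_le zero_le_one (min_le_left _ _)
  have hχ0 : ∀ y, 0 ≤ χ y := fun y => le_max_left _ _
  have hχs : ∀ y, y ∉ closedBall x₀ (2 * ρ) → χ y = 0 := by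
    intro y hy
    have hy' : 2 * ρ < dist y x₀ := by simpa using hy
    have : 2 < dist y x₀ / ρ := (lt_div_iff₀ hρ).2 hy'
    exact max_eq_left ((min_le_right _ _).trans (by linarith))
  have hχb : ∀ y ∈ ball x₀ ρ, χ y = 1 := by
    intro y hy
    have : dist y x₀ / ρ ≤ 1 := (div_le_one hρ).2 (mem_ball.1 hy).le
    simp only [hχ]
    rw [min_eq_left (by linarith), max_eq_right zero_le_one]
  set g : EuclideanSpace ℝ (Fin N) → ℝ := fun y => χ y * U y s with hg
  have hUc : Continuous (fun y => U y s) := (hU.c2 s).continuous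
  have hgc : Continuous g := by
    have : Continuous χ := by fun_prop
    exact this.mul hUc
  have hgK : ∀ y, y ∉ closedBall x₀ (2 * ρ) → g y = 0 := fun y hy => by simp [hg, hχs y hy]
  have hgs : HasCompactSupport g := HasCompactSupport.intro (isCompact_closedBall x₀ (2 * ρ)) hgK
  have htsupp : tsupport g ⊆ closedBall x₀ (2 * ρ) :=
    closure_minimal (fun y hy => by by_contra h; exact hy (hgK y h)) isClosed_closedBall
  have hg0 : ∀ y, 0 ≤ g y := by
    intro y
    by_cases hy : y ∈ closedBall x₀ (2 * ρ)
    · exact mul_nonneg (hχ0 y)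
        (hU.pos y (closedBall_subset_closedBall hL hy) s ⟨le_rfl, hs0⟩).le
    · rw [hgK y hy]
  set I := ∫ y, g y with hI
  have hI0 : 0 ≤ I := integral_nonneg hg0
  have hIle : ∫ y in ball x₀ ρ, U y s ≤ I := by
    have h1 : ∫ y in ball x₀ ρ, U y s = ∫ y in ball x₀ ρ, g y :=
      setIntegral_congr_fun measurableSet_ball fun y hy => by simp [hg, hχb y hy]
    rw [h1]
    exact setIntegral_le_integral (hgc.integrable_of_hasCompactSupport hgs)
      (Eventually.of_forall hg0)
  set c := (gaussMass N)⁻¹ * ((4 * ρ ^ 2) ^ (-(N : ℝ) / 2) * rexp (-1)) with hc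
  have hc0 : 0 < c := by positivity
  have hlow : c * I ≤ heatExt g x₀ (ρ ^ 2) := by
    refine le_heatExt_of_le_heatKer hgc hgs hg0 (by positivity) x₀ fun y hy => ?_
    have h1 : ‖y - x₀‖ ≤ 2 * ρ := by simpa [dist_eq_norm] using htsupp hy
    unfold heatKer
    rw [hc]
    gcongr
    rw [div_le_one (by positivity)]
    nlinarith [norm_nonneg (y - x₀)]
  have hkey : ∀ η > 0, c * I - 2⁻¹ * (c * I) ≤ U x₀ (s + ρ ^ 2) + η * (1 + ρ ^ 2) := by
    intro η hη
    have hsub : StrictSub x₀ ((2 * N + 6) * ρ) s (s + ρ ^ 2)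
        (fun y σ => heatExt g y (σ - s) - ((2⁻¹ * (c * I) + η) + η * (σ - s))) := by
      refine ⟨?_, ?_, ?_⟩
      · apply Continuous.continuousOn
        have := (continuous_heatExt hgc hgs).comp
          (f := fun p : EuclideanSpace ℝ (Fin N) × ℝ => (p.1, p.2 - s)) (by fun_prop)
        exact this.sub (by fun_prop)
      · intro y hy σ hσ
        have hy' : dist y x₀ = (2 * N + 6) * ρ := hy
        have h0 : 0 ≤ η * (σ - s) := mul_nonneg hη.le (by linarith [hσ.1])
        have h00 : 0 ≤ 2⁻¹ * (c * I) := by positivity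
        rcases hσ.1.eq_or_lt with h | h
        · have : g y = 0 := hgK y fun h => by
            have h1 : dist y x₀ ≤ 2 * ρ := h
            have : (0 : ℝ) ≤ N := by positivity
            rw [hy'] at h1
            nlinarith
          rw [← h, sub_self, heatExt_zero, this]
          linarith
        · have hτ : 0 < σ - s := by linarith
          have h1 : heatExt g y (σ - s) ≤ (2⁻¹ * c) * I := by
            refine heatExt_le_of_heatKer_le hgc hgs hg0 hτ y fun z hz => ?_
            have h2 : ‖z - x₀‖ ≤ 2 * ρ := by simpa [dist_eq_norm] using htsupp hz
            have h3 : (2 * N + 4) * ρ ≤ ‖z - y‖ := by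
              have : ‖y - x₀‖ ≤ ‖z - x₀‖ + ‖z - y‖ := by
                rw [← dist_eq_norm, ← dist_eq_norm, ← dist_eq_norm]
                linarith [dist_triangle y z x₀, dist_comm z y]
              rw [← dist_eq_norm y, hy'] at this
              linarith
            have h4 := rpow_mul_exp_le_half (n := N) (d := (N + 2) ^ 2) (ρ := ρ ^ 2) (by positivity)
              (by have : (0 : ℝ) ≤ N := by positivity
                  nlinarith) hτ (by linarith [hσ.2])
            have h5 : ((N : ℝ) + 2) ^ 2 * ρ ^ 2 / (σ - s) ≤ ‖z - y‖ ^ 2 / (4 * (σ - s)) := by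
              rw [div_le_div_iff₀ hτ (by positivity)]
              have : ((2 * N + 4) * ρ) ^ 2 ≤ ‖z - y‖ ^ 2 := by gcongr
              nlinarith
            calc heatKer N (σ - s) (z - y) ≤ (gaussMass N)⁻¹ * ((4 * (σ - s)) ^ (-(N : ℝ) / 2) *
                  rexp (-(((N : ℝ) + 2) ^ 2 * ρ ^ 2 / (σ - s)))) := by
                  unfold heatKer; gcongr
              _ ≤ (gaussMass N)⁻¹ * (2⁻¹ * ((4 * ρ ^ 2) ^ (-(N : ℝ) / 2) * rexp (-1))) := by gcongr
              _ = 2⁻¹ * c := by rw [hc]; ring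
          linarith
      · intro σ hσ y hy
        refine ⟨0 - η, by linarith, (hasHeatOpAt_heatExt hgc hgs s y hσ.1).sub ?_⟩
        exact hasHeatOpAt_time _ _ _ _ _
    have h1 := hU.comparison s (s + ρ ^ 2) (mem_univ _) (mem_univ _) hs0 le_rfl le_rfl _ hsub
      (fun y hy => ?_) (s + ρ ^ 2) ⟨hs0, le_rfl⟩ x₀ (mem_closedBall_self (by positivity))
    · simp only [add_sub_cancel_left] at h1
      linarith
    · simp only [sub_self, heatExt_zero]
      have h2 := hU.pos y hy s ⟨le_rfl, hs0⟩
      have h3 : g y ≤ U y s := mul_le_of_le_one_left h2.le (hχ1 y)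
      have h00 : 0 ≤ 2⁻¹ * (c * I) := by positivity
      linarith
  have hfin : c * I - 2⁻¹ * (c * I) ≤ U x₀ (s + ρ ^ 2) := by
    refine le_of_forall_pos_le_add fun ε hε => ?_
    have := hkey (ε / (1 + ρ ^ 2)) (by positivity)
    rwa [div_mul_cancel₀ _ (by positivity)] at this
  have hcinv : (2 * rexp 1 * gaussMass N * 2 ^ N * ρ ^ N) * (2⁻¹ * c) = 1 := by
    have h4 : (4 * ρ ^ 2) ^ (-(N : ℝ) / 2) = ((2 : ℝ) ^ N * ρ ^ N)⁻¹ := by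
      have : 4 * ρ ^ 2 = (2 * ρ) ^ (2 : ℝ) := by rw [rpow_two]; ring
      rw [this, ← rpow_mul (by positivity), ← mul_pow, ← rpow_natCast, ← rpow_neg (by positivity)]
      congr 1; ring
    rw [hc, h4, exp_neg]
    field_simp
  calc ∫ y in ball x₀ ρ, U y s ≤ I := hIle
    _ = (2 * rexp 1 * gaussMass N * 2 ^ N * ρ ^ N) * (2⁻¹ * c * I) := by
        rw [← mul_assoc, hcinv, one_mul]
    _ ≤ _ := by gcongr; linarith

/-- A local mean value inequality for subsolutions with bounded right-hand side. -/
lemma le_integral_of_subsolution {x₁ : EuclideanSpace ℝ (Fin N)} {lam s τ Λ c : ℝ}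
    {U : EuclideanSpace ℝ (Fin N) → ℝ → ℝ} (hlam : 0 < lam) (hτ : 0 < τ) (hc : 0 ≤ c)
    (hc2 : ∀ t, ContDiff ℝ 2 (fun x => U x t)) (hc1 : ∀ x, ContDiff ℝ 1 (fun t => U x t))
    (h0 : ∀ x ∈ closedBall x₁ lam, ∀ t ∈ Icc s (s + τ), 0 ≤ U x t)
    (hΛ : ∀ x ∈ closedBall x₁ lam, ∀ t ∈ Icc s (s + τ), U x t ≤ Λ)
    (hop : ∀ x ∈ closedBall x₁ lam, ∀ t ∈ Icc s (s + τ), ∃ d ≤ c, HasHeatOpAt U d x t) :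
    U x₁ (s + τ) ≤ (gaussMass N)⁻¹ * (4 * τ) ^ (-(N : ℝ) / 2) * (∫ y in ball x₁ lam, U y s)
      + 2 * N * Λ * τ / lam ^ 2 + c * τ := by
  have hs0 : s ≤ s + τ := by linarith
  have hx₁ : x₁ ∈ closedBall x₁ lam := mem_closedBall_self hlam.le
  have hΛ0 : 0 ≤ Λ := (h0 x₁ hx₁ s ⟨le_rfl, hs0⟩).trans (hΛ x₁ hx₁ s ⟨le_rfl, hs0⟩)
  set χ : EuclideanSpace ℝ (Fin N) → ℝ := fun y => max 0 (1 - ‖y - x₁‖ ^ 2 / lam ^ 2) with hχ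
  have hχ0 : ∀ y, 0 ≤ χ y := fun y => le_max_left _ _
  have hχ1 : ∀ y, χ y ≤ 1 := fun y => max_le zero_le_one (by
    have : 0 ≤ ‖y - x₁‖ ^ 2 / lam ^ 2 := by positivity
    linarith)
  have hχs : ∀ y, y ∉ ball x₁ lam → χ y = 0 := by
    intro y hy
    have hy' : lam ≤ ‖y - x₁‖ := by simpa [dist_eq_norm] using hy
    refine max_eq_left ?_
    have : 1 ≤ ‖y - x₁‖ ^ 2 / lam ^ 2 := (one_le_div (by positivity)).2 (by gcongr)
    linarith
  have hχb : ∀ y ∈ closedBall x₁ lam, χ y = 1 - ‖y - x₁‖ ^ 2 / lam ^ 2 := by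
    intro y hy
    have hy' : ‖y - x₁‖ ≤ lam := by simpa [dist_eq_norm] using hy
    refine max_eq_right ?_
    have : ‖y - x₁‖ ^ 2 / lam ^ 2 ≤ 1 := (div_le_one (by positivity)).2 (by gcongr)
    linarith
  set g : EuclideanSpace ℝ (Fin N) → ℝ := fun y => χ y * U y s with hg
  have hUc : Continuous (fun y => U y s) := (hc2 s).continuous
  have hgc : Continuous g := by
    have : Continuous χ := by fun_prop
    exact this.mul hUc
  have hgK : ∀ y, y ∉ ball x₁ lam → g y = 0 := fun y hy => by simp [hg, hχs y hy]
  have hgs : HasCompactSupport g := HasCompactSupport.intro (isCompact_closedBall x₁ lam)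
    fun y hy => hgK y fun h => hy (ball_subset_closedBall h)
  have hg0 : ∀ y, 0 ≤ g y := by
    intro y
    by_cases hy : y ∈ ball x₁ lam
    · exact mul_nonneg (hχ0 y) (h0 y (ball_subset_closedBall hy) s ⟨le_rfl, hs0⟩)
    · rw [hgK y hy]
  have hUint : IntegrableOn (fun y => U y s) (ball x₁ lam) :=
    (hUc.continuousOn.integrableOn_compact (isCompact_closedBall x₁ lam)).mono_set
      ball_subset_closedBall
  have hIle : ∫ y, g y ≤ ∫ y in ball x₁ lam, U y s := by
    rw [← setIntegral_eq_integral_of_forall_compl_eq_zero (s := ball x₁ lam) hgK]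
    refine setIntegral_mono_on (hgc.integrable_of_hasCompactSupport hgs).integrableOn hUint
      measurableSet_ball fun y hy => ?_
    exact mul_le_of_le_one_left (h0 y (ball_subset_closedBall hy) s ⟨le_rfl, hs0⟩) (hχ1 y)
  have hkey : ∀ η > 0, U x₁ (s + τ) ≤ heatExt g x₁ τ + 2 * N * Λ * τ / lam ^ 2 + c * τ
      + η * (1 + τ) := by
    intro η hη
    have hV : PosSuper x₁ lam s (s + τ) (fun y σ => (Λ + η) + c * (σ - s) - U y σ) := by
      refine ⟨fun t => contDiff_const.sub (hc2 t), fun x => ContDiff.sub (by fun_prop) (hc1 x),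
        fun x hx t ht => ?_, fun x hx t ht => ?_⟩
      · have h1 := hΛ x hx t ht
        have h2 : 0 ≤ c * (t - s) := mul_nonneg hc (by linarith [ht.1])
        linarith
      · obtain ⟨d, hd, hop'⟩ := hop x hx t ht
        exact ⟨c - d, by linarith, (hasHeatOpAt_time _ _ _ _ _).sub hop'⟩
    have hsub : StrictSub x₁ lam s (s + τ) (fun y σ => Λ + (-(2 * N * Λ / lam ^ 2) - η) * (σ - s)
        - heatExt g y (σ - s) - Λ / lam ^ 2 * ‖y - x₁‖ ^ 2) := by
      refine ⟨?_, ?_, ?_⟩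
      · apply Continuous.continuousOn
        have := (continuous_heatExt hgc hgs).comp
          (f := fun p : EuclideanSpace ℝ (Fin N) × ℝ => (p.1, p.2 - s)) (by fun_prop)
        exact (Continuous.sub (by fun_prop) this).sub (by fun_prop)
      · intro y hy σ hσ
        have hy' : ‖y - x₁‖ = lam := by rw [← dist_eq_norm]; exact hy
        have h1 := heatExt_nonneg hg0 y (σ - s)
        have h2 : Λ / lam ^ 2 * ‖y - x₁‖ ^ 2 = Λ := by rw [hy']; field_simp
        have h3 : 0 ≤ (2 * N * Λ / lam ^ 2 + η) * (σ - s) :=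
          mul_nonneg (by positivity) (by linarith [hσ.1])
        rw [h2]
        linarith
      · intro σ hσ y hy
        refine ⟨(-(2 * N * Λ / lam ^ 2) - η) - 0 - Λ / lam ^ 2 * (-(2 * N)), ?_,
          ((hasHeatOpAt_time _ _ _ _ _).sub (hasHeatOpAt_heatExt hgc hgs s y hσ.1)).sub
            ((hasHeatOpAt_normSq x₁ y σ).const_mul _)⟩
        have : Λ / lam ^ 2 * (-(2 * N)) = -(2 * N * Λ / lam ^ 2) := by ring
        rw [this]; linarith
    have h1 := hV.comparison s (s + τ) (mem_univ _) (mem_univ _) hs0 le_rfl le_rfl _ hsub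
      (fun y hy => ?_) (s + τ) ⟨hs0, le_rfl⟩ x₁ hx₁
    · simp only [add_sub_cancel_left, sub_self, norm_zero] at h1
      have : 2 * N * Λ * τ / lam ^ 2 = 2 * N * Λ / lam ^ 2 * τ := by ring
      rw [this]
      linarith
    · simp only [sub_self, heatExt_zero, mul_zero, add_zero]
      have h2 := hΛ y hy s ⟨le_rfl, hs0⟩
      have h3 := hχb y hy
      have h4 : Λ / lam ^ 2 * ‖y - x₁‖ ^ 2 = Λ * (1 - χ y) := by rw [h3]; ring
      rw [h4]
      simp only [hg]
      nlinarith [hχ1 y, hχ0 y]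
  have hfin : U x₁ (s + τ) ≤ heatExt g x₁ τ + 2 * N * Λ * τ / lam ^ 2 + c * τ := by
    refine le_of_forall_pos_le_add fun ε hε => ?_
    have := hkey (ε / (1 + τ)) (by positivity)
    rwa [div_mul_cancel₀ _ (by positivity)] at this
  have h5 := heatExt_le_of_heatKer_le hgc hgs hg0 hτ x₁ (fun y _ => heatKer_le hτ (y - x₁))
  have hkap := gaussMass_pos N
  have h6 : (gaussMass N)⁻¹ * (4 * τ) ^ (-(N : ℝ) / 2) * ∫ y, g y ≤
    (gaussMass N)⁻¹ * (4 * τ) ^ (-(N : ℝ) / 2) * ∫ y in ball x₁ lam, U y s := by gcongr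
  linarith

/-- One-sided Lipschitz bound in time for supersolutions touched from below by a paraboloid. -/
lemma PosSuper.sub_le_of_paraboloid {x : EuclideanSpace ℝ (Fin N)} {ρ t τ A : ℝ}
    {V : EuclideanSpace ℝ (Fin N) → ℝ → ℝ} (hρ : 0 < ρ) (hτ : 0 ≤ τ) (hA : 0 < A)
    (hV : PosSuper x ρ t (t + τ) V)
    (ℓ : EuclideanSpace ℝ (Fin N) →L[ℝ] ℝ)
    (hpar : ∀ y ∈ closedBall x ρ, V x t + ℓ (y - x) - A * ‖y - x‖ ^ 2 ≤ V y t)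
    (hbd : V x t + ‖ℓ‖ * ρ ≤ A * ρ ^ 2) :
    V x t - A * (2 * N + 1) * τ ≤ V x (t + τ) := by
  have hs0 : t ≤ t + τ := by linarith
  refine le_of_forall_pos_le_add fun ε hε => ?_
  have hsub : StrictSub x ρ t (t + τ) (fun y σ => (V x t - ε) + (-(A * (2 * N + 1))) * (σ - t)
      + ℓ (y - x) - A * ‖y - x‖ ^ 2) := by
    refine ⟨?_, ?_, ?_⟩
    · apply Continuous.continuousOn
      fun_prop
    · intro y hy σ hσ
      have hy' : ‖y - x‖ = ρ := by rw [← dist_eq_norm]; exact hy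
      have h1 : ℓ (y - x) ≤ ‖ℓ‖ * ρ := by
        rw [← hy']; exact (le_abs_self _).trans (ℓ.le_opNorm _)
      have h2 : 0 ≤ A * (2 * N + 1) * (σ - t) := mul_nonneg (by positivity) (by linarith [hσ.1])
      simp only [hy']
      linarith
    · intro σ hσ y hy
      refine ⟨-(A * (2 * N + 1)) + 0 - A * (-(2 * N)), by linarith,
        ((hasHeatOpAt_time _ _ _ _ _).add (hasHeatOpAt_linear ℓ x y σ)).sub
          ((hasHeatOpAt_normSq x y σ).const_mul _)⟩
  have h1 := hV.comparison t (t + τ) (mem_univ _) (mem_univ _) hs0 le_rfl le_rfl _ hsub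
    (fun y hy => ?_) (t + τ) ⟨hs0, le_rfl⟩ x (mem_closedBall_self hρ.le)
  · simp only [add_sub_cancel_left, sub_self, norm_zero, map_zero] at h1
    linarith
  · have := hpar y hy
    simp only [sub_self]
    linarith

end Barriers

section WeakForm

open Filter Topology

/-- The derivative of `f` in the direction `v`, as a function. -/
noncomputable def dirDeriv {F : Type*} [NormedAddCommGroup F] [NormedSpace ℝ F] (v : F)
    (f : F → ℝ) : F → ℝ := fun z => fderiv ℝ f z v

section DirDeriv

variable {F : Type*} [NormedAddCommGroup F] [NormedSpace ℝ F]

lemma contDiff_dirDeriv {f : F → ℝ} {n k : WithTop ℕ∞} (hf : ContDiff ℝ n f) (h : k + 1 ≤ n)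
    (v : F) : ContDiff ℝ k (dirDeriv v f) :=
  (hf.fderiv_right h).clm_apply contDiff_const

lemma hasCompactSupport_dirDeriv {f : F → ℝ} (hf : HasCompactSupport f) (v : F) :
    HasCompactSupport (dirDeriv v f) := hf.fderiv_apply ℝ v

lemma dirDeriv_eq_zero_of_notMem {f : F → ℝ} {z : F} (hz : z ∉ tsupport f) (v : F) :
    dirDeriv v f z = 0 := by
  have : fderiv ℝ f z = 0 := by
    by_contra h
    exact hz (tsupport_fderiv_subset ℝ (subset_tsupport _ h))
  simp [dirDeriv, this]

lemma tsupport_dirDeriv_subset (f : F → ℝ) (v : F) : tsupport (dirDeriv v f) ⊆ tsupport f :=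
  closure_minimal (fun z hz => by
    by_contra h
    exact hz (dirDeriv_eq_zero_of_notMem h v)) (isClosed_tsupport f)

lemma continuous_dirDeriv {f : F → ℝ} (hf : ContDiff ℝ 1 f) (v : F) :
    Continuous (dirDeriv v f) := (contDiff_dirDeriv hf (k := 0) (by norm_num) v).continuous

variable [FiniteDimensional ℝ F] [MeasurableSpace F] [BorelSpace F] (μ : Measure F)
  [μ.IsAddHaarMeasure]

lemma integral_mul_dirDeriv {f g : F → ℝ} (hf : ContDiff ℝ 1 f) (hg : ContDiff ℝ 1 g)
    (hgs : HasCompactSupport g) (v : F) :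
    ∫ x, f x * dirDeriv v g x ∂μ = -∫ x, dirDeriv v f x * g x ∂μ := by
  refine integral_mul_fderiv_eq_neg_fderiv_mul_of_integrable ?_ ?_ ?_
    (fun x _ => hf.differentiable (by norm_num) x) (fun x _ => hg.differentiable (by norm_num) x)
  · exact ((continuous_dirDeriv hf v).mul hg.continuous).integrable_of_hasCompactSupport
      hgs.mul_left
  · exact (hf.continuous.mul (continuous_dirDeriv hg v)).integrable_of_hasCompactSupport
      (hasCompactSupport_dirDeriv hgs v).mul_left
  · exact (hf.continuous.mul hg.continuous).integrable_of_hasCompactSupport hgs.mul_left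

lemma integral_dirDeriv_eq_zero {g : F → ℝ} (hg : ContDiff ℝ 1 g)
    (hgs : HasCompactSupport g) (v : F) : ∫ x, dirDeriv v g x ∂μ = 0 := by
  have := integral_mul_dirDeriv μ (contDiff_const (c := (1 : ℝ))) hg hgs v
  simpa [dirDeriv] using this

end DirDeriv

variable {N : ℕ}

lemma lap_eq_sum_dirDeriv {g : EuclideanSpace ℝ (Fin N) → ℝ} (hg : ContDiff ℝ 2 g)
    (x : EuclideanSpace ℝ (Fin N)) :
    lap g x = ∑ i, dirDeriv (EuclideanSpace.single i 1) (dirDeriv (EuclideanSpace.single i 1) g) x := by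
  refine Finset.sum_congr rfl fun i _ => ?_
  have h1 : DifferentiableAt ℝ (fderiv ℝ g) x :=
    (hg.fderiv_right (m := 1) (by norm_num)).differentiable (by norm_num) x
  have h2 := (h1.hasFDerivAt.clm_apply
    (hasFDerivAt_const (EuclideanSpace.single i (1 : ℝ)) x)).fderiv
  rw [iteratedFDeriv_two_apply]
  simp only [Matrix.cons_val_zero, Matrix.cons_val_one]
  unfold dirDeriv
  rw [h2]
  simp

lemma continuous_lap {g : EuclideanSpace ℝ (Fin N) → ℝ} (hg : ContDiff ℝ 2 g) :
    Continuous (lap g) := by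
  have : lap g = fun x => ∑ i, dirDeriv (EuclideanSpace.single i 1)
      (dirDeriv (EuclideanSpace.single i 1) g) x := funext (lap_eq_sum_dirDeriv hg)
  rw [this]
  exact continuous_finsetSum _ fun i _ =>
    continuous_dirDeriv (contDiff_dirDeriv hg (by norm_num) _) _

lemma integral_lap_mul {g ψ : EuclideanSpace ℝ (Fin N) → ℝ} (hg : ContDiff ℝ 2 g)
    (hψ : ContDiff ℝ 2 ψ) (hψs : HasCompactSupport ψ) :
    ∫ x, lap g x * ψ x = ∫ x, g x * lap ψ x := by
  simp only [lap_eq_sum_dirDeriv hg, lap_eq_sum_dirDeriv hψ, Finset.sum_mul, Finset.mul_sum]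
  have hg1 : ∀ i, ContDiff ℝ 1 (dirDeriv (EuclideanSpace.single i (1 : ℝ)) g) := fun i =>
    contDiff_dirDeriv hg (by norm_num) _
  have hψ1 : ∀ i, ContDiff ℝ 1 (dirDeriv (EuclideanSpace.single i (1 : ℝ)) ψ) := fun i =>
    contDiff_dirDeriv hψ (by norm_num) _
  have hg' : ContDiff ℝ 1 g := hg.of_le (by norm_num)
  have hψ' : ContDiff ℝ 1 ψ := hψ.of_le (by norm_num)
  rw [integral_finsetSum, integral_finsetSum]
  · refine Finset.sum_congr rfl fun i _ => ?_
    rw [integral_mul_dirDeriv volume hg' (hψ1 i) (hasCompactSupport_dirDeriv hψs _),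
      integral_mul_dirDeriv volume (hg1 i) hψ' hψs, neg_neg]
  · exact fun i _ => (hg.continuous.mul (continuous_dirDeriv (hψ1 i) _)).integrable_of_hasCompactSupport
      (hasCompactSupport_dirDeriv (hasCompactSupport_dirDeriv hψs _) _).mul_left
  · exact fun i _ => ((continuous_dirDeriv (hg1 i) _).mul hψ.continuous).integrable_of_hasCompactSupport
      hψs.mul_left

lemma exists_paraboloid_bound {g : EuclideanSpace ℝ (Fin N) → ℝ} (hg : ContDiff ℝ 2 g) (R : ℝ) :
    ∃ A K : ℝ, 0 < A ∧ 0 ≤ K ∧ ∀ x ∈ closedBall (0 : EuclideanSpace ℝ (Fin N)) R,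
      ‖fderiv ℝ g x‖ ≤ K ∧ ∀ y ∈ closedBall (0 : EuclideanSpace ℝ (Fin N)) R,
        |g y - g x - fderiv ℝ g x (y - x)| ≤ A * ‖y - x‖ ^ 2 := by
  have h1 : ContDiff ℝ 1 (fderiv ℝ g) := hg.fderiv_right (by norm_num)
  obtain ⟨K, hK⟩ := (isCompact_closedBall (0 : EuclideanSpace ℝ (Fin N)) R).exists_bound_of_continuousOn
    h1.continuous.continuousOn
  obtain ⟨A, hA⟩ := (isCompact_closedBall (0 : EuclideanSpace ℝ (Fin N)) R).exists_bound_of_continuousOn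
    (h1.continuous_fderiv (by norm_num)).continuousOn
  have hconv := convex_closedBall (0 : EuclideanSpace ℝ (Fin N)) R
  refine ⟨max A 1, max K 0, by positivity, by positivity, fun x hx =>
    ⟨(hK x hx).trans (le_max_left _ _), fun y hy => ?_⟩⟩
  have hseg : segment ℝ x y ⊆ closedBall 0 R := hconv.segment_subset hx hy
  have h2 := Convex.norm_image_sub_le_of_norm_hasFDerivWithin_le' (f := g) (f' := fderiv ℝ g)
    (s := segment ℝ x y) (x := x) (y := y) (φ := fderiv ℝ g x) (C := max A 1 * ‖y - x‖)
    (fun z _ => (hg.differentiable (by norm_num) z).hasFDerivAt.hasFDerivWithinAt)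
    (fun z hz => ?_) (convex_segment x y) (left_mem_segment ℝ x y) (right_mem_segment ℝ x y)
  · rw [← Real.norm_eq_abs]
    exact h2.trans_eq (by ring)
  · have h3 := hconv.norm_image_sub_le_of_norm_fderiv_le (𝕜 := ℝ) (f := fderiv ℝ g) (x := x) (y := z)
      (fun z _ => h1.differentiable (by norm_num) z) hA hx (hseg hz)
    have h4 : ‖z - x‖ ≤ ‖y - x‖ := by
      obtain ⟨a, b, ha, hb, hab, rfl⟩ := hz
      have : a • x + b • y - x = b • (y - x) := by
        rw [← eq_sub_iff_add_eq] at hab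
        rw [hab]; module
      rw [this, norm_smul, Real.norm_of_nonneg hb]
      exact mul_le_of_le_one_left (norm_nonneg _) (by linarith)
    refine h3.trans ?_
    gcongr
    exact le_max_left _ _

lemma exists_time_lipschitz {w f : EuclideanSpace ℝ (Fin N) → ℝ → ℝ} {M F ρ t : ℝ}
    (hc2 : ∀ t, ContDiff ℝ 2 (fun x => w x t)) (hc1 : ∀ x, ContDiff ℝ 1 (fun t => w x t))
    (hpos : ∀ x ∈ ball (0 : EuclideanSpace ℝ (Fin N)) 1, ∀ t ∈ Ioo (-1 : ℝ) 1, 0 < w x t)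
    (hM : ∀ x ∈ ball (0 : EuclideanSpace ℝ (Fin N)) 1, ∀ t ∈ Ioo (-1 : ℝ) 1, w x t ≤ M)
    (hop : ∀ x ∈ ball (0 : EuclideanSpace ℝ (Fin N)) 1, ∀ t ∈ Ioo (-1 : ℝ) 1,
      HasHeatOpAt w (f x t) x t)
    (hf0 : ∀ x ∈ ball (0 : EuclideanSpace ℝ (Fin N)) 1, ∀ t ∈ Ioo (-1 : ℝ) 1, 0 ≤ f x t)
    (hfF : ∀ x ∈ ball (0 : EuclideanSpace ℝ (Fin N)) 1, ∀ t ∈ Ioo (-1 : ℝ) 1, f x t ≤ F)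
    (hρ1 : ρ < 1) (ht : t ∈ Ioo (-1 : ℝ) 1) :
    ∃ L τ₀ : ℝ, 0 < τ₀ ∧ 0 ≤ L ∧ t + τ₀ < 1 ∧ ∀ x ∈ closedBall (0 : EuclideanSpace ℝ (Fin N)) ρ,
      ∀ τ ∈ Icc 0 τ₀, |w x (t + τ) - w x t| ≤ L * τ := by
  set ρ' := (1 - ρ) / 2 with hρ'
  have hρ'0 : 0 < ρ' := by rw [hρ']; linarith
  obtain ⟨A, K, hA, hK, hAK⟩ := exists_paraboloid_bound (hc2 t) (ρ + ρ')
  have h0b : (0 : EuclideanSpace ℝ (Fin N)) ∈ ball (0 : EuclideanSpace ℝ (Fin N)) 1 :=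
    mem_ball_self one_pos
  have hM0 : 0 ≤ M := (hpos 0 h0b t ht).le.trans (hM 0 h0b t ht)
  have hF0 : 0 ≤ F := (hf0 0 h0b t ht).trans (hfF 0 h0b t ht)
  set B := A + (M + 1 + K * ρ') / ρ' ^ 2 with hB
  have hB0 : 0 < B := by positivity
  have hBA : A ≤ B := le_add_of_nonneg_right (by positivity)
  have hBρ : M + 1 + K * ρ' ≤ B * ρ' ^ 2 := by
    have : (M + 1 + K * ρ') / ρ' ^ 2 * ρ' ^ 2 = M + 1 + K * ρ' := by field_simp
    have h0 : 0 ≤ A * ρ' ^ 2 := by positivity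
    rw [hB, add_mul]; linarith
  refine ⟨F + B * (2 * N + 1), (1 - t) / 2, by linarith [ht.2], by positivity, by linarith [ht.2], ?_⟩
  intro x hx τ hτ
  have hx' : ‖x‖ ≤ ρ := by simpa using hx
  have hsub : closedBall x ρ' ⊆ ball 0 1 := fun y hy => by
    have h1 : ‖y‖ ≤ ‖x‖ + ‖y - x‖ := by simpa using norm_add_le x (y - x)
    have h2 : ‖y - x‖ ≤ ρ' := by simpa [dist_eq_norm] using hy
    have : ‖y‖ < 1 := by rw [hρ'] at h2; linarith
    simpa using this
  have hsub2 : ∀ y ∈ closedBall x ρ', y ∈ closedBall (0 : EuclideanSpace ℝ (Fin N)) (ρ + ρ') :=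
    fun y hy => by
      have h1 : ‖y‖ ≤ ‖x‖ + ‖y - x‖ := by simpa using norm_add_le x (y - x)
      have h2 : ‖y - x‖ ≤ ρ' := by simpa [dist_eq_norm] using hy
      simpa using (by linarith : ‖y‖ ≤ ρ + ρ')
  have hI : Icc t (t + τ) ⊆ Ioo (-1) 1 := fun s hs =>
    ⟨by linarith [ht.1, hs.1], by linarith [hs.2, hτ.2, ht.2]⟩
  have hxx : x ∈ closedBall x ρ' := mem_closedBall_self hρ'0.le
  have hxR := hsub2 x hxx
  have hw : PosSuper x ρ' t (t + τ) w :=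
    ⟨hc2, hc1, fun y hy s hs => hpos y (hsub hy) s (hI hs),
      fun y hy s hs => ⟨_, hf0 y (hsub hy) s (hI hs), hop y (hsub hy) s (hI hs)⟩⟩
  have h1 := hw.sub_le_of_paraboloid hρ'0 hτ.1 hB0 (fderiv ℝ (fun y => w y t) x)
    (fun y hy => by
      have h2 := (abs_le.1 ((hAK x hxR).2 y (hsub2 y hy))).1
      have h3 : A * ‖y - x‖ ^ 2 ≤ B * ‖y - x‖ ^ 2 := by gcongr
      linarith)
    (by
      have h2 := hM x (hsub hxx) t ht
      have h3 : ‖fderiv ℝ (fun y => w y t) x‖ * ρ' ≤ K * ρ' := by gcongr; exact (hAK x hxR).1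
      linarith)
  have hV : PosSuper x ρ' t (t + τ) (fun y s => (M + 1) + F * (s - t) - w y s) := by
    refine ⟨fun s => contDiff_const.sub (hc2 s), fun y => ContDiff.sub (by fun_prop) (hc1 y),
      fun y hy s hs => ?_, fun y hy s hs => ?_⟩
    · have h2 := hM y (hsub hy) s (hI hs)
      have h3 : 0 ≤ F * (s - t) := mul_nonneg hF0 (by linarith [hs.1])
      linarith
    · exact ⟨F - f y s, by linarith [hfF y (hsub hy) s (hI hs)],
        (hasHeatOpAt_time _ _ _ _ _).sub (hop y (hsub hy) s (hI hs))⟩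
  have h2 := hV.sub_le_of_paraboloid hρ'0 hτ.1 hB0 (-fderiv ℝ (fun y => w y t) x)
    (fun y hy => by
      have h2 := (abs_le.1 ((hAK x hxR).2 y (hsub2 y hy))).2
      have h3 : A * ‖y - x‖ ^ 2 ≤ B * ‖y - x‖ ^ 2 := by gcongr
      simp only [sub_self, mul_zero, add_zero, neg_apply]
      linarith)
    (by
      have h2 := hpos x (hsub hxx) t ht
      have h3 : ‖fderiv ℝ (fun y => w y t) x‖ * ρ' ≤ K * ρ' := by gcongr; exact (hAK x hxR).1
      simp only [sub_self, mul_zero, add_zero, norm_neg]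
      linarith)
  simp only [sub_self, mul_zero, add_zero, add_sub_cancel_left] at h2
  have h3 : 0 ≤ F * τ := mul_nonneg hF0 hτ.1
  rw [abs_le]
  constructor <;> linarith

lemma abs_mul_le_indicator {h : EuclideanSpace ℝ (Fin N) → ℝ → ℝ}
    {Φ : EuclideanSpace ℝ (Fin N) × ℝ → ℝ} {B P ρ : ℝ}
    (hB : ∀ z ∈ ball (0 : EuclideanSpace ℝ (Fin N) × ℝ) 1, |h z.1 z.2| ≤ B) (hρ1 : ρ < 1)
    (hP : ∀ z, ‖Φ z‖ ≤ P) (hΦ : ∀ z, z ∉ ball (0 : EuclideanSpace ℝ (Fin N) × ℝ) ρ → Φ z = 0)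
    (x : EuclideanSpace ℝ (Fin N)) (t : ℝ) :
    ‖h x t * Φ (x, t)‖ ≤ (ball (0 : EuclideanSpace ℝ (Fin N)) ρ).indicator (fun _ => B * P) x := by
  by_cases hz : (x, t) ∈ ball (0 : EuclideanSpace ℝ (Fin N) × ℝ) ρ
  · have h1 : x ∈ ball (0 : EuclideanSpace ℝ (Fin N)) ρ := by
      rw [← Prod.mk_zero_zero, ← ball_prod_same] at hz
      exact hz.1
    have h2 := hB _ (ball_subset_ball hρ1.le hz)
    rw [indicator_of_mem h1, norm_mul]
    exact mul_le_mul h2 (hP _) (norm_nonneg _) ((abs_nonneg _).trans h2)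
  · rw [hΦ _ hz, mul_zero, norm_zero]
    refine indicator_nonneg (fun y hy => ?_) x
    have h1 : (y, (0 : ℝ)) ∈ ball (0 : EuclideanSpace ℝ (Fin N) × ℝ) 1 := by
      rw [← Prod.mk_zero_zero, ← ball_prod_same]
      exact ⟨ball_subset_ball hρ1.le hy, mem_ball_self one_pos⟩
    exact mul_nonneg ((abs_nonneg _).trans (hB _ h1)) ((norm_nonneg _).trans (hP 0))

lemma stronglyMeasurable_of_separately_continuous {h : EuclideanSpace ℝ (Fin N) → ℝ → ℝ}
    (hx : ∀ t, Continuous fun x => h x t) (ht : ∀ x, Continuous fun t => h x t) :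
    StronglyMeasurable fun z : EuclideanSpace ℝ (Fin N) × ℝ => h z.1 z.2 :=
  stronglyMeasurable_uncurry_of_continuous_of_stronglyMeasurable hx fun x =>
    (ht x).stronglyMeasurable

variable {h : EuclideanSpace ℝ (Fin N) → ℝ → ℝ} {Φ : EuclideanSpace ℝ (Fin N) × ℝ → ℝ} {B ρ : ℝ}

lemma integrable_mul_of_separately_continuous
    (hx : ∀ t, Continuous fun x => h x t) (ht : ∀ x, Continuous fun t => h x t)
    (hB : ∀ z ∈ ball (0 : EuclideanSpace ℝ (Fin N) × ℝ) 1, |h z.1 z.2| ≤ B) (hρ1 : ρ < 1)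
    (hΦc : Continuous Φ) (hΦ : ∀ z, z ∉ ball (0 : EuclideanSpace ℝ (Fin N) × ℝ) ρ → Φ z = 0) :
    Integrable fun z : EuclideanSpace ℝ (Fin N) × ℝ => h z.1 z.2 * Φ z := by
  have hΦs : HasCompactSupport Φ := HasCompactSupport.intro
    (isCompact_closedBall (0 : EuclideanSpace ℝ (Fin N) × ℝ) ρ) fun z hz =>
      hΦ z fun h => hz (ball_subset_closedBall h)
  refine Integrable.mono' ((hΦc.norm.integrable_of_hasCompactSupport hΦs.norm).const_mul B)
    ((stronglyMeasurable_of_separately_continuous hx ht).mul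
      hΦc.stronglyMeasurable).aestronglyMeasurable (Eventually.of_forall fun z => ?_)
  by_cases hz : z ∈ ball (0 : EuclideanSpace ℝ (Fin N) × ℝ) ρ
  · rw [norm_mul]
    exact mul_le_mul_of_nonneg_right (hB z (ball_subset_ball hρ1.le hz)) (norm_nonneg _)
  · simp [hΦ z hz]

lemma continuous_integral_mul_of_separately_continuous
    (hx : ∀ t, Continuous fun x => h x t) (ht : ∀ x, Continuous fun t => h x t)
    (hB : ∀ z ∈ ball (0 : EuclideanSpace ℝ (Fin N) × ℝ) 1, |h z.1 z.2| ≤ B) (hρ1 : ρ < 1)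
    (hΦc : Continuous Φ) (hΦ : ∀ z, z ∉ ball (0 : EuclideanSpace ℝ (Fin N) × ℝ) ρ → Φ z = 0) :
    Continuous fun t => ∫ x, h x t * Φ (x, t) := by
  have hΦs : HasCompactSupport Φ := HasCompactSupport.intro
    (isCompact_closedBall (0 : EuclideanSpace ℝ (Fin N) × ℝ) ρ) fun z hz =>
      hΦ z fun h => hz (ball_subset_closedBall h)
  obtain ⟨P, hP⟩ := hΦc.bounded_above_of_compact_support hΦs
  refine continuous_of_dominated
    (bound := (ball (0 : EuclideanSpace ℝ (Fin N)) ρ).indicator (fun _ => B * P)) (fun t => ?_)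
    (fun t => Eventually.of_forall fun x => abs_mul_le_indicator hB hρ1 hP hΦ x t) ?_
    (Eventually.of_forall fun x => ?_)
  · have := hx t
    exact Continuous.aestronglyMeasurable (by fun_prop)
  · exact (integrable_indicator_iff measurableSet_ball).2 (integrableOn_const measure_ball_lt_top.ne)
  · have := ht x
    fun_prop

lemma hasDerivAt_slice {Φ : EuclideanSpace ℝ (Fin N) × ℝ → ℝ} (hΦ : ContDiff ℝ 1 Φ)
    (x : EuclideanSpace ℝ (Fin N)) (t : ℝ) :
    HasDerivAt (fun s => Φ (x, s)) (dirDeriv (0, 1) Φ (x, t)) t :=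
  (hΦ.differentiable (by norm_num) (x, t)).hasFDerivAt.comp_hasDerivAt t
    ((hasDerivAt_const t x).prodMk (hasDerivAt_id t))

lemma dirDeriv_slice {Φ : EuclideanSpace ℝ (Fin N) × ℝ → ℝ} (hΦ : ContDiff ℝ 1 Φ)
    (v x : EuclideanSpace ℝ (Fin N)) (t : ℝ) :
    dirDeriv v (fun y => Φ (y, t)) x = dirDeriv (v, 0) Φ (x, t) := by
  have h1 : HasFDerivAt (fun y => (y, t))
      ((ContinuousLinearMap.id ℝ (EuclideanSpace ℝ (Fin N))).prod 0) x :=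
    (hasFDerivAt_id x).prodMk (hasFDerivAt_const t x)
  have h2 : HasFDerivAt (fun y => Φ (y, t)) _ x :=
    (hΦ.differentiable (by norm_num) (x, t)).hasFDerivAt.comp x h1
  unfold dirDeriv
  rw [h2.fderiv]
  simp

/-- The Laplacian in the first variable of a function on space-time. -/
noncomputable def spaceLap (Φ : EuclideanSpace ℝ (Fin N) × ℝ → ℝ) :
    EuclideanSpace ℝ (Fin N) × ℝ → ℝ := fun z =>
  ∑ i, dirDeriv (EuclideanSpace.single i 1, 0) (dirDeriv (EuclideanSpace.single i 1, 0) Φ) z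

lemma lap_slice {Φ : EuclideanSpace ℝ (Fin N) × ℝ → ℝ} (hΦ : ContDiff ℝ 2 Φ)
    (x : EuclideanSpace ℝ (Fin N)) (t : ℝ) :
    lap (fun y => Φ (y, t)) x = spaceLap Φ (x, t) := by
  have h0 : ContDiff ℝ 2 fun y => Φ (y, t) := hΦ.comp (by fun_prop)
  rw [lap_eq_sum_dirDeriv h0]
  refine Finset.sum_congr rfl fun i _ => ?_
  have h1 : dirDeriv (EuclideanSpace.single i (1 : ℝ)) (fun y => Φ (y, t))
      = fun y => dirDeriv (EuclideanSpace.single i 1, 0) Φ (y, t) :=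
    funext fun y => dirDeriv_slice (hΦ.of_le (by norm_num)) _ _ _
  rw [h1, dirDeriv_slice (contDiff_dirDeriv hΦ (by norm_num) _)]

lemma continuous_spaceLap {Φ : EuclideanSpace ℝ (Fin N) × ℝ → ℝ} (hΦ : ContDiff ℝ 2 Φ) :
    Continuous (spaceLap Φ) :=
  continuous_finsetSum _ fun _ _ => continuous_dirDeriv (contDiff_dirDeriv hΦ (by norm_num) _) _

lemma spaceLap_eq_zero_of_notMem {Φ : EuclideanSpace ℝ (Fin N) × ℝ → ℝ}
    {z : EuclideanSpace ℝ (Fin N) × ℝ} (hz : z ∉ tsupport Φ) : spaceLap Φ z = 0 :=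
  Finset.sum_eq_zero fun _ _ => dirDeriv_eq_zero_of_notMem
    (fun h => hz (tsupport_dirDeriv_subset _ _ h)) _

/-- Separately regular bounded solutions of the inhomogeneous heat equation are weak solutions. -/
theorem integral_mul_adjoint_eq {w f : EuclideanSpace ℝ (Fin N) → ℝ → ℝ} {M F : ℝ}
    (hc2 : ∀ t, ContDiff ℝ 2 (fun x => w x t)) (hc1 : ∀ x, ContDiff ℝ 1 (fun t => w x t))
    (hpos : ∀ x ∈ ball (0 : EuclideanSpace ℝ (Fin N)) 1, ∀ t ∈ Ioo (-1 : ℝ) 1, 0 < w x t)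
    (hM : ∀ x ∈ ball (0 : EuclideanSpace ℝ (Fin N)) 1, ∀ t ∈ Ioo (-1 : ℝ) 1, w x t ≤ M)
    (hop : ∀ x ∈ ball (0 : EuclideanSpace ℝ (Fin N)) 1, ∀ t ∈ Ioo (-1 : ℝ) 1,
      HasHeatOpAt w (f x t) x t)
    (hf0 : ∀ x ∈ ball (0 : EuclideanSpace ℝ (Fin N)) 1, ∀ t ∈ Ioo (-1 : ℝ) 1, 0 ≤ f x t)
    (hfF : ∀ x ∈ ball (0 : EuclideanSpace ℝ (Fin N)) 1, ∀ t ∈ Ioo (-1 : ℝ) 1, f x t ≤ F)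
    (hfx : ∀ t, Continuous fun x => f x t) (hft : ∀ x, Continuous fun t => f x t)
    {ψ : EuclideanSpace ℝ (Fin N) × ℝ → ℝ} (hψ : ContDiff ℝ 2 ψ)
    (hψs : tsupport ψ ⊆ ball (0 : EuclideanSpace ℝ (Fin N) × ℝ) 1) :
    ∫ z : EuclideanSpace ℝ (Fin N) × ℝ, w z.1 z.2 * (-dirDeriv (0, 1) ψ z - spaceLap ψ z)
      = ∫ z : EuclideanSpace ℝ (Fin N) × ℝ, f z.1 z.2 * ψ z := by
  obtain ⟨ρ, ⟨hρ0, hρ1⟩, hρ⟩ := exists_pos_lt_subset_ball one_pos (isClosed_tsupport ψ) hψs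
  have hball : ∀ z ∈ ball (0 : EuclideanSpace ℝ (Fin N) × ℝ) 1,
      z.1 ∈ ball (0 : EuclideanSpace ℝ (Fin N)) 1 ∧ z.2 ∈ Ioo (-1 : ℝ) 1 := fun z hz => by
    rw [← Prod.mk_zero_zero, ← ball_prod_same] at hz
    refine ⟨hz.1, ?_⟩
    have := hz.2
    rw [Real.ball_eq_Ioo] at this
    simpa using this
  have hψ1 : ContDiff ℝ 1 ψ := hψ.of_le (by norm_num)
  have hψt1 : Continuous (dirDeriv ((0 : EuclideanSpace ℝ (Fin N)), (1 : ℝ)) ψ) :=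
    continuous_dirDeriv hψ1 _
  have hψL := continuous_spaceLap hψ
  have z1 : ∀ z, z ∉ ball (0 : EuclideanSpace ℝ (Fin N) × ℝ) ρ → ψ z = 0 := fun z hz =>
    image_eq_zero_of_notMem_tsupport fun h => hz (hρ h)
  have z2 : ∀ z, z ∉ ball (0 : EuclideanSpace ℝ (Fin N) × ℝ) ρ →
      dirDeriv ((0 : EuclideanSpace ℝ (Fin N)), (1 : ℝ)) ψ z + spaceLap ψ z = 0 := fun z hz => by
    rw [dirDeriv_eq_zero_of_notMem fun h => hz (hρ h), spaceLap_eq_zero_of_notMem fun h => hz (hρ h),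
      add_zero]
  have hψcs : HasCompactSupport ψ :=
    HasCompactSupport.intro (isCompact_closedBall (0 : EuclideanSpace ℝ (Fin N) × ℝ) ρ)
      fun z hz => z1 z fun h => hz (ball_subset_closedBall h)
  obtain ⟨P, hP⟩ := hψ.continuous.bounded_above_of_compact_support hψcs
  have hP0 : 0 ≤ P := (norm_nonneg _).trans (hP 0)
  obtain ⟨P1, hP1⟩ := hψ1.lipschitzWith_of_hasCompactSupport hψcs (by norm_num)
  have hwB : ∀ z ∈ ball (0 : EuclideanSpace ℝ (Fin N) × ℝ) 1, |w z.1 z.2| ≤ M := fun z hz => by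
    rw [abs_of_pos (hpos _ (hball z hz).1 _ (hball z hz).2)]
    exact hM _ (hball z hz).1 _ (hball z hz).2
  have hfB : ∀ z ∈ ball (0 : EuclideanSpace ℝ (Fin N) × ℝ) 1, |f z.1 z.2| ≤ F := fun z hz => by
    rw [abs_of_nonneg (hf0 _ (hball z hz).1 _ (hball z hz).2)]
    exact hfF _ (hball z hz).1 _ (hball z hz).2
  have hwx : ∀ t, Continuous fun x => w x t := fun t => (hc2 t).continuous
  have hwt : ∀ x, Continuous fun t => w x t := fun x => (hc1 x).continuous
  have i1 := integrable_mul_of_separately_continuous hwx hwt hwB hρ1 (hψt1.add hψL) z2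
  simp only [Pi.add_apply] at i1
  have i2 := integrable_mul_of_separately_continuous hfx hft hfB hρ1 hψ.continuous z1
  have c0 := continuous_integral_mul_of_separately_continuous hwx hwt hwB hρ1 hψ.continuous z1
  have c1 := continuous_integral_mul_of_separately_continuous hwx hwt hwB hρ1 (hψt1.add hψL) z2
  have c2 := continuous_integral_mul_of_separately_continuous hfx hft hfB hρ1 hψ.continuous z1
  have hslice : ∀ {Φ : EuclideanSpace ℝ (Fin N) × ℝ → ℝ}
      (_ : ∀ z, z ∉ ball (0 : EuclideanSpace ℝ (Fin N) × ℝ) ρ → Φ z = 0) (t : ℝ),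
      HasCompactSupport fun x => Φ (x, t) := fun hz t =>
    HasCompactSupport.intro (isCompact_closedBall (0 : EuclideanSpace ℝ (Fin N)) ρ) fun x hx =>
      hz _ fun h => hx (by
        rw [← Prod.mk_zero_zero, ← ball_prod_same] at h
        exact ball_subset_closedBall h.1)
  have hend : ∀ {Φ : EuclideanSpace ℝ (Fin N) × ℝ → ℝ}
      (_ : ∀ z, z ∉ ball (0 : EuclideanSpace ℝ (Fin N) × ℝ) ρ → Φ z = 0) (x) (t : ℝ),
      t ∉ Ioo (-ρ) ρ → Φ (x, t) = 0 := fun hz x t ht =>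
    hz _ fun h => ht (by
      rw [← Prod.mk_zero_zero, ← ball_prod_same] at h
      have := h.2
      rw [Real.ball_eq_Ioo] at this
      simpa using this)
  set J : ℝ → ℝ := fun t => ∫ x, w x t * ψ (x, t) with hJ
  set G : ℝ → ℝ := fun t => (∫ x, w x t * (dirDeriv (0, 1) ψ (x, t) + spaceLap ψ (x, t)))
    + ∫ x, f x t * ψ (x, t) with hG
  have hGc : Continuous G := c1.add c2
  have hderiv : ∀ t ∈ Ioo (-ρ) ρ, HasDerivWithinAt J (G t) (Ioi t) t := by
    intro t ht
    have ht1 : t ∈ Ioo (-1 : ℝ) 1 := ⟨by linarith [ht.1], by linarith [ht.2]⟩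
    obtain ⟨L, τ₀, hτ₀, hL0, hτ1, hL⟩ :=
      exists_time_lipschitz hc2 hc1 hpos hM hop hf0 hfF hρ1 ht1
    have hGt : G t = ∫ x, (deriv (fun s => w x s) t * ψ (x, t)
        + w x t * dirDeriv (0, 1) ψ (x, t)) := by
      have hψslice : ContDiff ℝ 2 fun y => ψ (y, t) := hψ.comp (by fun_prop)
      have hcs := hslice z1 t
      have e1 : ∫ x, w x t * spaceLap ψ (x, t) = ∫ x, lap (fun y => w y t) x * ψ (x, t) := by
        rw [integral_lap_mul (hc2 t) hψslice hcs]
        simp only [lap_slice hψ]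
      have hzt : ∀ z, z ∉ ball (0 : EuclideanSpace ℝ (Fin N) × ℝ) ρ →
          dirDeriv ((0 : EuclideanSpace ℝ (Fin N)), (1 : ℝ)) ψ z = 0 := fun z hz =>
        dirDeriv_eq_zero_of_notMem (fun h => hz (hρ h)) _
      have hzL : ∀ z, z ∉ ball (0 : EuclideanSpace ℝ (Fin N) × ℝ) ρ → spaceLap ψ z = 0 :=
        fun z hz => spaceLap_eq_zero_of_notMem fun h => hz (hρ h)
      have j1 : Integrable fun x => w x t * dirDeriv (0, 1) ψ (x, t) :=
        Continuous.integrable_of_hasCompactSupport ((hwx t).mul (by fun_prop))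
          (hslice hzt t).mul_left
      have j2 : Integrable fun x => w x t * spaceLap ψ (x, t) :=
        Continuous.integrable_of_hasCompactSupport ((hwx t).mul (by fun_prop))
          (hslice hzL t).mul_left
      have j3 : Integrable fun x => f x t * ψ (x, t) :=
        Continuous.integrable_of_hasCompactSupport ((hfx t).mul hψslice.continuous) hcs.mul_left
      have j4 : Integrable fun x => lap (fun y => w y t) x * ψ (x, t) :=
        Continuous.integrable_of_hasCompactSupport ((continuous_lap (hc2 t)).mul hψslice.continuous)
          hcs.mul_left
      have e2 : ∀ x, deriv (fun s => w x s) t * ψ (x, t) + w x t * dirDeriv (0, 1) ψ (x, t)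
          = w x t * dirDeriv (0, 1) ψ (x, t) + lap (fun y => w y t) x * ψ (x, t)
            + f x t * ψ (x, t) := by
        intro x
        by_cases hx : (x, t) ∈ ball (0 : EuclideanSpace ℝ (Fin N) × ℝ) ρ
        · have h1 := hball _ (ball_subset_ball hρ1.le hx)
          have h2 := (hop x h1.1 t h1.2).unique (hasHeatOpAt_of_contDiff hc2 hc1 x t)
          rw [h2]; ring
        · rw [z1 _ hx]; ring
      simp only [hG, e2]
      have e3 := integral_add (j1.add j4) j3
      simp only [Pi.add_apply] at e3
      rw [e3, integral_add j1 j4, ← e1, ← integral_add j1 j2]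
      simp only [mul_add]
    rw [hGt, hasDerivWithinAt_iff_tendsto_slope' (by simp)]
    have jq : ∀ s, Integrable fun x => w x s * ψ (x, s) := fun s =>
      Continuous.integrable_of_hasCompactSupport ((hwx s).mul
        (hψ.continuous.comp (by fun_prop))) (hslice z1 s).mul_left
    have hsl : ∀ s, slope J t s = ∫ x, slope (fun s => w x s * ψ (x, s)) t s := by
      intro s
      simp only [slope_def_module, smul_eq_mul, hJ]
      rw [← integral_sub (jq s) (jq t), ← integral_const_mul]
    simp only [funext hsl]
    refine tendsto_integral_filter_of_dominated_convergence
      ((ball (0 : EuclideanSpace ℝ (Fin N)) ρ).indicator (fun _ => L * P + M * P1)) ?_ ?_ ?_ ?_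
    · refine Eventually.of_forall fun s => ?_
      simp only [slope_def_module, smul_eq_mul]
      exact (((jq s).sub (jq t)).const_mul _).aestronglyMeasurable
    · have : ∀ᶠ s in 𝓝[>] t, s ∈ Ioo t (t + τ₀) := Ioo_mem_nhdsGT (by linarith)
      filter_upwards [this] with s hs
      refine Eventually.of_forall fun x => ?_
      by_cases hx : x ∈ ball (0 : EuclideanSpace ℝ (Fin N)) ρ
      · have hst : 0 < s - t := by linarith [hs.1]
        have hx1 := ball_subset_ball hρ1.le hx
        rw [indicator_of_mem hx, slope_def_module, norm_smul, norm_inv, Real.norm_of_nonneg hst.le,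
          inv_mul_le_iff₀ hst]
        have k1 := hL x (ball_subset_closedBall hx) (s - t) ⟨hst.le, by linarith [hs.2]⟩
        rw [add_sub_cancel] at k1
        have k2 : |ψ (x, s) - ψ (x, t)| ≤ P1 * (s - t) := by
          have := hP1.dist_le_mul (x, s) (x, t)
          rw [Prod.dist_eq, dist_self, Real.dist_eq, Real.dist_eq, abs_of_pos hst,
            max_eq_right hst.le] at this
          exact this
        have k3 : w x t ≤ M := hM x hx1 t ht1
        have k4 := hpos x hx1 t ht1
        have k5 : w x s * ψ (x, s) - w x t * ψ (x, t)
            = (w x s - w x t) * ψ (x, s) + w x t * (ψ (x, s) - ψ (x, t)) := by ring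
        rw [k5]
        calc ‖(w x s - w x t) * ψ (x, s) + w x t * (ψ (x, s) - ψ (x, t))‖
            ≤ |w x s - w x t| * ‖ψ (x, s)‖ + |w x t| * |ψ (x, s) - ψ (x, t)| := by
              refine (norm_add_le _ _).trans ?_
              rw [norm_mul, norm_mul]; rfl
          _ ≤ (L * (s - t)) * P + M * (P1 * (s - t)) := by
              rw [abs_of_pos k4]
              have := hP (x, s)
              have := k4.le.trans k3
              gcongr
          _ = (s - t) * (L * P + M * P1) := by ring
      · have : ∀ s, ψ (x, s) = 0 := fun s => z1 _ fun h => hx (by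
          rw [← Prod.mk_zero_zero, ← ball_prod_same] at h
          exact h.1)
        rw [indicator_of_notMem hx, slope_def_module]
        simp [this]
    · exact (integrable_indicator_iff measurableSet_ball).2
        (integrableOn_const measure_ball_lt_top.ne)
    · refine Eventually.of_forall fun x => ?_
      have k1 : HasDerivAt (fun s => w x s) (deriv (fun s => w x s) t) t :=
        ((hc1 x).differentiable (by norm_num) t).hasDerivAt
      exact (hasDerivWithinAt_iff_tendsto_slope' (by simp)).1
        (k1.mul (hasDerivAt_slice hψ1 x t)).hasDerivWithinAt
  have hFTC := intervalIntegral.integral_eq_sub_of_hasDeriv_right_of_le (a := -ρ) (b := ρ)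
    (by linarith) c0.continuousOn hderiv (hGc.intervalIntegrable _ _)
  have hGz : ∀ t, t ∉ Ioc (-ρ) ρ → G t = 0 := fun t ht => by
    have ht' : t ∉ Ioo (-ρ) ρ := fun h => ht (Ioo_subset_Ioc_self h)
    simp only [hG, hend z2 _ t ht', hend z1 _ t ht', mul_zero, integral_zero, add_zero]
  have hJ1 : J ρ = 0 := by simp only [hJ, hend z1 _ ρ (by simp), mul_zero, integral_zero]
  have hJ2 : J (-ρ) = 0 := by simp only [hJ, hend z1 _ (-ρ) (by simp), mul_zero, integral_zero]
  have hGI : ∫ t, G t = 0 := by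
    rw [← setIntegral_eq_integral_of_forall_compl_eq_zero (s := Ioc (-ρ) ρ) hGz,
      ← intervalIntegral.integral_of_le (by linarith), hFTC, hJ1, hJ2, sub_zero]
  have hFub : ∫ t, G t = ∫ z : EuclideanSpace ℝ (Fin N) × ℝ,
      (w z.1 z.2 * (dirDeriv (0, 1) ψ z + spaceLap ψ z) + f z.1 z.2 * ψ z) := by
    rw [integral_add i1 i2, Measure.volume_eq_prod, integral_prod_symm _ i1, integral_prod_symm _ i2,
      ← integral_add]
    · exact i1.integral_prod_right
    · exact i2.integral_prod_right
  rw [hGI] at hFub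
  have e4 := integral_add i1 i2
  rw [← hFub] at e4
  have e5 : ∫ z : EuclideanSpace ℝ (Fin N) × ℝ, w z.1 z.2 * (-dirDeriv (0, 1) ψ z - spaceLap ψ z)
      = -∫ z : EuclideanSpace ℝ (Fin N) × ℝ,
        w z.1 z.2 * (dirDeriv (0, 1) ψ z + spaceLap ψ z) := by
    rw [← integral_neg]
    congr 1; ext z; ring
  rw [e5]
  linarith

end WeakForm

section DivergenceIdentities

open Filter Topology
open scoped ContDiff

section Rules

variable {F : Type*} [NormedAddCommGroup F] [NormedSpace ℝ F] {f g : F → ℝ} {z : F} (w : F)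

lemma dirDeriv_mul (hf : DifferentiableAt ℝ f z) (hg : DifferentiableAt ℝ g z) :
    dirDeriv w (fun y => f y * g y) z = dirDeriv w f z * g z + f z * dirDeriv w g z := by
  unfold dirDeriv
  have h : HasFDerivAt (fun y => f y * g y) _ z := hf.hasFDerivAt.mul hg.hasFDerivAt
  rw [h.fderiv]
  simp
  ring

lemma dirDeriv_const_mul (c : ℝ) (hf : DifferentiableAt ℝ f z) :
    dirDeriv w (fun y => c * f y) z = c * dirDeriv w f z := by
  unfold dirDeriv
  rw [(hf.hasFDerivAt.const_mul c).fderiv]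
  simp

lemma dirDeriv_sum {ι : Type*} (s : Finset ι) {h : ι → F → ℝ}
    (hh : ∀ i ∈ s, DifferentiableAt ℝ (h i) z) :
    dirDeriv w (fun y => ∑ i ∈ s, h i y) z = ∑ i ∈ s, dirDeriv w (h i) z := by
  unfold dirDeriv
  rw [(HasFDerivAt.fun_sum fun i hi => (hh i hi).hasFDerivAt).fderiv]
  simp

lemma dirDeriv_sq (hf : DifferentiableAt ℝ f z) :
    dirDeriv w (fun y => f y ^ 2) z = 2 * f z * dirDeriv w f z := by
  simp only [pow_two]
  rw [dirDeriv_mul w hf hf]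
  ring

lemma dirDeriv_comp {φ : ℝ → ℝ} {φ' : ℝ} (hφ : HasDerivAt φ φ' (f z))
    (hf : DifferentiableAt ℝ f z) : dirDeriv w (fun y => φ (f y)) z = φ' * dirDeriv w f z := by
  unfold dirDeriv
  have h : HasFDerivAt (fun y => φ (f y)) _ z := hφ.comp_hasFDerivAt z hf.hasFDerivAt
  rw [h.fderiv]
  simp

lemma dirDeriv_comm (hf : ContDiff ℝ ∞ f) (w' : F) :
    dirDeriv w (dirDeriv w' f) z = dirDeriv w' (dirDeriv w f) z := by
  have h1 : DifferentiableAt ℝ (fderiv ℝ f) z :=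
    ((contDiff_infty.1 hf 2).fderiv_right (m := 1) (by norm_num)).differentiable (by norm_num) z
  have h2 : ∀ a b : F, dirDeriv a (dirDeriv b f) z = fderiv ℝ (fderiv ℝ f) z a b := fun a b => by
    unfold dirDeriv
    have := (h1.hasFDerivAt.clm_apply (hasFDerivAt_const b z)).fderiv
    rw [this]
    simp
  rw [h2, h2]
  have h3 : ContDiff ℝ 2 f := contDiff_infty.1 hf 2
  exact (h3.contDiffAt.isSymmSndFDerivAt (by simp)) w w'

lemma contDiff_infty_dirDeriv (hf : ContDiff ℝ ∞ f) : ContDiff ℝ ∞ (dirDeriv w f) :=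
  contDiff_dirDeriv hf (by norm_num) w

end Rules

variable {N : ℕ}

/-- The partial derivative in the `a`-th space direction of a function on space-time. -/
noncomputable abbrev pd (a : Fin N) (f : EuclideanSpace ℝ (Fin N) × ℝ → ℝ) :
    EuclideanSpace ℝ (Fin N) × ℝ → ℝ := dirDeriv (EuclideanSpace.single a 1, 0) f

/-- The time derivative of a function on space-time. -/
noncomputable abbrev td (f : EuclideanSpace ℝ (Fin N) × ℝ → ℝ) :
    EuclideanSpace ℝ (Fin N) × ℝ → ℝ := dirDeriv (0, 1) f

/-- Integrable functions with vanishing integral. -/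
def ZeroMean (X : EuclideanSpace ℝ (Fin N) × ℝ → ℝ) : Prop :=
  Integrable X ∧ ∫ z, X z = 0

lemma ZeroMean.add {X Y : EuclideanSpace ℝ (Fin N) × ℝ → ℝ} (hX : ZeroMean X) (hY : ZeroMean Y) :
    ZeroMean fun z => X z + Y z :=
  ⟨hX.1.add hY.1, by rw [integral_add hX.1 hY.1, hX.2, hY.2, add_zero]⟩

lemma ZeroMean.const_mul {X : EuclideanSpace ℝ (Fin N) × ℝ → ℝ} (hX : ZeroMean X) (c : ℝ) :
    ZeroMean fun z => c * X z :=
  ⟨hX.1.const_mul c, by rw [integral_const_mul, hX.2, mul_zero]⟩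

lemma ZeroMean.sum {ι : Type*} {s : Finset ι} {X : ι → EuclideanSpace ℝ (Fin N) × ℝ → ℝ}
    (hX : ∀ i ∈ s, ZeroMean (X i)) : ZeroMean fun z => ∑ i ∈ s, X i z :=
  ⟨integrable_finsetSum _ fun i hi => (hX i hi).1, by
    rw [integral_finsetSum _ fun i hi => (hX i hi).1]
    exact Finset.sum_eq_zero fun i hi => (hX i hi).2⟩

lemma zeroMean_dirDeriv {h : EuclideanSpace ℝ (Fin N) × ℝ → ℝ} (hh : ContDiff ℝ ∞ h)
    (hs : HasCompactSupport h) (w : EuclideanSpace ℝ (Fin N) × ℝ) : ZeroMean (dirDeriv w h) := by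
  have h1 : ContDiff ℝ 1 h := hh.of_le (by exact_mod_cast le_top)
  refine ⟨(continuous_dirDeriv h1 w).integrable_of_hasCompactSupport (hasCompactSupport_dirDeriv hs w),
    ?_⟩
  rw [Measure.volume_eq_prod]
  exact integral_dirDeriv_eq_zero _ h1 hs w

lemma ZeroMean.sub {X Y : EuclideanSpace ℝ (Fin N) × ℝ → ℝ} (hX : ZeroMean X) (hY : ZeroMean Y) :
    ZeroMean fun z => X z - Y z :=
  ⟨hX.1.sub hY.1, by rw [integral_sub hX.1 hY.1, hX.2, hY.2, sub_zero]⟩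

lemma zeroMean_mul {ψ h : EuclideanSpace ℝ (Fin N) × ℝ → ℝ} (hψ : ContDiff ℝ ∞ ψ)
    (hψs : HasCompactSupport ψ) (hh : ContDiff ℝ ∞ h) (w : EuclideanSpace ℝ (Fin N) × ℝ) :
    ZeroMean fun z => dirDeriv w ψ z * h z + ψ z * dirDeriv w h z := by
  have := zeroMean_dirDeriv (hψ.mul hh) hψs.mul_right w
  convert this using 2 with z
  exact (dirDeriv_mul w (hψ.differentiable (by simp) z) (hh.differentiable (by simp) z)).symm

lemma ContDiff.differentiableAt_of_infty {F : Type*} [NormedAddCommGroup F] [NormedSpace ℝ F]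
    {f : F → ℝ} (hf : ContDiff ℝ ∞ f) (z : F) : DifferentiableAt ℝ f z :=
  hf.differentiable (by simp) z

variable {v φ : EuclideanSpace ℝ (Fin N) × ℝ → ℝ}

lemma contDiff_spaceLap (hv : ContDiff ℝ ∞ v) : ContDiff ℝ ∞ (spaceLap v) :=
  ContDiff.sum fun _ _ => contDiff_infty_dirDeriv _ (contDiff_infty_dirDeriv _ hv)

lemma zeroMean_bochner (hv : ContDiff ℝ ∞ v) (hφ : ContDiff ℝ ∞ φ) (hφs : HasCompactSupport φ) :
    ZeroMean fun z => φ z * (spaceLap v z) ^ 2 - φ z * (∑ a, ∑ b, (pd a (pd b v) z) ^ 2)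
      + spaceLap v z * (∑ a, pd a v z * pd a φ z)
      + 1 / 2 * (∑ a, (pd a v z) ^ 2) * spaceLap φ z := by
  have hg : ∀ a, ContDiff ℝ ∞ (pd a v) := fun a => contDiff_infty_dirDeriv _ hv
  have hA : ∀ a b, ContDiff ℝ ∞ (pd a (pd b v)) := fun a b => contDiff_infty_dirDeriv _ (hg b)
  have hφg : ∀ a, ContDiff ℝ ∞ (pd a φ) := fun a => contDiff_infty_dirDeriv _ hφ
  have hL : ContDiff ℝ ∞ (spaceLap v) := contDiff_spaceLap hv
  have hkey := ((ZeroMean.sum (s := Finset.univ) fun a _ =>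
    zeroMean_mul hφ hφs ((hg a).mul hL) (EuclideanSpace.single a 1, 0)).sub
    (ZeroMean.sum (s := Finset.univ) fun a _ => ZeroMean.sum (s := Finset.univ) fun b _ =>
      zeroMean_mul hφ hφs ((hg b).mul (hA a b)) (EuclideanSpace.single a 1, 0))).add
    (ZeroMean.sum (s := Finset.univ) fun a _ => ZeroMean.sum (s := Finset.univ) fun b _ =>
      (zeroMean_mul (hφg a) (hasCompactSupport_dirDeriv hφs _) ((hg b).pow 2)
        (EuclideanSpace.single a 1, 0)).const_mul (1 / 2))
  convert hkey using 2 with z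
  have hz : ∀ {f : EuclideanSpace ℝ (Fin N) × ℝ → ℝ}, ContDiff ℝ ∞ f → DifferentiableAt ℝ f z :=
    fun hf => hf.differentiableAt_of_infty z
  have e1 : ∀ a, pd a (fun z => pd a v z * spaceLap v z) z
      = pd a (pd a v) z * spaceLap v z + pd a v z * ∑ b, pd a (pd b (pd b v)) z := fun a => by
    refine (dirDeriv_mul _ (hz (hg a)) (hz hL)).trans ?_
    congr 2
    exact dirDeriv_sum _ _ fun b _ => hz (hA b b)
  have e2 : ∀ a b, pd a (fun z => pd b v z * pd a (pd b v) z) z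
      = pd a (pd b v) z * pd a (pd b v) z + pd b v z * pd a (pd a (pd b v)) z := fun a b =>
    dirDeriv_mul _ (hz (hg b)) (hz (hA a b))
  have e3 : ∀ a b, pd a (fun z => pd b v z ^ 2) z = 2 * pd b v z * pd a (pd b v) z := fun a b =>
    dirDeriv_sq _ (hz (hg b))
  have e4 : ∑ a, pd a v z * ∑ b, pd a (pd b (pd b v)) z
      = ∑ a, ∑ b, pd b v z * pd a (pd a (pd b v)) z := by
    simp only [Finset.mul_sum]
    rw [Finset.sum_comm]
    refine Finset.sum_congr rfl fun a _ => Finset.sum_congr rfl fun b _ => ?_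
    have h1 : pd a (pd b v) = pd b (pd a v) := funext fun y => dirDeriv_comm _ hv _
    have h2 : pd b (pd a (pd a v)) z = pd a (pd b (pd a v)) z := dirDeriv_comm _ (hg a) _
    rw [h1, h2]
  have e5 : spaceLap v z = ∑ a, pd a (pd a v) z := rfl
  have e6 : spaceLap φ z = ∑ a, pd a (pd a φ) z := rfl
  simp only [e1, e2, e3]
  have s1 : ∑ a, (pd a φ z * (pd a v z * spaceLap v z)
      + φ z * (pd a (pd a v) z * spaceLap v z + pd a v z * ∑ b, pd a (pd b (pd b v)) z))
      = spaceLap v z * (∑ a, pd a v z * pd a φ z) + φ z * spaceLap v z ^ 2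
        + φ z * ∑ a, pd a v z * ∑ b, pd a (pd b (pd b v)) z := by
    rw [pow_two]
    nth_rw 4 [e5]
    simp only [Finset.mul_sum, Finset.sum_mul, ← Finset.sum_add_distrib]
    exact Finset.sum_congr rfl fun a _ => by simp only [← Finset.mul_sum]; ring
  rw [s1, e4, e6]
  have s2 : ∑ a, ∑ b, (pd a φ z * (pd b v z * pd a (pd b v) z)
      + φ z * (pd a (pd b v) z * pd a (pd b v) z + pd b v z * pd a (pd a (pd b v)) z))
      = (∑ a, ∑ b, pd a φ z * (pd b v z * pd a (pd b v) z))
        + φ z * (∑ a, ∑ b, (pd a (pd b v) z) ^ 2)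
        + φ z * ∑ a, ∑ b, pd b v z * pd a (pd a (pd b v)) z := by
    simp only [Finset.mul_sum, ← Finset.sum_add_distrib]
    exact Finset.sum_congr rfl fun a _ => Finset.sum_congr rfl fun b _ => by ring
  have s3 : ∑ a, ∑ b, 1 / 2 * (pd a (pd a φ) z * pd b v z ^ 2
      + pd a φ z * (2 * pd b v z * pd a (pd b v) z))
      = 1 / 2 * (∑ a, (pd a v z) ^ 2) * (∑ a, pd a (pd a φ) z)
        + ∑ a, ∑ b, pd a φ z * (pd b v z * pd a (pd b v) z) := by
    rw [mul_assoc, Finset.sum_mul_sum, Finset.sum_comm]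
    simp only [Finset.mul_sum]
    rw [Finset.sum_comm (f := fun a b => pd a φ z * (pd b v z * pd a (pd b v) z))]
    simp only [← Finset.sum_add_distrib]
    exact Finset.sum_congr rfl fun a _ => Finset.sum_congr rfl fun b _ => by ring
  rw [s2, s3]
  ring

lemma zeroMean_grad_sq (hv : ContDiff ℝ ∞ v) (hpos : ∀ z, 0 < v z) (hφ : ContDiff ℝ ∞ φ)
    (hφs : HasCompactSupport φ) :
    ZeroMean fun z => φ z * ((v z)⁻¹ * (∑ a, (pd a v z) ^ 2)) * spaceLap v z
      + 2 * φ z * (v z)⁻¹ * (∑ a, ∑ b, pd a v z * pd b v z * pd a (pd b v) z)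
      - φ z * ((v z)⁻¹ * (∑ a, (pd a v z) ^ 2)) ^ 2
      + (v z)⁻¹ * (∑ a, (pd a v z) ^ 2) * (∑ a, pd a v z * pd a φ z) := by
  have hg : ∀ a, ContDiff ℝ ∞ (pd a v) := fun a => contDiff_infty_dirDeriv _ hv
  have hA : ∀ a b, ContDiff ℝ ∞ (pd a (pd b v)) := fun a b => contDiff_infty_dirDeriv _ (hg b)
  have hi : ContDiff ℝ ∞ fun z => (v z)⁻¹ := hv.inv fun z => (hpos z).ne'
  have hs : ContDiff ℝ ∞ fun z => ∑ b, (pd b v z) ^ 2 := ContDiff.sum fun b _ => (hg b).pow 2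
  have hkey := ZeroMean.sum (s := Finset.univ) fun a _ =>
    zeroMean_mul hφ hφs ((hi.mul hs).mul (hg a)) (EuclideanSpace.single a 1, 0)
  convert hkey using 2 with z
  have hz : ∀ {f : EuclideanSpace ℝ (Fin N) × ℝ → ℝ}, ContDiff ℝ ∞ f → DifferentiableAt ℝ f z :=
    fun hf => hf.differentiableAt_of_infty z
  have e1 : ∀ a, pd a (fun z => ∑ b, (pd b v z) ^ 2) z
      = 2 * ∑ b, pd b v z * pd a (pd b v) z := fun a => by
    refine (dirDeriv_sum _ _ fun b _ => hz ((hg b).pow 2)).trans ?_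
    rw [Finset.mul_sum]
    exact Finset.sum_congr rfl fun b _ => by rw [dirDeriv_sq _ (hz (hg b))]; ring
  have e2 : ∀ a, pd a (fun z => (v z)⁻¹) z = -(((v z)⁻¹) ^ 2 * pd a v z) := fun a => by
    refine (dirDeriv_comp _ (hasDerivAt_inv (hpos z).ne') (hz hv)).trans ?_
    field_simp
  have e3 : ∀ a, pd a (fun z => (v z)⁻¹ * (∑ b, (pd b v z) ^ 2) * pd a v z) z
      = (-(((v z)⁻¹) ^ 2 * pd a v z) * (∑ b, (pd b v z) ^ 2)
        + (v z)⁻¹ * (2 * ∑ b, pd b v z * pd a (pd b v) z)) * pd a v z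
        + (v z)⁻¹ * (∑ b, (pd b v z) ^ 2) * pd a (pd a v) z := fun a => by
    refine (dirDeriv_mul _ (hz (hi.mul hs)) (hz (hg a))).trans ?_
    rw [dirDeriv_mul _ (hz hi) (hz hs), ← e1, ← e2]
  simp only [e3]
  have e5 : spaceLap v z = ∑ a, pd a (pd a v) z := rfl
  have e6 : ∑ a, ∑ b, pd a v z * pd b v z * pd a (pd b v) z
      = ∑ a, pd a v z * ∑ b, pd b v z * pd a (pd b v) z := by
    simp only [Finset.mul_sum, mul_assoc]
  have e7 : (∑ a, (pd a v z) ^ 2) ^ 2 = ∑ a, pd a v z ^ 2 * (∑ a, (pd a v z) ^ 2) := by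
    rw [pow_two, Finset.sum_mul]
  rw [e5, e6, mul_pow, e7]
  generalize (∑ a, (pd a v z) ^ 2) = s
  obtain ⟨G, hG⟩ : ∃ G : Fin N → ℝ, ∀ a, ∑ b, pd b v z * pd a (pd b v) z = G a := ⟨_, fun _ => rfl⟩
  simp only [hG, Finset.mul_sum, ← Finset.sum_add_distrib, ← Finset.sum_sub_distrib]
  exact Finset.sum_congr rfl fun a _ => by ring

lemma zeroMean_source {f : EuclideanSpace ℝ (Fin N) × ℝ → ℝ} (hv : ContDiff ℝ ∞ v)
    (hf : ContDiff ℝ ∞ f) (hφ : ContDiff ℝ ∞ φ) (hφs : HasCompactSupport φ) :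
    ZeroMean fun z => φ z * (∑ a, pd a f z * pd a v z) + φ z * f z * spaceLap v z
      + f z * (∑ a, pd a v z * pd a φ z) := by
  have hg : ∀ a, ContDiff ℝ ∞ (pd a v) := fun a => contDiff_infty_dirDeriv _ hv
  have hkey := ZeroMean.sum (s := Finset.univ) fun a _ =>
    zeroMean_mul hφ hφs (hf.mul (hg a)) (EuclideanSpace.single a 1, 0)
  convert hkey using 2 with z
  have e5 : spaceLap v z = ∑ a, pd a (pd a v) z := rfl
  rw [e5]
  simp only [Finset.mul_sum, ← Finset.sum_add_distrib]
  refine Finset.sum_congr rfl fun a _ => ?_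
  rw [dirDeriv_mul _ (hf.differentiableAt_of_infty z) ((hg a).differentiableAt_of_infty z)]
  ring

lemma zeroMean_energy (hv : ContDiff ℝ ∞ v) (hφ : ContDiff ℝ ∞ φ) (hφs : HasCompactSupport φ) :
    ZeroMean fun z => φ z * td v z * spaceLap v z + td v z * (∑ a, pd a v z * pd a φ z)
      - 1 / 2 * td φ z * (∑ a, (pd a v z) ^ 2) := by
  have hg : ∀ a, ContDiff ℝ ∞ (pd a v) := fun a => contDiff_infty_dirDeriv _ hv
  have hT : ContDiff ℝ ∞ (td v) := contDiff_infty_dirDeriv _ hv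
  have hkey := (zeroMean_source hv hT hφ hφs).sub ((ZeroMean.sum (s := Finset.univ) fun a _ =>
    zeroMean_mul hφ hφs ((hg a).pow 2) (0, 1)).const_mul (1 / 2))
  convert hkey using 2 with z
  have e1 : ∀ a, td (fun z => pd a v z ^ 2) z = 2 * (pd a (td v) z * pd a v z) := fun a => by
    refine (dirDeriv_sq _ ((hg a).differentiableAt_of_infty z)).trans ?_
    rw [dirDeriv_comm _ hv]
    ring
  simp only [e1]
  rw [Finset.sum_add_distrib, ← Finset.mul_sum, ← Finset.mul_sum, ← Finset.mul_sum]
  ring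

end DivergenceIdentities

section PointwiseAlgebra

set_option maxHeartbeats 1000000 in
lemma exists_absorption {α κ κ' θ p D₄ : ℝ} (D : ℝ → ℝ) (hα : 0 < α) (hθ : 0 ≤ θ) (hp : 0 ≤ p)
    (hκ : θ * p < κ') (hD : ∀ δ, 0 < δ → 0 ≤ D δ) (hD₄ : 0 ≤ D₄) :
    ∃ c₁ c₂ c₃ c₄ C : ℝ, 0 ≤ C ∧ ∀ X Y LL TT Ff EE b P₁ P₂ P₃ P₄ : ℝ, 0 ≤ X → 0 ≤ Y →
      (∀ δ, 0 < δ → α * X + κ' * Y ≤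
        (θ + δ) * LL + (κ' + 1) * δ * X + D δ * (TT + EE + b) - P₁ - κ * P₂) →
      (∀ δ, 0 < δ → LL ≤ p * Y + δ * (LL + Ff) + D δ * (TT + EE + b) - P₃) →
      TT ≤ D₄ * (EE + b) + 2 * P₄ → Ff ≤ 3 * (LL + TT + EE) → 0 ≤ b →
      X + Ff ≤ C * (EE + b) + (c₁ * P₁ + c₂ * P₂ + c₃ * P₃ + c₄ * P₄) := by
  have hθp : 0 ≤ θ * p := by positivity
  have hκ0 : 0 < κ' := by linarith
  set c₀ := κ' - θ * p with hc₀
  have hc₀p : 0 < c₀ := by simp only [hc₀]; linarith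
  obtain ⟨δ, hδ, hδ1, hδ2, hδ3⟩ : ∃ δ : ℝ, 0 < δ ∧ δ ≤ 1 / 8 ∧ (κ' + 1) * δ ≤ α / 2 ∧
      δ * (4 * κ' + p) ≤ c₀ / 2 := by
    refine ⟨min (1 / 8) (min (α / 2 / (κ' + 1)) (c₀ / 2 / (4 * κ' + p))), by positivity,
      min_le_left _ _, ?_, ?_⟩
    · rw [mul_comm, ← le_div_iff₀ (by positivity)]
      exact (min_le_right _ _).trans (min_le_left _ _)
    · rw [← le_div_iff₀ (by positivity)]
      exact (min_le_right _ _).trans (min_le_right _ _)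
  have hD0 := hD δ hδ
  set E := D δ
  set ν := (1 - 4 * δ)⁻¹ with hν
  have hν4 : 0 < 1 - 4 * δ := by linarith
  have hν0 : 0 < ν := by positivity
  have hν1 : ν * (1 - 4 * δ) = 1 := inv_mul_cancel₀ hν4.ne'
  set μ := ν * (θ + δ) with hμ
  have hμ0 : 0 ≤ μ := by positivity
  have hμp : μ * p ≤ κ' - c₀ / 2 := by
    have h1 : p * (θ + δ) ≤ (1 - 4 * δ) * (κ' - c₀ / 2) := by
      have : 0 ≤ δ * c₀ := by positivity
      simp only [hc₀] at *
      nlinarith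
    calc μ * p = ν * (p * (θ + δ)) := by simp only [hμ]; ring
      _ ≤ ν * ((1 - 4 * δ) * (κ' - c₀ / 2)) := by gcongr
      _ = κ' - c₀ / 2 := by rw [← mul_assoc, hν1, one_mul]
  set M := 2 / α + 6 * ν * p / c₀ with hM
  have hM0 : 0 ≤ M := by positivity
  set C₃ := M * (E + μ * (E + 3 * δ)) + 3 * ν * (E + 3 * δ) + 3 with hC₃
  have hC₃0 : 0 ≤ C₃ := by positivity
  refine ⟨-M, -(M * κ), -(M * μ + 3 * ν), 2 * C₃, C₃ * (D₄ + 1), by positivity, ?_⟩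
  intro X Y LL TT Ff EE b P₁ P₂ P₃ P₄ hX hY h1 h2 h4 h5 hb
  have h1 := h1 δ hδ
  have h2 := h2 δ hδ
  set W := TT + EE + b with hW
  have h6 : (1 - 4 * δ) * LL ≤ p * Y + (E + 3 * δ) * W - P₃ := by
    have := mul_le_mul_of_nonneg_left h5 hδ.le
    have : 0 ≤ δ * b := by positivity
    simp only [hW] at *
    nlinarith
  have h7 : LL ≤ ν * (p * Y + (E + 3 * δ) * W - P₃) := by
    have := mul_le_mul_of_nonneg_left h6 hν0.le
    rwa [← mul_assoc, hν1, one_mul] at this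
  have h8 : (θ + δ) * LL ≤ μ * (p * Y + (E + 3 * δ) * W - P₃) := by
    have := mul_le_mul_of_nonneg_left h7 (by positivity : 0 ≤ θ + δ)
    simp only [hμ]
    linarith
  have h9 : α / 2 * X + c₀ / 2 * Y ≤ (E + μ * (E + 3 * δ)) * W - P₁ - κ * P₂ - μ * P₃ := by
    have a1 := mul_le_mul_of_nonneg_right hδ2 hX
    have a2 := mul_le_mul_of_nonneg_right hμp hY
    nlinarith
  have h10 : X + 3 * ν * p * Y ≤ M * (α / 2 * X + c₀ / 2 * Y) := by
    have : M * (α / 2 * X + c₀ / 2 * Y) = X + 3 * ν * p * Y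
        + (6 * ν * p / c₀ * (α / 2)) * X + (c₀ / α) * Y := by
      simp only [hM]
      field_simp
      ring
    rw [this]
    have : 0 ≤ (6 * ν * p / c₀ * (α / 2)) * X := by positivity
    have : 0 ≤ (c₀ / α) * Y := by positivity
    linarith
  have h11 := mul_le_mul_of_nonneg_left h9 hM0
  have h12 : X + Ff ≤ C₃ * W - M * P₁ - M * κ * P₂ - (M * μ + 3 * ν) * P₃ := by
    have e1 : C₃ * W = M * ((E + μ * (E + 3 * δ)) * W) + 3 * (ν * ((E + 3 * δ) * W)) + 3 * W := by
      rw [hC₃]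
      ring
    have e2 : 3 * W = 3 * TT + 3 * EE + 3 * b := by
      rw [hW]
      ring
    rw [e1]
    clear_value C₃ W M μ ν E
    linarith
  have h13 := mul_le_mul_of_nonneg_left
    (show W ≤ (D₄ + 1) * (EE + b) + 2 * P₄ by simp only [hW]; linarith) hC₃0
  linarith

lemma sq_trace_sub_le {N : ℕ} (hN : 1 ≤ N) (A : Fin N → Fin N → ℝ) (g : Fin N → ℝ) (w κ : ℝ) :
    1 / (N : ℝ) * ((∑ a, A a a) - κ * (w * ∑ a, g a ^ 2)) ^ 2 ≤
      (∑ a, ∑ b, A a b ^ 2) - 2 * κ * w * (∑ a, ∑ b, g a * g b * A a b)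
        + κ ^ 2 * (w * ∑ a, g a ^ 2) ^ 2 := by
  have hN' : (0 : ℝ) < N := by exact_mod_cast hN
  set B : Fin N → Fin N → ℝ := fun a b => A a b - κ * w * (g a * g b) with hB
  have h1 : (∑ a, A a a) - κ * (w * ∑ a, g a ^ 2) = ∑ a, B a a := by
    simp only [hB, Finset.sum_sub_distrib, Finset.mul_sum]
    congr 1
    exact Finset.sum_congr rfl fun a _ => by ring
  have h2 : (∑ a, ∑ b, A a b ^ 2) - 2 * κ * w * (∑ a, ∑ b, g a * g b * A a b)
        + κ ^ 2 * (w * ∑ a, g a ^ 2) ^ 2 = ∑ a, ∑ b, B a b ^ 2 := by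
    rw [mul_pow, pow_two (∑ a, g a ^ 2), Finset.sum_mul_sum]
    simp only [hB, Finset.mul_sum, ← Finset.sum_sub_distrib, ← Finset.sum_add_distrib]
    exact Finset.sum_congr rfl fun a _ => Finset.sum_congr rfl fun b _ => by ring
  rw [h1, h2, div_mul_eq_mul_div, one_mul, div_le_iff₀ hN', mul_comm]
  calc (∑ a, B a a) ^ 2 ≤ (N : ℝ) * ∑ a, B a a ^ 2 := by
        simpa using sq_sum_le_card_mul_sum_sq (s := Finset.univ) (f := fun a => B a a)
    _ ≤ N * ∑ a, ∑ b, B a b ^ 2 := by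
        gcongr with a
        exact Finset.single_le_sum (f := fun b => B a b ^ 2) (fun _ _ => sq_nonneg _)
          (Finset.mem_univ a)

lemma mul_le_of_sq_le {φ w x a δ : ℝ} (hφ : 0 ≤ φ) (hw : 0 ≤ w) (hδ : 0 < δ)
    (h : a ^ 2 ≤ φ * w) : x * a ≤ δ * (φ * x ^ 2) + w / (4 * δ) := by
  refine (abs_le_of_sq_le_sq' (a := x * a) ?_ (by positivity)).2
  have h1 : (δ * (φ * x ^ 2) + w / (4 * δ)) ^ 2 =
      (δ * (φ * x ^ 2) - w / (4 * δ)) ^ 2 + x ^ 2 * (φ * w) := by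
    field_simp
    ring
  rw [h1, mul_pow]
  nlinarith [sq_nonneg (δ * (φ * x ^ 2) - w / (4 * δ)), mul_le_mul_of_nonneg_left h (sq_nonneg x)]

lemma mul_sub_le_of_pos {φ x T e δ : ℝ} (hφ : 0 ≤ φ) (hδ : 0 < δ) :
    φ * (x * (T - e)) ≤ δ * (φ * x ^ 2) + 1 / (2 * δ) * (φ * T ^ 2 + φ * e ^ 2) := by
  have h : x * (T - e) ≤ δ * x ^ 2 + 1 / (2 * δ) * (T ^ 2 + e ^ 2) := by
    have : δ * x ^ 2 + 1 / (2 * δ) * (T ^ 2 + e ^ 2) - x * (T - e)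
        = 1 / (4 * δ) * ((2 * δ * x - (T - e)) ^ 2 + (T + e) ^ 2) := by
      field_simp
      ring
    have h2 : 0 ≤ 1 / (4 * δ) * ((2 * δ * x - (T - e)) ^ 2 + (T + e) ^ 2) := by positivity
    linarith
  calc φ * (x * (T - e)) ≤ φ * (δ * x ^ 2 + 1 / (2 * δ) * (T ^ 2 + e ^ 2)) := by gcongr
    _ = _ := by ring

lemma bochner_pointwise {N : ℕ} (hN : 1 ≤ N) (A : Fin N → Fin N → ℝ) (g : Fin N → ℝ)
    {w φ Γ c κ δ L T e f a₁ dφ : ℝ} (hφ : 0 ≤ φ) (hΓ : 0 ≤ Γ) (hc : 0 ≤ c) (hκ : 0 ≤ κ)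
    (hδ : 0 < δ) (hL : L = ∑ a, A a a) (hT : T - L - f = e)
    (ha : a₁ ^ 2 ≤ φ * (c * Γ * ∑ a, g a ^ 2)) (hd : dφ ≤ c * Γ) :
    (κ - κ ^ 2 * (1 - 1 / N)) * (φ * (w * ∑ a, g a ^ 2) ^ 2)
        + κ * (1 + 2 / N) * (φ * (w * ∑ a, g a ^ 2) * f) ≤
      (1 - 1 / N + δ) * (φ * L ^ 2) + (κ * (1 + 2 / N) + 1) * δ * (φ * (w * ∑ a, g a ^ 2) ^ 2)
        + κ * (1 + 2 / N) * (1 / (2 * δ)) * (φ * T ^ 2 + φ * e ^ 2)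
        + ((1 + κ ^ 2) * (c / (4 * δ)) + c / 2) * (Γ * ∑ a, g a ^ 2)
        - (φ * L ^ 2 - φ * (∑ a, ∑ b, A a b ^ 2) + L * a₁ + 1 / 2 * (∑ a, g a ^ 2) * dφ)
        - κ * (φ * (w * ∑ a, g a ^ 2) * L + 2 * φ * w * (∑ a, ∑ b, g a * g b * A a b)
          - φ * (w * ∑ a, g a ^ 2) ^ 2 + w * (∑ a, g a ^ 2) * a₁) := by
  have hN' : (0 : ℝ) < N := by exact_mod_cast hN
  have h0 := sq_trace_sub_le hN A g w κ
  rw [← hL] at h0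
  have hs : 0 ≤ ∑ a, g a ^ 2 := Finset.sum_nonneg fun _ _ => sq_nonneg _
  generalize (∑ a, g a ^ 2) = s at *
  generalize (∑ a, ∑ b, A a b ^ 2) = A2 at *
  generalize (∑ a, ∑ b, g a * g b * A a b) = G at *
  set q := w * s with hq
  have hκ' : 0 ≤ κ * (1 + 2 / N) := by positivity
  have h1 : L * a₁ ≤ δ * (φ * L ^ 2) + c * Γ * s / (4 * δ) :=
    mul_le_of_sq_le hφ (by positivity) hδ ha
  have h2 : q * (κ * a₁) ≤ δ * (φ * q ^ 2) + κ ^ 2 * (c * Γ * s) / (4 * δ) := by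
    refine mul_le_of_sq_le hφ (by positivity) hδ ?_
    have := mul_le_mul_of_nonneg_left ha (sq_nonneg κ)
    nlinarith
  have h3 := mul_le_mul_of_nonneg_left (mul_sub_le_of_pos (x := q) (T := T) (e := e) hφ hδ) hκ'
  have h4 : 1 / 2 * s * dφ ≤ c / 2 * (Γ * s) := by
    have := mul_le_mul_of_nonneg_left hd hs
    linarith
  have h5 := mul_le_mul_of_nonneg_left h0 hφ
  have h6 : T - e = L + f := by linarith
  rw [h6] at h3
  have e1 : (1 + κ ^ 2) * (c / (4 * δ)) * (Γ * s)
      = c * Γ * s / (4 * δ) + κ ^ 2 * (c * Γ * s) / (4 * δ) := by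
    field_simp
  have e2 : φ * (1 / (N : ℝ) * (L - κ * q) ^ 2)
    = 1 / (N : ℝ) * (φ * L ^ 2) - 2 / N * (κ * φ * L * q) + 1 / N * (κ ^ 2 * (φ * q ^ 2)) := by
    ring
  have e3 : κ * (1 + 2 / N) * (φ * (q * (L + f))) = κ * (φ * q * L) + 2 / N * (κ * φ * L * q)
    + κ * (1 + 2 / N) * (φ * q * f) := by ring
  rw [e2] at h5
  rw [e3] at h3
  linarith

lemma source_pointwise {φ Γ c δ L T e f a₁ s Z : ℝ} (hφ : 0 ≤ φ) (hΓ : 0 ≤ Γ) (hc : 0 ≤ c)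
    (hδ : 0 < δ) (hs : 0 ≤ s) (hT : T - L - f = e) (ha : a₁ ^ 2 ≤ φ * (c * Γ * s)) :
    φ * L ^ 2 ≤ φ * Z + δ * (φ * L ^ 2 + φ * f ^ 2) + 1 / (2 * δ) * (φ * T ^ 2 + φ * e ^ 2)
      + c / (4 * δ) * (Γ * s) - (φ * Z + φ * f * L + f * a₁) := by
  have h1 : f * a₁ ≤ δ * (φ * f ^ 2) + c * Γ * s / (4 * δ) :=
    mul_le_of_sq_le hφ (by positivity) hδ ha
  have h2 := mul_sub_le_of_pos (x := L) (T := T) (e := e) hφ hδ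
  have h3 : T - e = L + f := by linarith
  rw [h3] at h2
  have e1 : c / (4 * δ) * (Γ * s) = c * Γ * s / (4 * δ) := by field_simp
  rw [e1]
  linarith

lemma energy_pointwise {φ Γ c L T e f a₁ s φt : ℝ} (hφ : 0 ≤ φ) (hΓ : 0 ≤ Γ) (hc : 0 ≤ c)
    (hs : 0 ≤ s) (hT : T - L - f = e) (ha : a₁ ^ 2 ≤ φ * (c * Γ * s)) (hφt : φt ≤ c * Γ) :
    1 / 2 * (φ * T ^ 2) ≤ (φ * T * L + T * a₁ - 1 / 2 * φt * s) + φ * f * T + φ * e ^ 2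
      + 3 / 2 * c * (Γ * s) := by
  have h1 : (-T) * a₁ ≤ 1 / 4 * (φ * (-T) ^ 2) + c * Γ * s / (4 * (1 / 4)) :=
    mul_le_of_sq_le hφ (by positivity) (by norm_num) ha
  have h2 : φ * (T * e) ≤ φ * (1 / 4 * T ^ 2 + e ^ 2) := by
    gcongr
    nlinarith [sq_nonneg (T / 2 - e)]
  have h3 : φt * s ≤ c * (Γ * s) := by
    have := mul_le_mul_of_nonneg_right hφt hs
    linarith
  have h4 : φ * T ^ 2 = φ * T * L + φ * f * T + φ * (T * e) := by
    have : T = L + f + e := by linarith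
    calc φ * T ^ 2 = φ * T * T := by ring
      _ = φ * T * (L + f + e) := by rw [← this]
      _ = _ := by ring
  norm_num at h1
  linarith

lemma exists_interpolation {r β₀ : ℝ} (hr : 0 < r) (hβ : 0 < β₀) {k : ℕ} (hk : 1 ≤ k * r) {η : ℝ}
    (hη : 0 < η) : ∃ C : ℝ, 0 ≤ C ∧ ∀ ξ v s f : ℝ, 0 < ξ → ξ ≤ 1 → 0 < v → 0 ≤ s →
      β₀ * v ^ (2 * r + 1) ≤ f →
      ξ ^ (2 * k + 2) * s + ξ ^ (2 * k + 2) * v ^ (2 * r + 2) ≤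
        η * (ξ ^ (2 * k + 4) * (v⁻¹ * s) ^ 2 + ξ ^ (2 * k + 4) * f ^ 2) + C := by
  set A := 1 / (4 * η) + 1 with hA
  set K := max 1 (A / (η * β₀ ^ 2)) with hK
  have hK1 : 1 ≤ K := le_max_left _ _
  have hK0 : 0 < K := by linarith
  have hA0 : 0 < A := by positivity
  have hKA : A ≤ η * β₀ ^ 2 * K := by
    have : A / (η * β₀ ^ 2) ≤ K := le_max_right _ _
    rw [div_le_iff₀ (by positivity)] at this
    linarith
  refine ⟨A * (K ^ (1 / r) * K), by positivity, fun ξ v s f hξ hξ1 hv hs hf => ?_⟩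
  set W := ξ ^ (2 * k) * v ^ 2 with hW
  have hW0 : 0 ≤ W := by positivity
  set y := ξ ^ 2 * v ^ (2 * r) with hy
  have hy0 : 0 < y := by positivity
  have hWy : W ≤ y ^ (1 / r) := by
    have h1 : (y : ℝ) ^ (1 / r) = ξ ^ (2 / r) * v ^ 2 := by
      rw [hy, Real.mul_rpow (by positivity) (by positivity), ← Real.rpow_natCast ξ 2,
        ← Real.rpow_mul hξ.le, ← Real.rpow_mul hv.le, ← Real.rpow_natCast v 2]
      congr 2
      · push_cast; ring
      · push_cast; field_simp
    rw [h1]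
    simp only [hW]
    gcongr
    rw [← Real.rpow_natCast]
    refine Real.rpow_le_rpow_of_exponent_ge hξ hξ1 ?_
    rw [div_le_iff₀ hr]
    push_cast
    linarith
  have e1 : ξ ^ (2 * k + 2) * v ^ (2 * r + 2) = W * y := by
    rw [Real.rpow_add hv, Real.rpow_ofNat]
    simp only [hW, hy]
    ring
  have e2 : ξ ^ (2 * k + 4) * (v ^ (2 * r + 1)) ^ 2 = W * y ^ 2 := by
    rw [Real.rpow_add hv, Real.rpow_one]
    simp only [hW, hy]
    ring
  have e3 : β₀ ^ 2 * (W * y ^ 2) ≤ ξ ^ (2 * k + 4) * f ^ 2 := by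
    rw [← e2]
    calc β₀ ^ 2 * (ξ ^ (2 * k + 4) * (v ^ (2 * r + 1)) ^ 2)
        = ξ ^ (2 * k + 4) * (β₀ * v ^ (2 * r + 1)) ^ 2 := by ring
      _ ≤ _ := by gcongr
  have e4 : ξ ^ (2 * k + 2) * s ≤ η * (ξ ^ (2 * k + 4) * (v⁻¹ * s) ^ 2) + 1 / (4 * η) * W := by
    have h2 : η * (ξ ^ (2 * k + 4) * (v⁻¹ * s) ^ 2) + 1 / (4 * η) * W - ξ ^ (2 * k + 2) * s
        = ξ ^ (2 * k) * η * (ξ ^ 2 * (v⁻¹ * s) - v / (2 * η)) ^ 2 := by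
      simp only [hW]
      field_simp
      ring
    have h3 : 0 ≤ ξ ^ (2 * k) * η * (ξ ^ 2 * (v⁻¹ * s) - v / (2 * η)) ^ 2 := by positivity
    linarith
  have e5 : 1 / (4 * η) * W + W * y ≤ A * (W * y ^ 2) / K + A * (K ^ (1 / r) * K) := by
    have hA1 : 0 < 1 / (4 * η) := by positivity
    rcases le_total K y with h | h
    · have h1 : W ≤ W * y ^ 2 / K := by
        rw [le_div_iff₀ hK0]
        gcongr
        nlinarith
      have h2 : W * y ≤ W * y ^ 2 / K := by
        rw [le_div_iff₀ hK0]
        calc W * y * K ≤ W * y * y := mul_le_mul_of_nonneg_left h (by positivity)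
          _ = W * y ^ 2 := by ring
      have h3 : 0 ≤ A * (K ^ (1 / r) * K) := by positivity
      have h4 := mul_le_mul_of_nonneg_left h1 hA1.le
      have h5 : A * (W * y ^ 2) / K = 1 / (4 * η) * (W * y ^ 2 / K) + W * y ^ 2 / K := by
        rw [hA]
        ring
      linarith
    · have h1 : W ≤ K ^ (1 / r) := hWy.trans (by gcongr)
      have h2 : W ≤ K ^ (1 / r) * K := h1.trans (le_mul_of_one_le_right (by positivity) hK1)
      have h3 : W * y ≤ K ^ (1 / r) * K := by gcongr
      have h4 := mul_le_mul_of_nonneg_left h2 hA1.le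
      have h5 : 0 ≤ A * (W * y ^ 2) / K := by positivity
      have h6 : A * (K ^ (1 / r) * K) = 1 / (4 * η) * (K ^ (1 / r) * K) + K ^ (1 / r) * K := by
        rw [hA]
        ring
      linarith
  have e6 : A * (W * y ^ 2) / K ≤ η * (ξ ^ (2 * k + 4) * f ^ 2) := by
    rw [div_le_iff₀ hK0]
    calc A * (W * y ^ 2) ≤ η * β₀ ^ 2 * K * (W * y ^ 2) := by gcongr
      _ = η * (β₀ ^ 2 * (W * y ^ 2)) * K := by ring
      _ ≤ _ := by gcongr
  rw [e1]
  linarith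

end PointwiseAlgebra

section SmoothEstimate

open Filter Topology
open scoped ContDiff

variable {N m : ℕ}

lemma exists_cutoff_bounds {ξ : EuclideanSpace ℝ (Fin N) × ℝ → ℝ} (hξ : ContDiff ℝ ∞ ξ)
    (hξs : HasCompactSupport ξ) (h0 : ∀ z, 0 ≤ ξ z) (h1 : ∀ z, ξ z ≤ 1) (k : ℕ) :
    ∃ c : ℝ, 0 ≤ c ∧ ∀ z,
      (∑ a, (pd a (fun z => ξ z ^ (2 * k + 4)) z) ^ 2)
        ≤ ξ z ^ (2 * k + 4) * (c * ξ z ^ (2 * k + 2)) ∧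
      spaceLap (fun z => ξ z ^ (2 * k + 4)) z ≤ c * ξ z ^ (2 * k + 2) ∧
      |td (fun z => ξ z ^ (2 * k + 4)) z| ≤ c * ξ z ^ (2 * k + 2) := by
  have hg : ∀ a, ContDiff ℝ ∞ (pd a ξ) := fun a => contDiff_infty_dirDeriv _ hξ
  have hL : ContDiff ℝ ∞ (spaceLap ξ) := contDiff_spaceLap hξ
  have hs : ContDiff ℝ ∞ fun z => ∑ a, (pd a ξ z) ^ 2 := ContDiff.sum fun a _ => (hg a).pow 2
  have hT : ContDiff ℝ ∞ (td ξ) := contDiff_infty_dirDeriv _ hξ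
  obtain ⟨c₁, hc₁⟩ := hξs.isCompact.exists_bound_of_continuousOn hs.continuous.continuousOn
  obtain ⟨c₂, hc₂⟩ := hξs.isCompact.exists_bound_of_continuousOn hL.continuous.continuousOn
  obtain ⟨c₃, hc₃⟩ := hξs.isCompact.exists_bound_of_continuousOn hT.continuous.continuousOn
  set n : ℝ := 2 * k + 4 with hn
  have hn0 : 4 ≤ n := by simp only [hn]; linarith [(Nat.cast_nonneg k : (0 : ℝ) ≤ k)]
  set M := |c₁| + |c₂| + |c₃| with hM
  have hM0 : 0 ≤ M := by positivity
  refine ⟨2 * n ^ 2 * M, by positivity, fun z => ?_⟩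
  have hz : ∀ {f : EuclideanSpace ℝ (Fin N) × ℝ → ℝ}, ContDiff ℝ ∞ f → ∀ z, DifferentiableAt ℝ f z :=
    fun hf z => hf.differentiableAt_of_infty z
  have hpow : ∀ (j : ℕ) (w y : EuclideanSpace ℝ (Fin N) × ℝ),
      dirDeriv w (fun z => ξ z ^ (j + 1)) y = (j + 1) * ξ y ^ j * dirDeriv w ξ y := fun j w y => by
    rw [dirDeriv_comp w (φ := fun x => x ^ (j + 1)) (hasDerivAt_pow (j + 1) (ξ y)) (hz hξ y)]
    push_cast
    simp
  have e1 : ∀ (w y : EuclideanSpace ℝ (Fin N) × ℝ),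
      dirDeriv w (fun z => ξ z ^ (2 * k + 4)) y = n * ξ y ^ (2 * k + 3) * dirDeriv w ξ y :=
    fun w y => by
      rw [hpow (2 * k + 3)]
      simp only [hn]
      push_cast
      ring
  have e2 : ∀ a, pd a (pd a (fun z => ξ z ^ (2 * k + 4))) z
      = n * (n - 1) * ξ z ^ (2 * k + 2) * (pd a ξ z) ^ 2
        + n * ξ z ^ (2 * k + 3) * pd a (pd a ξ) z := fun a => by
    have : pd a (fun z => ξ z ^ (2 * k + 4)) = fun y => n * ξ y ^ (2 * k + 3) * pd a ξ y :=
      funext fun y => e1 _ y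
    rw [this]
    have hp := (hξ.pow (2 * k + 3))
    refine (dirDeriv_mul _ (hz (contDiff_const.mul hp) z) (hz (hg a) z)).trans ?_
    rw [dirDeriv_const_mul _ _ (hz hp z), hpow (2 * k + 2)]
    simp only [hn]
    push_cast
    ring
  by_cases hzs : z ∈ tsupport ξ
  · have b1 : ∑ a, (pd a ξ z) ^ 2 ≤ M := by
      have := (le_abs_self _).trans (hc₁ z hzs)
      have := le_abs_self c₁
      have := abs_nonneg c₂
      have := abs_nonneg c₃
      linarith
    have b2 : spaceLap ξ z ≤ M := by
      have := (le_abs_self _).trans (hc₂ z hzs)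
      have := le_abs_self c₂
      have := abs_nonneg c₁
      have := abs_nonneg c₃
      linarith
    have b3 : |td ξ z| ≤ M := by
      have : |td ξ z| ≤ c₃ := hc₃ z hzs
      have := le_abs_self c₃
      have := abs_nonneg c₁
      have := abs_nonneg c₂
      linarith
    have hx0 := h0 z
    have hx1 := h1 z
    refine ⟨?_, ?_, ?_⟩
    · simp only [pd, e1]
      have : ∑ a, (n * ξ z ^ (2 * k + 3) * dirDeriv (EuclideanSpace.single a 1, 0) ξ z) ^ 2
          = n ^ 2 * ξ z ^ (2 * k + 4) * ξ z ^ (2 * k + 2) * ∑ a, (pd a ξ z) ^ 2 := by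
        rw [Finset.mul_sum]
        exact Finset.sum_congr rfl fun a _ => by ring
      rw [this]
      calc n ^ 2 * ξ z ^ (2 * k + 4) * ξ z ^ (2 * k + 2) * ∑ a, (pd a ξ z) ^ 2
          ≤ n ^ 2 * ξ z ^ (2 * k + 4) * ξ z ^ (2 * k + 2) * (2 * M) := by
            gcongr
            linarith
        _ = _ := by ring
    · have : spaceLap (fun z => ξ z ^ (2 * k + 4)) z = n * (n - 1) * ξ z ^ (2 * k + 2)
          * (∑ a, (pd a ξ z) ^ 2) + n * ξ z ^ (2 * k + 3) * spaceLap ξ z := by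
        refine (Finset.sum_congr rfl fun a _ => e2 a).trans ?_
        rw [Finset.sum_add_distrib, ← Finset.mul_sum, ← Finset.mul_sum]
        rfl
      rw [this]
      have a1 : n * (n - 1) * ξ z ^ (2 * k + 2) * (∑ a, (pd a ξ z) ^ 2)
          ≤ n * n * ξ z ^ (2 * k + 2) * M := by
        have hs0 : 0 ≤ ∑ a, (pd a ξ z) ^ 2 := Finset.sum_nonneg fun _ _ => sq_nonneg _
        gcongr
        linarith
      have a2 : n * ξ z ^ (2 * k + 3) * spaceLap ξ z ≤ n * n * ξ z ^ (2 * k + 2) * M := by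
        calc n * ξ z ^ (2 * k + 3) * spaceLap ξ z ≤ n * ξ z ^ (2 * k + 3) * M := by gcongr
          _ ≤ n * ξ z ^ (2 * k + 2) * M := by
            gcongr ?_ * ?_ * _
            exact pow_le_pow_of_le_one hx0 hx1 (by omega)
          _ ≤ n * n * ξ z ^ (2 * k + 2) * M := by
            gcongr
            nlinarith
      linarith
    · simp only [td, e1]
      rw [abs_mul, abs_of_nonneg (by positivity)]
      calc n * ξ z ^ (2 * k + 3) * |td ξ z| ≤ n * ξ z ^ (2 * k + 3) * M := by gcongr
        _ ≤ n * ξ z ^ (2 * k + 2) * M := by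
          gcongr ?_ * ?_ * _
          exact pow_le_pow_of_le_one hx0 hx1 (by omega)
        _ ≤ 2 * n ^ 2 * M * ξ z ^ (2 * k + 2) := by
          have h2 : 0 ≤ ξ z ^ (2 * k + 2) * M := by positivity
          have h3 : n * (ξ z ^ (2 * k + 2) * M) ≤ 2 * n ^ 2 * (ξ z ^ (2 * k + 2) * M) :=
            mul_le_mul_of_nonneg_right (by nlinarith) h2
          linarith
  · have d0 : ∀ w, dirDeriv w ξ z = 0 := fun w => dirDeriv_eq_zero_of_notMem hzs w
    have x0 : ξ z = 0 := image_eq_zero_of_notMem_tsupport hzs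
    refine ⟨?_, ?_, ?_⟩
    · simp [pd, e1, d0, x0]
    · have : spaceLap (fun z => ξ z ^ (2 * k + 4)) z = 0 :=
        Finset.sum_eq_zero fun a _ => (e2 a).trans (by simp [x0])
      rw [this]
      simp [x0]
    · simp [td, e1, d0, x0]

/-- The nonlinearity of the system. -/
noncomputable def src (β : Fin m → Fin m → ℝ) (r : ℝ) (w : Fin m → ℝ) (i : Fin m) : ℝ :=
  ∑ j, β i j * w i ^ r * w j ^ (r + 1)

variable {β : Fin m → Fin m → ℝ} {r : ℝ}

lemma src_nonneg (hβ : ∀ i j, 0 ≤ β i j) {w : Fin m → ℝ} (hw : ∀ i, 0 < w i) (i : Fin m) :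
    0 ≤ src β r w i :=
  Finset.sum_nonneg fun j _ => by
    have := hβ i j
    have := hw i
    have := hw j
    positivity

lemma le_src (hβ : ∀ i j, 0 ≤ β i j) {w : Fin m → ℝ} (hw : ∀ i, 0 < w i) (i : Fin m) :
    β i i * w i ^ (2 * r + 1) ≤ src β r w i := by
  have : β i i * w i ^ (2 * r + 1) = β i i * w i ^ r * w i ^ (r + 1) := by
    rw [mul_assoc, ← Real.rpow_add (hw i)]
    congr 2
    ring
  rw [this]
  refine Finset.single_le_sum (f := fun j => β i j * w i ^ r * w j ^ (r + 1)) (fun j _ => ?_)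
    (Finset.mem_univ i)
  have := hβ i j
  have := hw i
  have := hw j
  positivity

lemma sum_grad_src_le (hr : 0 < r) (hβ : ∀ i j, 0 ≤ β i j) (hsym : ∀ i j, β i j = β j i)
    {w : Fin m → ℝ} (hw : ∀ i, 0 < w i) (g : Fin m → Fin N → ℝ) :
    ∑ i, ∑ a, (∑ j, β i j * (r * w i ^ (r - 1) * g i a * w j ^ (r + 1)
      + w i ^ r * ((r + 1) * w j ^ r * g j a))) * g i a ≤
    (2 * r + 1) * ∑ i, (w i)⁻¹ * (∑ a, g i a ^ 2) * src β r w i := by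
  set M : Fin m → Fin m → ℝ := fun i j => β i j * (w i ^ r * w j ^ r) with hM
  set q : Fin m → ℝ := fun i => (w i)⁻¹ * (∑ a, g i a ^ 2) with hq
  have hM0 : ∀ i j, 0 ≤ M i j := fun i j => by
    have := hβ i j
    have := hw i
    have := hw j
    positivity
  have hMs : ∀ i j, M i j = M j i := fun i j => by
    simp only [hM]
    rw [hsym i j]
    ring
  have h1 : ∀ i j, ∑ a, g i a * g j a ≤ 1 / 2 * (w j * q i + w i * q j) := fun i j => by
    have hi := hw i
    have hj := hw j
    simp only [hq, Finset.mul_sum, ← Finset.sum_add_distrib]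
    refine Finset.sum_le_sum fun a _ => ?_
    have : 1 / 2 * (w j * ((w i)⁻¹ * g i a ^ 2) + w i * ((w j)⁻¹ * g j a ^ 2)) - g i a * g j a
        = (w i)⁻¹ * (w j)⁻¹ / 2 * (w j * g i a - w i * g j a) ^ 2 := by
      field_simp
      ring
    have h2 : 0 ≤ (w i)⁻¹ * (w j)⁻¹ / 2 * (w j * g i a - w i * g j a) ^ 2 := by positivity
    linarith
  have e1 : ∀ i, ∑ a, (∑ j, β i j * (r * w i ^ (r - 1) * g i a * w j ^ (r + 1)
      + w i ^ r * ((r + 1) * w j ^ r * g j a))) * g i a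
      = ∑ j, M i j * (r * (w j * q i) + (r + 1) * ∑ a, g i a * g j a) := fun i => by
    simp only [Finset.sum_mul]
    rw [Finset.sum_comm]
    refine Finset.sum_congr rfl fun j _ => ?_
    simp only [hq, hM, Finset.mul_sum, ← Finset.sum_add_distrib]
    refine Finset.sum_congr rfl fun a _ => ?_
    have hi := hw i
    rw [Real.rpow_sub_one hi.ne', Real.rpow_add_one (hw j).ne']
    field_simp
  have e2 : ∑ i, ∑ j, M i j * (w i * q j) = ∑ i, ∑ j, M i j * (w j * q i) := by
    rw [Finset.sum_comm]
    exact Finset.sum_congr rfl fun i _ => Finset.sum_congr rfl fun j _ => by rw [hMs]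
  have e3 : ∀ i, q i * src β r w i = ∑ j, M i j * (w j * q i) := fun i => by
    simp only [src, Finset.mul_sum, hM]
    refine Finset.sum_congr rfl fun j _ => ?_
    rw [Real.rpow_add_one (hw j).ne']
    ring
  simp only [e1]
  calc ∑ i, ∑ j, M i j * (r * (w j * q i) + (r + 1) * ∑ a, g i a * g j a)
      ≤ ∑ i, ∑ j, M i j * (r * (w j * q i) + (r + 1) * (1 / 2 * (w j * q i + w i * q j))) := by
        gcongr with i _ j _
        · exact hM0 i j
        · exact h1 i j
    _ = (r + (r + 1) / 2) * (∑ i, ∑ j, M i j * (w j * q i))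
          + (r + 1) / 2 * ∑ i, ∑ j, M i j * (w i * q j) := by
        simp only [Finset.mul_sum, ← Finset.sum_add_distrib]
        exact Finset.sum_congr rfl fun i _ => Finset.sum_congr rfl fun j _ => by ring
    _ = (2 * r + 1) * ∑ i, ∑ j, M i j * (w j * q i) := by
        rw [e2]
        ring
    _ = _ := by rw [Finset.sum_congr rfl fun i _ => e3 i]

lemma contDiff_src {v : Fin m → EuclideanSpace ℝ (Fin N) × ℝ → ℝ} (hv : ∀ i, ContDiff ℝ ∞ (v i))
    (hpos : ∀ i z, 0 < v i z) (i : Fin m) : ContDiff ℝ ∞ fun z => src β r (fun j => v j z) i :=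
  ContDiff.sum fun j _ => (contDiff_const.mul
    ((hv i).rpow_const_of_ne fun z => (hpos i z).ne')).mul
    ((hv j).rpow_const_of_ne fun z => (hpos j z).ne')

lemma dirDeriv_rpow {F : Type*} [NormedAddCommGroup F] [NormedSpace ℝ F] {f : F → ℝ} {z : F} (w : F)
    (hf : DifferentiableAt ℝ f z) (h0 : f z ≠ 0) (s : ℝ) :
    dirDeriv w (fun y => f y ^ s) z = s * f z ^ (s - 1) * dirDeriv w f z :=
  dirDeriv_comp w (φ := fun x => x ^ s) (Real.hasDerivAt_rpow_const (Or.inl h0)) hf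

lemma dirDeriv_src {v : Fin m → EuclideanSpace ℝ (Fin N) × ℝ → ℝ} (hv : ∀ i, ContDiff ℝ ∞ (v i))
    (hpos : ∀ i z, 0 < v i z) (i : Fin m) (w z : EuclideanSpace ℝ (Fin N) × ℝ) :
    dirDeriv w (fun z => src β r (fun j => v j z) i) z =
      ∑ j, β i j * (r * v i z ^ (r - 1) * dirDeriv w (v i) z * v j z ^ (r + 1)
        + v i z ^ r * ((r + 1) * v j z ^ r * dirDeriv w (v j) z)) := by
  have hz : ∀ {f : EuclideanSpace ℝ (Fin N) × ℝ → ℝ}, ContDiff ℝ ∞ f → DifferentiableAt ℝ f z :=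
    fun hf => hf.differentiableAt_of_infty z
  have hp : ∀ i (s : ℝ), ContDiff ℝ ∞ fun z => v i z ^ s := fun i s =>
    (hv i).rpow_const_of_ne fun z => (hpos i z).ne'
  refine (dirDeriv_sum w Finset.univ (h := fun j z => β i j * v i z ^ r * v j z ^ (r + 1))
    fun j _ => hz ((contDiff_const.mul (hp i r)).mul (hp j (r + 1)))).trans ?_
  refine Finset.sum_congr rfl fun j _ => ?_
  rw [dirDeriv_mul w (hz (contDiff_const.mul (hp i r))) (hz (hp j (r + 1))),
    dirDeriv_const_mul w _ (hz (hp i r)), dirDeriv_rpow w (hz (hv i)) (hpos i z).ne',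
    dirDeriv_rpow w (hz (hv j)) (hpos j z).ne', add_sub_cancel_right]
  ring

/-- The potential of the nonlinearity. -/
noncomputable def pot (β : Fin m → Fin m → ℝ) (r : ℝ) (w : Fin m → ℝ) : ℝ :=
  (2 * (r + 1))⁻¹ * ∑ i, ∑ j, β i j * (w i ^ (r + 1) * w j ^ (r + 1))

lemma contDiff_pot {v : Fin m → EuclideanSpace ℝ (Fin N) × ℝ → ℝ} (hv : ∀ i, ContDiff ℝ ∞ (v i))
    (hpos : ∀ i z, 0 < v i z) : ContDiff ℝ ∞ fun z => pot β r (fun j => v j z) :=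
  contDiff_const.mul (ContDiff.sum fun i _ => ContDiff.sum fun j _ => contDiff_const.mul
    (((hv i).rpow_const_of_ne fun z => (hpos i z).ne').mul
    ((hv j).rpow_const_of_ne fun z => (hpos j z).ne')))

lemma dirDeriv_pot (hr : 0 < r) (hsym : ∀ i j, β i j = β j i)
    {v : Fin m → EuclideanSpace ℝ (Fin N) × ℝ → ℝ} (hv : ∀ i, ContDiff ℝ ∞ (v i))
    (hpos : ∀ i z, 0 < v i z) (w z : EuclideanSpace ℝ (Fin N) × ℝ) :
    dirDeriv w (fun z => pot β r (fun j => v j z)) z =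
      ∑ i, src β r (fun j => v j z) i * dirDeriv w (v i) z := by
  have hz : ∀ {f : EuclideanSpace ℝ (Fin N) × ℝ → ℝ}, ContDiff ℝ ∞ f → DifferentiableAt ℝ f z :=
    fun hf => hf.differentiableAt_of_infty z
  have hp : ∀ i (s : ℝ), ContDiff ℝ ∞ fun z => v i z ^ s := fun i s =>
    (hv i).rpow_const_of_ne fun z => (hpos i z).ne'
  have hij : ∀ i j, ContDiff ℝ ∞ fun z => β i j * (v i z ^ (r + 1) * v j z ^ (r + 1)) := fun i j =>
    contDiff_const.mul ((hp i _).mul (hp j _))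
  have e1 : ∀ i j, dirDeriv w (fun z => β i j * (v i z ^ (r + 1) * v j z ^ (r + 1))) z
      = (r + 1) * (β i j * v i z ^ r * v j z ^ (r + 1) * dirDeriv w (v i) z)
        + (r + 1) * (β j i * v j z ^ r * v i z ^ (r + 1) * dirDeriv w (v j) z) := fun i j => by
    rw [dirDeriv_const_mul w _ (hz ((hp i _).mul (hp j _))), dirDeriv_mul w (hz (hp i _)) (hz (hp j _)),
      dirDeriv_rpow w (hz (hv i)) (hpos i z).ne',
      dirDeriv_rpow w (hz (hv j)) (hpos j z).ne', add_sub_cancel_right, hsym j i]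
    ring
  have e2 : dirDeriv w (fun z => pot β r (fun j => v j z)) z = (2 * (r + 1))⁻¹ *
      ∑ i, ∑ j, dirDeriv w (fun z => β i j * (v i z ^ (r + 1) * v j z ^ (r + 1))) z := by
    refine (dirDeriv_const_mul w _ (hz (ContDiff.sum fun i _ => ContDiff.sum fun j _ => hij i j))).trans ?_
    congr 1
    refine (dirDeriv_sum w _ fun i _ => hz (ContDiff.sum fun j _ => hij i j)).trans ?_
    exact Finset.sum_congr rfl fun i _ => dirDeriv_sum w _ fun j _ => hz (hij i j)
  rw [e2]
  simp only [e1, Finset.sum_add_distrib]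
  rw [Finset.sum_comm (f := fun i j => (r + 1) * (β j i * v j z ^ r * v i z ^ (r + 1)
    * dirDeriv w (v j) z))]
  simp only [src, Finset.sum_mul, Finset.mul_sum, ← Finset.sum_add_distrib]
  refine Finset.sum_congr rfl fun i _ => Finset.sum_congr rfl fun j _ => ?_
  field_simp
  ring

lemma exists_pot_le (β : Fin m → Fin m → ℝ) (hr : 0 < r) : ∃ C : ℝ, 0 ≤ C ∧ ∀ w : Fin m → ℝ,
    (∀ i, 0 < w i) → |pot β r w| ≤ C * ∑ i, w i ^ (2 * r + 2) := by
  refine ⟨(2 * (r + 1))⁻¹ * ∑ i, ∑ j, |β i j|, by positivity, fun w hw => ?_⟩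
  have hS : ∀ i, w i ^ (r + 1) * w i ^ (r + 1) ≤ ∑ i, w i ^ (2 * r + 2) := fun i => by
    have : w i ^ (r + 1) * w i ^ (r + 1) = w i ^ (2 * r + 2) := by
      rw [← Real.rpow_add (hw i)]
      congr 1
      ring
    rw [this]
    exact Finset.single_le_sum (f := fun i => w i ^ (2 * r + 2))
      (fun j _ => (Real.rpow_pos_of_pos (hw j) _).le) (Finset.mem_univ i)
  have h1 : ∀ i j, |β i j * (w i ^ (r + 1) * w j ^ (r + 1))|
      ≤ |β i j| * ∑ i, w i ^ (2 * r + 2) := fun i j => by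
    have hi := Real.rpow_pos_of_pos (hw i) (r + 1)
    have hj := Real.rpow_pos_of_pos (hw j) (r + 1)
    rw [abs_mul, abs_of_pos (mul_pos hi hj)]
    gcongr
    have := hS i
    have := hS j
    nlinarith [sq_nonneg (w i ^ (r + 1) - w j ^ (r + 1))]
  rw [pot, abs_mul, abs_of_pos (by positivity : 0 < (2 * (r + 1))⁻¹), mul_assoc, Finset.sum_mul]
  gcongr
  refine (Finset.abs_sum_le_sum_abs _ _).trans (Finset.sum_le_sum fun i _ => ?_)
  rw [Finset.sum_mul]
  exact (Finset.abs_sum_le_sum_abs _ _).trans (Finset.sum_le_sum fun j _ => h1 i j)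

end SmoothEstimate

section IntegratedEstimate

open Filter Topology
open scoped ContDiff

variable {N m : ℕ} {β : Fin m → Fin m → ℝ} {r : ℝ}

lemma exists_bochner_parameter {p : ℝ} (hp : 0 < p) (hN : 1 ≤ N)
    (hpB : N = 1 ∨ (2 ≤ N ∧ p < ((N : ℝ) * (N + 2)) / ((N : ℝ) - 1) ^ 2)) :
    ∃ κ : ℝ, 0 < κ ∧ 0 < κ - κ ^ 2 * (1 - 1 / (N : ℝ)) ∧
      (1 - 1 / (N : ℝ)) * p < κ * (1 + 2 / N) := by
  rcases hpB with rfl | ⟨hN2, h⟩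
  · exact ⟨1, by norm_num, by norm_num, by norm_num⟩
  · have hN2' : (2 : ℝ) ≤ N := by exact_mod_cast hN2
    have hN1 : (0 : ℝ) < N - 1 := by linarith
    have h1 : p * (N - 1) / (N + 2) < N / (N - 1) := by
      rw [div_lt_div_iff₀ (by positivity) hN1]
      rw [lt_div_iff₀ (by positivity)] at h
      linarith
    obtain ⟨κ, hκ1, hκ2⟩ := exists_between h1
    have hκ0 : 0 < κ := lt_trans (by positivity) hκ1
    refine ⟨κ, hκ0, ?_, ?_⟩
    · rw [lt_div_iff₀ hN1] at hκ2
      have : κ - κ ^ 2 * (1 - 1 / (N : ℝ)) = κ / N * (N - κ * (N - 1)) := by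
        field_simp
      rw [this]
      have : 0 < N - κ * (N - 1) := by linarith
      positivity
    · rw [div_lt_iff₀ (by positivity)] at hκ1
      have e1 : (1 - 1 / (N : ℝ)) * p = p * (N - 1) / N := by field_simp
      have e2 : κ * (1 + 2 / (N : ℝ)) = κ * (N + 2) / N := by field_simp
      rw [e1, e2]
      gcongr

/-- The divergence in Bochner's identity. -/
noncomputable def bochnerDiv (φ v : EuclideanSpace ℝ (Fin N) × ℝ → ℝ)
    (z : EuclideanSpace ℝ (Fin N) × ℝ) : ℝ :=
  φ z * (spaceLap v z) ^ 2 - φ z * (∑ a, ∑ b, (pd a (pd b v) z) ^ 2)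
      + spaceLap v z * (∑ a, pd a v z * pd a φ z)
      + 1 / 2 * (∑ a, (pd a v z) ^ 2) * spaceLap φ z

/-- The space divergence of `φ v⁻¹ |∇v|² ∇v`. -/
noncomputable def gradDiv (φ v : EuclideanSpace ℝ (Fin N) × ℝ → ℝ)
    (z : EuclideanSpace ℝ (Fin N) × ℝ) : ℝ :=
  φ z * ((v z)⁻¹ * (∑ a, (pd a v z) ^ 2)) * spaceLap v z
      + 2 * φ z * (v z)⁻¹ * (∑ a, ∑ b, pd a v z * pd b v z * pd a (pd b v) z)
      - φ z * ((v z)⁻¹ * (∑ a, (pd a v z) ^ 2)) ^ 2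
      + (v z)⁻¹ * (∑ a, (pd a v z) ^ 2) * (∑ a, pd a v z * pd a φ z)

/-- The space divergence of `φ f ∇v`. -/
noncomputable def sourceDiv (φ f v : EuclideanSpace ℝ (Fin N) × ℝ → ℝ)
    (z : EuclideanSpace ℝ (Fin N) × ℝ) : ℝ :=
  φ z * (∑ a, pd a f z * pd a v z) + φ z * f z * spaceLap v z
      + f z * (∑ a, pd a v z * pd a φ z)

/-- The space-time divergence of the energy identity. -/
noncomputable def energyDiv (φ v : EuclideanSpace ℝ (Fin N) × ℝ → ℝ)
    (z : EuclideanSpace ℝ (Fin N) × ℝ) : ℝ :=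
  φ z * td v z * spaceLap v z + td v z * (∑ a, pd a v z * pd a φ z)
      - 1 / 2 * td φ z * (∑ a, (pd a v z) ^ 2)

/-- The defect of `v` in the system. -/
noncomputable def defect (β : Fin m → Fin m → ℝ) (r : ℝ)
    (v : Fin m → EuclideanSpace ℝ (Fin N) × ℝ → ℝ) (i : Fin m)
    (z : EuclideanSpace ℝ (Fin N) × ℝ) : ℝ :=
  td (v i) z - spaceLap (v i) z - src β r (fun j => v j z) i

lemma contDiff_defect {v : Fin m → EuclideanSpace ℝ (Fin N) × ℝ → ℝ} (hv : ∀ i, ContDiff ℝ ∞ (v i))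
    (hpos : ∀ i z, 0 < v i z) (i : Fin m) : ContDiff ℝ ∞ (defect β r v i) :=
  ((contDiff_infty_dirDeriv _ (hv i)).sub (contDiff_spaceLap (hv i))).sub (contDiff_src hv hpos i)

lemma coeff_mul_le {A₁ A₂ A₃ A₄ A₅ TT EE B₁ B₂ : ℝ} (h₁ : 0 ≤ A₁) (h₂ : 0 ≤ A₂) (h₃ : 0 ≤ A₃)
    (h₄ : 0 ≤ A₄) (h₅ : 0 ≤ A₅) (hT : 0 ≤ TT) (hE : 0 ≤ EE) (hB₁ : 0 ≤ B₁) (hB₂ : 0 ≤ B₂) :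
    A₁ * (TT + EE) + (A₃ + A₄) * B₁ ≤ (A₁ + A₂ + A₃ + A₄ + A₅) * (TT + EE + (B₁ + B₂)) ∧
    A₂ * (TT + EE) + A₅ * B₁ ≤ (A₁ + A₂ + A₃ + A₄ + A₅) * (TT + EE + (B₁ + B₂)) := by
  constructor
  · have : 0 ≤ (A₂ + A₃ + A₄ + A₅) * (TT + EE) + (A₁ + A₂ + A₅) * B₁
      + (A₁ + A₂ + A₃ + A₄ + A₅) * B₂ := by positivity
    linarith
  · have : 0 ≤ (A₁ + A₃ + A₄ + A₅) * (TT + EE) + (A₁ + A₂ + A₃ + A₄) * B₁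
      + (A₁ + A₂ + A₃ + A₄ + A₅) * B₂ := by positivity
    linarith

lemma absorb_half {C K X F I E b c₁ c₂ c₃ c₄ P₁ P₂ P₃ P₄ : ℝ} (hC : 0 ≤ C) (hK : 0 ≤ K) (hX : 0 ≤ X)
    (hF : 0 ≤ F) (hI : 0 ≤ I) (hE : 0 ≤ E) (hb : b ≤ (2 * (C + 1))⁻¹ * (X + F) + K * I)
    (h : X + F ≤ C * (E + b) + (c₁ * P₁ + c₂ * P₂ + c₃ * P₃ + c₄ * P₄)) :
    F ≤ 2 * C * (1 + K) * (E + I) + (2 * c₁ * P₁ + 2 * c₂ * P₂ + 2 * c₃ * P₃ + 2 * c₄ * P₄) := by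
  have h1 := mul_le_mul_of_nonneg_left hb hC
  have h2 : C * ((2 * (C + 1))⁻¹ * (X + F)) ≤ 1 / 2 * (X + F) := by
    rw [← mul_assoc]
    gcongr
    rw [← div_eq_mul_inv, div_le_iff₀ (by positivity)]
    linarith
  have h3 : 0 ≤ C * I := mul_nonneg hC hI
  have h4 : 0 ≤ C * K * E := by positivity
  linarith

section SumOfBounds

variable {ι : Type*} [Fintype ι] (X Y L T F E S W P G : ι → ℝ) (a b c d e g κ : ℝ)

lemma sum_interpolation_le (h : ∀ i, S i + W i ≤ a * (X i + F i) + b) :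
    (∑ i, S i) + ∑ i, W i ≤ a * ((∑ i, X i) + ∑ i, F i) + Fintype.card ι * b := by
  have := Finset.sum_le_sum fun i (_ : i ∈ Finset.univ) => h i
  simpa [Finset.sum_add_distrib, ← Finset.mul_sum] using this

lemma sum_bochner_le
    (h : ∀ i, a * X i + b * Y i ≤ c * L i + d * X i + e * (T i + E i) + g * S i - P i - κ * G i) :
    a * ∑ i, X i + b * ∑ i, Y i ≤ c * ∑ i, L i + d * ∑ i, X i
      + e * ((∑ i, T i) + ∑ i, E i) + g * ∑ i, S i - ∑ i, P i - κ * ∑ i, G i := by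
  have := Finset.sum_le_sum fun i (_ : i ∈ Finset.univ) => h i
  simpa only [Finset.sum_add_distrib, Finset.sum_sub_distrib, ← Finset.mul_sum] using this

lemma sum_source_le
    (h : ∀ i, L i ≤ Y i + a * (L i + F i) + b * (T i + E i) + c * S i - P i) :
    ∑ i, L i ≤ (∑ i, Y i) + a * ((∑ i, L i) + ∑ i, F i) + b * ((∑ i, T i) + ∑ i, E i)
      + c * ∑ i, S i - ∑ i, P i := by
  have := Finset.sum_le_sum fun i (_ : i ∈ Finset.univ) => h i
  simpa only [Finset.sum_add_distrib, Finset.sum_sub_distrib, ← Finset.mul_sum] using this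

lemma sum_energy_le (h : ∀ i, a * T i ≤ P i + Y i + E i + b * S i) :
    a * ∑ i, T i ≤ (∑ i, P i) + (∑ i, Y i) + (∑ i, E i) + b * ∑ i, S i := by
  have := Finset.sum_le_sum fun i (_ : i ∈ Finset.univ) => h i
  simpa only [Finset.sum_add_distrib, ← Finset.mul_sum] using this

end SumOfBounds

set_option maxHeartbeats 1000000 in
lemma exists_pointwise_estimate (hN : 1 ≤ N) (hr : 0 < r) (hβ : ∀ i j, 0 ≤ β i j)
    (hsym : ∀ i j, β i j = β j i) {β₀ : ℝ} (hβ₀ : 0 < β₀) (hdiag : ∀ i, β₀ ≤ β i i)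
    (hpB : N = 1 ∨ (2 ≤ N ∧ 2 * r + 1 < ((N : ℝ) * (N + 2)) / ((N : ℝ) - 1) ^ 2))
    {ξ : EuclideanSpace ℝ (Fin N) × ℝ → ℝ} (hξ : ContDiff ℝ ∞ ξ) (hξs : HasCompactSupport ξ)
    (h0 : ∀ z, 0 ≤ ξ z) (h1 : ∀ z, ξ z ≤ 1) {k : ℕ} (hk : 1 ≤ k * r) :
    ∃ c₁ c₂ c₃ c₄ C : ℝ, 0 ≤ C ∧ ∀ v : Fin m → EuclideanSpace ℝ (Fin N) × ℝ → ℝ,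
      (∀ i, ContDiff ℝ ∞ (v i)) → (∀ i z, 0 < v i z) → ∀ z,
      ξ z ^ (2 * k + 4) * ∑ i, src β r (fun j => v j z) i ^ 2 ≤
        C * (ξ z ^ (2 * k + 4) * ∑ i, defect β r v i z ^ 2 + (tsupport ξ).indicator 1 z)
        + (c₁ * ∑ i, bochnerDiv (fun z => ξ z ^ (2 * k + 4)) (v i) z
          + c₂ * ∑ i, gradDiv (fun z => ξ z ^ (2 * k + 4)) (v i) z
          + c₃ * ∑ i, sourceDiv (fun z => ξ z ^ (2 * k + 4)) (fun z => src β r (fun j => v j z) i)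
            (v i) z
          + c₄ * ((∑ i, energyDiv (fun z => ξ z ^ (2 * k + 4)) (v i) z)
            + (td (fun z => ξ z ^ (2 * k + 4)) z * pot β r (fun j => v j z)
              + ξ z ^ (2 * k + 4) * td (fun z => pot β r (fun j => v j z)) z))) := by
  have hp : 0 < 2 * r + 1 := by linarith
  have hN' : (1 : ℝ) ≤ N := by exact_mod_cast hN
  obtain ⟨κ, hκ, hα, hκp⟩ := exists_bochner_parameter hp hN hpB
  obtain ⟨c, hc, hcut⟩ := exists_cutoff_bounds hξ hξs h0 h1 k
  obtain ⟨Cp, hCp, hpot⟩ := exists_pot_le β hr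
  set κ' := κ * (1 + 2 / (N : ℝ)) with hκ'
  have hκ'0 : 0 < κ' := by positivity
  have hθ : 0 ≤ 1 - 1 / (N : ℝ) := by
    rw [sub_nonneg, div_le_one (by linarith)]
    exact hN'
  obtain ⟨c₁, c₂, c₃, c₄, C, hC, hab⟩ := exists_absorption (κ := κ) (D₄ := 2 + 3 * c + 2 * c * Cp)
    (fun δ => κ' * (1 / (2 * δ)) + 1 / (2 * δ) + (1 + κ ^ 2) * (c / (4 * δ)) + c / 2 + c / (4 * δ))
    hα hθ hp.le hκp (fun δ hδ => by positivity) (by positivity)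
  obtain ⟨C', hC', h_integrable⟩ := exists_interpolation hr hβ₀ hk (η := (2 * (C + 1))⁻¹) (by positivity)
  refine ⟨2 * c₁, 2 * c₂, 2 * c₃, 2 * c₄, 2 * C * (1 + m * C'), by positivity,
    fun v hv hpos z => ?_⟩
  obtain ⟨hcut1, hcut2, hcut3⟩ := hcut z
  set φ : EuclideanSpace ℝ (Fin N) × ℝ → ℝ := fun z => ξ z ^ (2 * k + 4) with hφ
  set w : Fin m → ℝ := fun j => v j z with hw
  have hwp : ∀ i, 0 < w i := fun i => hpos i z
  set s : Fin m → ℝ := fun i => ∑ a, (pd a (v i) z) ^ 2 with hs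
  set q : Fin m → ℝ := fun i => (v i z)⁻¹ * s i with hq
  set f : Fin m → ℝ := fun i => src β r w i with hf
  set e : Fin m → ℝ := fun i => defect β r v i z with he
  set T : Fin m → ℝ := fun i => td (v i) z with hT
  set L : Fin m → ℝ := fun i => spaceLap (v i) z with hL
  set a₁ : Fin m → ℝ := fun i => ∑ a, pd a (v i) z * pd a φ z with ha₁
  set Γ := ξ z ^ (2 * k + 2) with hΓ
  have hξ0 := h0 z
  have hΓ0 : 0 ≤ Γ := by positivity
  have hφ0 : 0 ≤ φ z := by simp only [hφ]; positivity
  have hs0 : ∀ i, 0 ≤ s i := fun i => Finset.sum_nonneg fun _ _ => sq_nonneg _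
  have hf0 : ∀ i, 0 ≤ f i := fun i => src_nonneg hβ hwp i
  have hq0 : ∀ i, 0 ≤ q i := fun i => mul_nonneg (inv_pos.2 (hwp i)).le (hs0 i)
  have hdef : ∀ i, T i - L i - f i = e i := fun i => rfl
  have ha : ∀ i, a₁ i ^ 2 ≤ φ z * (c * Γ * s i) := fun i => by
    refine (Finset.sum_mul_sq_le_sq_mul_sq _ _ _).trans ?_
    calc s i * ∑ a, (pd a φ z) ^ 2 ≤ s i * (φ z * (c * Γ)) :=
          mul_le_mul_of_nonneg_left hcut1 (hs0 i)
      _ = _ := by ring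
  have hb0 : ∀ i, 0 ≤ Γ * w i ^ (2 * r + 2) := fun i => by
    have := hwp i
    positivity
  have hB1 : 0 ≤ ∑ i, Γ * s i := Finset.sum_nonneg fun i _ => mul_nonneg hΓ0 (hs0 i)
  have hB2 : 0 ≤ ∑ i, Γ * w i ^ (2 * r + 2) := Finset.sum_nonneg fun i _ => hb0 i
  have hTT : 0 ≤ ∑ i, φ z * T i ^ 2 := Finset.sum_nonneg fun i _ => by positivity
  have hEE : 0 ≤ ∑ i, φ z * e i ^ 2 := Finset.sum_nonneg fun i _ => by positivity
  have key := hab (∑ i, φ z * q i ^ 2) (∑ i, φ z * q i * f i) (∑ i, φ z * L i ^ 2)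
    (∑ i, φ z * T i ^ 2) (∑ i, φ z * f i ^ 2) (∑ i, φ z * e i ^ 2)
    ((∑ i, Γ * s i) + ∑ i, Γ * w i ^ (2 * r + 2))
    (∑ i, bochnerDiv φ (v i) z) (∑ i, gradDiv φ (v i) z)
    (∑ i, sourceDiv φ (fun z => src β r (fun j => v j z) i) (v i) z)
    ((∑ i, energyDiv φ (v i) z) + (td φ z * pot β r w
              + φ z * td (fun z => pot β r (fun j => v j z)) z))
    (Finset.sum_nonneg fun i _ => by positivity)
    (Finset.sum_nonneg fun i _ => mul_nonneg (mul_nonneg hφ0 (hq0 i)) (hf0 i)) ?_ ?_ ?_ ?_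
    (by positivity)
  · have hb : (∑ i, Γ * s i) + ∑ i, Γ * w i ^ (2 * r + 2) ≤ (2 * (C + 1))⁻¹ *
        ((∑ i, φ z * q i ^ 2) + ∑ i, φ z * f i ^ 2) + m * C' * (tsupport ξ).indicator 1 z := by
      rcases hξ0.eq_or_lt with h | h
      · have hΓz : Γ = 0 := by simp [hΓ, ← h]
        have : 0 ≤ (tsupport ξ).indicator (1 : EuclideanSpace ℝ (Fin N) × ℝ → ℝ) z :=
          Set.indicator_nonneg (fun _ _ => zero_le_one) z
        simp only [hΓz, zero_mul, Finset.sum_const_zero, add_zero]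
        positivity
      · have hzs : z ∈ tsupport ξ := subset_tsupport _ h.ne'
        rw [Set.indicator_of_mem hzs]
        have h2 := fun i => h_integrable (ξ z) (v i z) (s i) (f i) h
          (h1 z) (hwp i) (hs0 i) (((mul_le_mul_of_nonneg_right (hdiag i)
            (Real.rpow_nonneg (hwp i).le _))).trans (le_src hβ hwp i))
        simpa using sum_interpolation_le (fun i => φ z * q i ^ 2) (fun i => φ z * f i ^ 2)
          (fun i => Γ * s i) (fun i => Γ * w i ^ (2 * r + 2)) _ _ h2
    have hφf : φ z * ∑ i, f i ^ 2 = ∑ i, φ z * f i ^ 2 := Finset.mul_sum _ _ _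
    have hφe : φ z * ∑ i, e i ^ 2 = ∑ i, φ z * e i ^ 2 := Finset.mul_sum _ _ _
    change φ z * ∑ i, f i ^ 2 ≤ 2 * C * (1 + m * C') * (φ z * ∑ i, e i ^ 2 + _) + _
    rw [hφf, hφe]
    have hX : 0 ≤ ∑ i, φ z * q i ^ 2 := Finset.sum_nonneg fun i _ => by positivity
    have hF : 0 ≤ ∑ i, φ z * f i ^ 2 := Finset.sum_nonneg fun i _ => by positivity
    have hI : 0 ≤ (tsupport ξ).indicator (1 : EuclideanSpace ℝ (Fin N) × ℝ → ℝ) z :=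
      Set.indicator_nonneg (fun _ _ => zero_le_one) z
    refine absorb_half hC (by positivity : 0 ≤ m * C') hX hF hI hEE hb key
  · intro δ hδ
    have h : ∀ i, (κ - κ ^ 2 * (1 - 1 / N)) * (φ z * q i ^ 2) + κ' * (φ z * q i * f i) ≤
      (1 - 1 / N + δ) * (φ z * L i ^ 2) + (κ' + 1) * δ * (φ z * q i ^ 2)
        + κ' * (1 / (2 * δ)) * (φ z * T i ^ 2 + φ z * e i ^ 2)
        + ((1 + κ ^ 2) * (c / (4 * δ)) + c / 2) * (Γ * s i)
        - bochnerDiv φ (v i) z - κ * gradDiv φ (v i) z := fun i =>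
      bochner_pointwise hN (fun a b => pd a (pd b (v i)) z) (fun a => pd a (v i) z)
        hφ0 hΓ0 hc hκ.le hδ rfl (hdef i) (ha i) hcut2
    have h' := sum_bochner_le (fun i => φ z * q i ^ 2) (fun i => φ z * q i * f i)
      (fun i => φ z * L i ^ 2) (fun i => φ z * T i ^ 2) (fun i => φ z * e i ^ 2)
      (fun i => Γ * s i) _ _ _ _ _ _ _ _ _ h
    have h2 := coeff_mul_le (A₁ := κ' * (1 / (2 * δ))) (A₂ := 1 / (2 * δ))
      (A₃ := (1 + κ ^ 2) * (c / (4 * δ))) (A₄ := c / 2) (A₅ := c / (4 * δ)) (by positivity)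
      (by positivity) (by positivity) (by positivity) (by positivity) hTT hEE hB1 hB2
    linarith [h2.1]
  · intro δ hδ
    have h : ∀ i, φ z * L i ^ 2 ≤
        φ z * (∑ a, pd a (fun z => src β r (fun j => v j z) i) z * pd a (v i) z)
        + δ * (φ z * L i ^ 2 + φ z * f i ^ 2) + 1 / (2 * δ) * (φ z * T i ^ 2 + φ z * e i ^ 2)
        + c / (4 * δ) * (Γ * s i)
        - sourceDiv φ (fun z => src β r (fun j => v j z) i) (v i) z := fun i =>
      source_pointwise hφ0 hΓ0 hc hδ (hs0 i) (hdef i) (ha i)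
    have h' := sum_source_le _ (fun i => φ z * L i ^ 2) (fun i => φ z * T i ^ 2)
      (fun i => φ z * f i ^ 2) (fun i => φ z * e i ^ 2) (fun i => Γ * s i) _ _ _ _ h
    have h3 : φ z * (∑ i, ∑ a, pd a (fun z => src β r (fun j => v j z) i) z * pd a (v i) z)
        ≤ (2 * r + 1) * ∑ i, φ z * q i * f i := by
      have h4 := sum_grad_src_le hr hβ hsym hwp fun i a => pd a (v i) z
      have h5 := mul_le_mul_of_nonneg_left h4 hφ0
      have h6 : φ z * ((2 * r + 1) * ∑ i, (w i)⁻¹ * (∑ a, pd a (v i) z ^ 2) * src β r w i)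
          = (2 * r + 1) * ∑ i, φ z * q i * f i := by
        rw [mul_left_comm, Finset.mul_sum]
        congr 1
        exact Finset.sum_congr rfl fun i _ => by simp only [hq, hf, hs, hw]; ring
      rw [h6] at h5
      refine le_trans (le_of_eq ?_) h5
      congr 1
      refine Finset.sum_congr rfl fun i _ => Finset.sum_congr rfl fun a _ => ?_
      rw [pd, dirDeriv_src hv hpos]
    rw [Finset.mul_sum] at h3
    have h2 := coeff_mul_le (A₁ := κ' * (1 / (2 * δ))) (A₂ := 1 / (2 * δ))
      (A₃ := (1 + κ ^ 2) * (c / (4 * δ))) (A₄ := c / 2) (A₅ := c / (4 * δ)) (by positivity)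
      (by positivity) (by positivity) (by positivity) (by positivity) hTT hEE hB1 hB2
    linarith [h2.2]
  · have h : ∀ i, 1 / 2 * (φ z * T i ^ 2) ≤ energyDiv φ (v i) z + φ z * f i * T i + φ z * e i ^ 2
        + 3 / 2 * c * (Γ * s i) := fun i =>
      energy_pointwise hφ0 hΓ0 hc (hs0 i) (hdef i) (ha i) ((le_abs_self _).trans hcut3)
    have h' := sum_energy_le (fun i => φ z * f i * T i) (fun i => φ z * T i ^ 2)
      (fun i => φ z * e i ^ 2) (fun i => Γ * s i) _ _ _ h
    have h2 : ∑ i, φ z * f i * T i = φ z * td (fun z => pot β r (fun j => v j z)) z := by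
      rw [td, dirDeriv_pot hr hsym hv hpos, Finset.mul_sum]
      exact Finset.sum_congr rfl fun i _ => mul_assoc _ _ _
    have h3 : -(td φ z * pot β r w) ≤ c * Cp * ∑ i, Γ * w i ^ (2 * r + 2) := by
      refine (neg_le_abs _).trans ?_
      rw [abs_mul, ← Finset.mul_sum]
      calc |td φ z| * |pot β r w| ≤ (c * Γ) * (Cp * ∑ i, w i ^ (2 * r + 2)) :=
            mul_le_mul hcut3 (hpot w hwp) (abs_nonneg _) (by positivity)
        _ = _ := by ring
    rw [h2] at h'
    have a1 : 0 ≤ c * (∑ i, Γ * w i ^ (2 * r + 2)) := mul_nonneg hc hB2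
    have a2 : 0 ≤ c * (∑ i, φ z * e i ^ 2) := mul_nonneg hc hEE
    have a3 : 0 ≤ c * Cp * (∑ i, φ z * e i ^ 2) := mul_nonneg (mul_nonneg hc hCp) hEE
    have a4 : 0 ≤ c * Cp * (∑ i, Γ * s i) := mul_nonneg (mul_nonneg hc hCp) hB1
    linarith
  · rw [← Finset.sum_add_distrib, ← Finset.sum_add_distrib, Finset.mul_sum]
    refine Finset.sum_le_sum fun i _ => ?_
    have h2 : f i = T i - L i - e i := by linarith [hdef i]
    have h3 : f i ^ 2 ≤ 3 * (L i ^ 2 + T i ^ 2 + e i ^ 2) := by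
      rw [h2]
      nlinarith [sq_nonneg (T i + L i), sq_nonneg (T i + e i), sq_nonneg (L i - e i)]
    nlinarith [mul_le_mul_of_nonneg_left h3 hφ0]

lemma exists_smooth_estimate (hN : 1 ≤ N) (hr : 0 < r) (hβ : ∀ i j, 0 ≤ β i j)
    (hsym : ∀ i j, β i j = β j i) {β₀ : ℝ} (hβ₀ : 0 < β₀) (hdiag : ∀ i, β₀ ≤ β i i)
    (hpB : N = 1 ∨ (2 ≤ N ∧ 2 * r + 1 < ((N : ℝ) * (N + 2)) / ((N : ℝ) - 1) ^ 2))
    {ξ : EuclideanSpace ℝ (Fin N) × ℝ → ℝ} (hξ : ContDiff ℝ ∞ ξ) (hξs : HasCompactSupport ξ)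
    (h0 : ∀ z, 0 ≤ ξ z) (h1 : ∀ z, ξ z ≤ 1) {k : ℕ} (hk : 1 ≤ k * r) :
    ∃ C : ℝ, 0 ≤ C ∧ ∀ v : Fin m → EuclideanSpace ℝ (Fin N) × ℝ → ℝ,
      (∀ i, ContDiff ℝ ∞ (v i)) → (∀ i z, 0 < v i z) →
      ∫ z, ξ z ^ (2 * k + 4) * ∑ i, src β r (fun j => v j z) i ^ 2 ≤
        C * ((∫ z, ξ z ^ (2 * k + 4) * ∑ i, defect β r v i z ^ 2) + 1) := by
  obtain ⟨c₁, c₂, c₃, c₄, C, hC, h⟩ :=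
    exists_pointwise_estimate hN hr hβ hsym hβ₀ hdiag hpB hξ hξs h0 h1 hk
  set V : ℝ := volume.real (tsupport ξ) with hV
  have hV0 : 0 ≤ V := measureReal_nonneg
  refine ⟨C * (1 + V), by positivity, fun v hv hpos => ?_⟩
  have hφ : ContDiff ℝ ∞ fun z => ξ z ^ (2 * k + 4) := hξ.pow _
  have hφs : HasCompactSupport fun z => ξ z ^ (2 * k + 4) := by
    refine HasCompactSupport.intro hξs.isCompact fun z hz => ?_
    simp [image_eq_zero_of_notMem_tsupport hz]
  have hZ : ZeroMean fun z => c₁ * ∑ i, bochnerDiv (fun z => ξ z ^ (2 * k + 4)) (v i) z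
          + c₂ * ∑ i, gradDiv (fun z => ξ z ^ (2 * k + 4)) (v i) z
          + c₃ * ∑ i, sourceDiv (fun z => ξ z ^ (2 * k + 4)) (fun z => src β r (fun j => v j z) i)
            (v i) z
          + c₄ * ((∑ i, energyDiv (fun z => ξ z ^ (2 * k + 4)) (v i) z)
            + (td (fun z => ξ z ^ (2 * k + 4)) z * pot β r (fun j => v j z)
              + ξ z ^ (2 * k + 4) * td (fun z => pot β r (fun j => v j z)) z)) := by
    refine ((((ZeroMean.sum fun i _ => ?_).const_mul _).add
      ((ZeroMean.sum fun i _ => ?_).const_mul _)).add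
      ((ZeroMean.sum fun i _ => ?_).const_mul _)).add
      (((ZeroMean.sum fun i _ => ?_).add ?_).const_mul _)
    · exact zeroMean_bochner (hv i) hφ hφs
    · exact zeroMean_grad_sq (hv i) (hpos i) hφ hφs
    · exact zeroMean_source (hv i) (contDiff_src hv hpos i) hφ hφs
    · exact zeroMean_energy (hv i) hφ hφs
    · exact zeroMean_mul hφ hφs (contDiff_pot hv hpos) _
  have hI : Integrable ((tsupport ξ).indicator (1 : EuclideanSpace ℝ (Fin N) × ℝ → ℝ)) :=
    (integrable_indicator_iff (isClosed_tsupport ξ).measurableSet).2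
      (integrableOn_const hξs.isCompact.measure_lt_top.ne)
  have hIv : ∫ z, (tsupport ξ).indicator (1 : EuclideanSpace ℝ (Fin N) × ℝ → ℝ) z = V := by
    rw [integral_indicator (isClosed_tsupport ξ).measurableSet]
    simp [hV]
  have hS : Integrable fun z => ξ z ^ (2 * k + 4) * ∑ i, src β r (fun j => v j z) i ^ 2 :=
    (hφ.mul (ContDiff.sum fun i _ => (contDiff_src hv hpos i).pow 2)).continuous
      |>.integrable_of_hasCompactSupport hφs.mul_right
  have hE : Integrable fun z => ξ z ^ (2 * k + 4) * ∑ i, defect β r v i z ^ 2 :=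
    (hφ.mul (ContDiff.sum fun i _ => (contDiff_defect hv hpos i).pow 2)).continuous
      |>.integrable_of_hasCompactSupport hφs.mul_right
  have hmono := integral_mono hS (((hE.add hI).const_mul C).add hZ.1) fun z => h v hv hpos z
  rw [integral_add' ((hE.add hI).const_mul C) hZ.1, hZ.2, integral_const_mul, integral_add' hE hI,
    hIv, add_zero] at hmono
  refine hmono.trans ?_
  have hE0 : 0 ≤ ∫ z, ξ z ^ (2 * k + 4) * ∑ i, defect β r v i z ^ 2 :=
    integral_nonneg fun z => by
      have := h0 z
      positivity
  have : 0 ≤ C * V * (∫ z, ξ z ^ (2 * k + 4) * ∑ i, defect β r v i z ^ 2) := by positivity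
  linarith

end IntegratedEstimate

section Mollification

open Filter Topology
open scoped ContDiff

variable {N : ℕ}

/-- The convolution of `η` and `g` on space-time. -/
noncomputable def mollify (η g : EuclideanSpace ℝ (Fin N) × ℝ → ℝ) :
    EuclideanSpace ℝ (Fin N) × ℝ → ℝ := fun z => ∫ w, η (z - w) * g w

variable {η g : EuclideanSpace ℝ (Fin N) × ℝ → ℝ}

lemma isAddHaarMeasure_volume_prod :
    (volume : Measure (EuclideanSpace ℝ (Fin N) × ℝ)).IsAddHaarMeasure := by
  rw [Measure.volume_eq_prod]
  infer_instance

attribute [local instance] isAddHaarMeasure_volume_prod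

lemma mollify_eq_convolution (η g : EuclideanSpace ℝ (Fin N) × ℝ → ℝ) :
    mollify η g = convolution η g (ContinuousLinearMap.lsmul ℝ ℝ) volume := by
  funext z
  rw [convolution_lsmul_swap]
  rfl

lemma contDiff_mollify (hη : ContDiff ℝ ∞ η) (hηs : HasCompactSupport η)
    (hg : LocallyIntegrable g) : ContDiff ℝ ∞ (mollify η g) := by
  rw [mollify_eq_convolution]
  exact hηs.contDiff_convolution_left _ hη hg

lemma integrable_comp_sub_mul (hη : Continuous η) (hηs : HasCompactSupport η)
    (hg : LocallyIntegrable g) (z : EuclideanSpace ℝ (Fin N) × ℝ) :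
    Integrable fun w => η (z - w) * g w := by
  have := hηs.convolutionExists_left (ContinuousLinearMap.lsmul ℝ ℝ) hη hg z
  exact this.integrable_swap

lemma dirDeriv_mollify (hη : ContDiff ℝ 1 η) (hηs : HasCompactSupport η)
    (hg : LocallyIntegrable g) (v : EuclideanSpace ℝ (Fin N) × ℝ) :
    dirDeriv v (mollify η g) = mollify (dirDeriv v η) g := by
  funext z
  have h := hηs.hasFDerivAt_convolution_left (ContinuousLinearMap.lsmul ℝ ℝ) hη hg z
  rw [dirDeriv, mollify_eq_convolution, h.fderiv]
  have hi : ConvolutionExistsAt (fderiv ℝ η) g z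
      ((ContinuousLinearMap.lsmul ℝ ℝ).precompL (EuclideanSpace ℝ (Fin N) × ℝ)) volume :=
    (hηs.fderiv ℝ).convolutionExists_left _ (hη.continuous_fderiv one_ne_zero) hg z
  rw [convolution_eq_swap, ContinuousLinearMap.integral_apply hi.integrable_swap]
  rfl

lemma spaceLap_mollify (hη : ContDiff ℝ ∞ η) (hηs : HasCompactSupport η)
    (hg : LocallyIntegrable g) (z : EuclideanSpace ℝ (Fin N) × ℝ) :
    spaceLap (mollify η g) z = mollify (spaceLap η) g z := by
  have h1 : ∀ v : EuclideanSpace ℝ (Fin N) × ℝ, ContDiff ℝ 1 (dirDeriv v η) := fun v =>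
    (contDiff_infty_dirDeriv v hη).of_le (by exact_mod_cast le_top)
  have h2 : ∀ v w : EuclideanSpace ℝ (Fin N) × ℝ, Continuous (dirDeriv w (dirDeriv v η)) :=
    fun v w => continuous_dirDeriv (h1 v) w
  simp only [spaceLap, mollify, Finset.sum_mul]
  rw [integral_finsetSum _ fun i _ => integrable_comp_sub_mul (h2 _ _)
    (hasCompactSupport_dirDeriv (hasCompactSupport_dirDeriv hηs _) _) hg z]
  refine Finset.sum_congr rfl fun i _ => ?_
  rw [dirDeriv_mollify (hη.of_le (by exact_mod_cast le_top)) hηs hg, dirDeriv_mollify (h1 _)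
    (hasCompactSupport_dirDeriv hηs _) hg]
  rfl

lemma dirDeriv_comp_sub {ζ : EuclideanSpace ℝ (Fin N) × ℝ → ℝ} (hζ : Differentiable ℝ ζ)
    (z v : EuclideanSpace ℝ (Fin N) × ℝ)
    (w : EuclideanSpace ℝ (Fin N) × ℝ) :
    dirDeriv v (fun w => ζ (z - w)) w = -dirDeriv v ζ (z - w) := by
  have h := (hζ (z - w)).hasFDerivAt.comp w ((hasFDerivAt_id w).const_sub z)
  have h2 : fderiv ℝ (fun w => ζ (z - w)) w = _ := h.fderiv
  rw [dirDeriv, dirDeriv, h2]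
  simp

lemma dirDeriv_neg {ζ : EuclideanSpace ℝ (Fin N) × ℝ → ℝ} (v w : EuclideanSpace ℝ (Fin N) × ℝ) :
    dirDeriv v (fun w => -ζ w) w = -dirDeriv v ζ w := by
  rw [dirDeriv, dirDeriv, fderiv_fun_neg]
  rfl

lemma spaceLap_comp_sub (hη : ContDiff ℝ ∞ η) (z w : EuclideanSpace ℝ (Fin N) × ℝ) :
    spaceLap (fun w => η (z - w)) w = spaceLap η (z - w) := by
  refine Finset.sum_congr rfl fun i _ => ?_
  have : dirDeriv (EuclideanSpace.single i (1 : ℝ), (0 : ℝ)) (fun w => η (z - w))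
      = fun w => -dirDeriv (EuclideanSpace.single i (1 : ℝ), (0 : ℝ)) η (z - w) := by
    funext w
    exact dirDeriv_comp_sub (hη.differentiable (by simp)) z _ w
  rw [this, dirDeriv_neg, dirDeriv_comp_sub
    ((contDiff_infty_dirDeriv _ hη).differentiable (by simp)), neg_neg]

/-- The value of a mollification with a normalised kernel lies below any bound of the function. -/
lemma mollify_le {M : ℝ} (hη : Continuous η) (hηs : HasCompactSupport η) (h0 : ∀ z, 0 ≤ η z)
    (h1 : ∫ z, η z = 1) (hg : LocallyIntegrable g) (hM : ∀ z, g z ≤ M)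
    (z : EuclideanSpace ℝ (Fin N) × ℝ) : mollify η g z ≤ M := by
  have hc : LocallyIntegrable fun _ : EuclideanSpace ℝ (Fin N) × ℝ => M := locallyIntegrable_const M
  calc mollify η g z ≤ ∫ w, η (z - w) * M :=
        integral_mono (integrable_comp_sub_mul hη hηs hg z) (integrable_comp_sub_mul hη hηs hc z)
          fun w => mul_le_mul_of_nonneg_left (hM w) (h0 _)
    _ = M := by rw [integral_mul_const, integral_sub_left_eq_self η volume z, h1, one_mul]

lemma mollify_nonneg (h0 : ∀ z, 0 ≤ η z) (hg : ∀ z, 0 ≤ g z)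
    (z : EuclideanSpace ℝ (Fin N) × ℝ) : 0 ≤ mollify η g z :=
  integral_nonneg fun _ => mul_nonneg (h0 _) (hg _)

lemma mollify_pos (hη : Continuous η) (hηs : HasCompactSupport η) (h0 : ∀ z, 0 ≤ η z)
    (h1 : 0 < η 0) (hg : LocallyIntegrable g) (hpos : ∀ z, 0 < g z)
    (z : EuclideanSpace ℝ (Fin N) × ℝ) : 0 < mollify η g z := by
  rw [mollify, integral_pos_iff_support_of_nonneg (fun w => mul_nonneg (h0 _) (hpos _).le)
    (integrable_comp_sub_mul hη hηs hg z)]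
  have : Function.support (fun w => η (z - w) * g w) = {w | η (z - w) ≠ 0} := by
    ext w
    simp [(hpos w).ne']
  rw [this]
  refine IsOpen.measure_pos _ (isOpen_ne_fun (by fun_prop) continuous_const) ⟨z, ?_⟩
  simpa using h1.ne'

end Mollification

section IntegralEstimate

open Filter Topology
open scoped ContDiff

attribute [local instance] isAddHaarMeasure_volume_prod

variable {N m : ℕ} {β : Fin m → Fin m → ℝ} {r : ℝ}

/-- A positive solution of the system, with separate regularity in space and in time. -/
structure IsPositiveSolution (β : Fin m → Fin m → ℝ) (r : ℝ)
    (u : Fin m → EuclideanSpace ℝ (Fin N) → ℝ → ℝ) : Prop where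
  pos : ∀ i x t, 0 < u i x t
  c2 : ∀ i t, ContDiff ℝ 2 fun x => u i x t
  c1 : ∀ i x, ContDiff ℝ 1 fun t => u i x t
  heat : ∀ i x t, HasHeatOpAt (u i) (src β r (fun j => u j x t) i) x t

lemma src_le {M : ℝ} (hβ : ∀ i j, 0 ≤ β i j) (hr : 0 ≤ r) {w : Fin m → ℝ} (hw : ∀ i, 0 < w i)
    (hM : ∀ i, w i ≤ M) (i : Fin m) : src β r w i ≤ ∑ i, ∑ j, β i j * M ^ r * M ^ (r + 1) := by
  have hM0 : 0 ≤ M := (hw i).le.trans (hM i)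
  have h1 : src β r w i ≤ ∑ j, β i j * M ^ r * M ^ (r + 1) := by
    refine Finset.sum_le_sum fun j _ => ?_
    have h2 := Real.rpow_le_rpow (hw i).le (hM i) hr
    have h3 := Real.rpow_le_rpow (hw j).le (hM j) (by linarith : 0 ≤ r + 1)
    have h4 := Real.rpow_nonneg (hw j).le (r + 1)
    have h5 := hβ i j
    have h6 := Real.rpow_nonneg hM0 r
    gcongr
  refine h1.trans (Finset.single_le_sum (f := fun i => ∑ j, β i j * M ^ r * M ^ (r + 1))
    (fun k _ => Finset.sum_nonneg fun j _ => ?_) (Finset.mem_univ i))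
  have := hβ k j
  positivity

lemma continuous_src_comp {X : Type*} [TopologicalSpace X] (hr : 0 ≤ r) {w : Fin m → X → ℝ}
    (hw : ∀ i, Continuous (w i)) (i : Fin m) : Continuous fun x => src β r (fun j => w j x) i := by
  refine continuous_finsetSum _ fun j _ => (continuous_const.mul ?_).mul ?_
  · exact (hw i).rpow_const fun _ => Or.inr hr
  · exact (hw j).rpow_const fun _ => Or.inr (by linarith)

lemma continuous_src (hr : 0 ≤ r) (i : Fin m) : Continuous fun w : Fin m → ℝ => src β r w i :=
  continuous_src_comp hr (fun j => continuous_apply j) i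

lemma tendsto_src {X : Type*} {l : Filter X} (hr : 0 ≤ r) {w : X → Fin m → ℝ} {w₀ : Fin m → ℝ}
    (h : ∀ j, Tendsto (fun x => w x j) l (𝓝 (w₀ j))) (i : Fin m) :
    Tendsto (fun x => src β r (w x) i) l (𝓝 (src β r w₀ i)) :=
  ((continuous_src hr i).tendsto w₀).comp (tendsto_pi_nhds.2 h)

lemma locallyIntegrable_of_bounded {M : ℝ} {g : EuclideanSpace ℝ (Fin N) × ℝ → ℝ}
    (hg : Measurable g) (h0 : ∀ z, 0 ≤ g z) (hM : ∀ z, g z ≤ M) : LocallyIntegrable g :=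
  (locallyIntegrable_const M).mono hg.aestronglyMeasurable (Eventually.of_forall fun z => by
    rw [Real.norm_of_nonneg (h0 z)]
    exact (hM z).trans (le_abs_self M))

variable {u : Fin m → EuclideanSpace ℝ (Fin N) → ℝ → ℝ}

lemma IsPositiveSolution.measurable (hu : IsPositiveSolution β r u) (i : Fin m) :
    Measurable fun z : EuclideanSpace ℝ (Fin N) × ℝ => u i z.1 z.2 :=
  (stronglyMeasurable_of_separately_continuous (fun t => (hu.c2 i t).continuous)
    fun x => (hu.c1 i x).continuous).measurable

/-- The components of the solution in the unit ball, extended by one. -/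
noncomputable def cutOff (u : Fin m → EuclideanSpace ℝ (Fin N) → ℝ → ℝ) (i : Fin m)
    (z : EuclideanSpace ℝ (Fin N) × ℝ) : ℝ :=
  open Classical in if z ∈ ball (0 : EuclideanSpace ℝ (Fin N) × ℝ) 1 then u i z.1 z.2 else 1

lemma cutOff_of_mem {z : EuclideanSpace ℝ (Fin N) × ℝ}
    (hz : z ∈ ball (0 : EuclideanSpace ℝ (Fin N) × ℝ) 1) (i : Fin m) :
    cutOff u i z = u i z.1 z.2 := if_pos hz

lemma IsPositiveSolution.measurable_cutOff (hu : IsPositiveSolution β r u) (i : Fin m) :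
    Measurable (cutOff u i) := by
  classical
  exact Measurable.ite measurableSet_ball (hu.measurable i) measurable_const

lemma IsPositiveSolution.cutOff_pos (hu : IsPositiveSolution β r u) (i : Fin m)
    (z : EuclideanSpace ℝ (Fin N) × ℝ) : 0 < cutOff u i z := by
  unfold cutOff
  split_ifs
  · exact hu.pos _ _ _
  · exact one_pos

lemma cutOff_le {M : ℝ} (hM1 : 1 ≤ M)
    (hM : ∀ i, ∀ z ∈ ball (0 : EuclideanSpace ℝ (Fin N) × ℝ) 1, u i z.1 z.2 ≤ M) (i : Fin m)
    (z : EuclideanSpace ℝ (Fin N) × ℝ) : cutOff u i z ≤ M := by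
  unfold cutOff
  split_ifs with h
  · exact hM i z h
  · exact hM1

lemma mem_ball_prod_zero {ρ : ℝ} {x : EuclideanSpace ℝ (Fin N)} {t : ℝ} :
    (x, t) ∈ ball (0 : EuclideanSpace ℝ (Fin N) × ℝ) ρ ↔
      x ∈ ball (0 : EuclideanSpace ℝ (Fin N)) ρ ∧ t ∈ Ioo (-ρ) ρ := by
  rw [← Prod.mk_zero_zero, ← ball_prod_same, Set.mem_prod, Real.ball_eq_Ioo]
  simp

/-- Mollifications of a bounded solution solve the heat equation with mollified source. -/
lemma IsPositiveSolution.heat_mollify (hu : IsPositiveSolution β r u) (hr : 0 ≤ r)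
    (hβ : ∀ i j, 0 ≤ β i j) {M : ℝ} (hM1 : 1 ≤ M)
    (hM : ∀ i, ∀ z ∈ ball (0 : EuclideanSpace ℝ (Fin N) × ℝ) 1, u i z.1 z.2 ≤ M)
    {η : EuclideanSpace ℝ (Fin N) × ℝ → ℝ} (hη : ContDiff ℝ ∞ η)
    (hηs : Function.support η ⊆ closedBall (0 : EuclideanSpace ℝ (Fin N) × ℝ) (1 / 8))
    (i : Fin m) {z : EuclideanSpace ℝ (Fin N) × ℝ} (hz : z ∈ closedBall 0 (3 / 4)) :
    td (mollify η (cutOff u i)) z - spaceLap (mollify η (cutOff u i)) z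
      = mollify η (fun w => src β r (fun j => cutOff u j w) i) z := by
  have hηc : HasCompactSupport η := HasCompactSupport.of_support_subset_isCompact
    (isCompact_closedBall _ _) hηs
  have hg : LocallyIntegrable (cutOff u i) := locallyIntegrable_of_bounded
    (hu.measurable_cutOff i) (fun z => (hu.cutOff_pos i z).le) (cutOff_le hM1 hM i)
  set ψ : EuclideanSpace ℝ (Fin N) × ℝ → ℝ := fun w => η (z - w) with hψ
  have hψd : ContDiff ℝ ∞ ψ := hη.comp (by fun_prop)
  have hηd : Differentiable ℝ η := hη.differentiable (by simp)
  have hψs : tsupport ψ ⊆ ball (0 : EuclideanSpace ℝ (Fin N) × ℝ) 1 := by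
    have h1 : tsupport ψ ⊆ closedBall z (1 / 8) := by
      refine closure_minimal (fun w hw => ?_) isClosed_closedBall
      have := hηs (show z - w ∈ Function.support η from hw)
      rwa [mem_closedBall_zero_iff, ← dist_eq_norm, dist_comm] at this
    refine h1.trans fun w hw => ?_
    rw [mem_closedBall] at hw hz
    rw [mem_ball]
    linarith [dist_triangle w z 0]
  have key := integral_mul_adjoint_eq (w := u i) (f := fun x t => src β r (fun j => u j x t) i)
    (M := M) (F := ∑ i, ∑ j, β i j * M ^ r * M ^ (r + 1)) (hu.c2 i) (hu.c1 i)
    (fun x _ t _ => hu.pos i x t)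
    (fun x hx t ht => hM i (x, t) (mem_ball_prod_zero.2 ⟨hx, ht⟩)) (fun x _ t _ => hu.heat i x t)
    (fun x _ t _ => src_nonneg hβ (fun j => hu.pos j x t) i)
    (fun x hx t ht => src_le hβ hr (fun j => hu.pos j x t)
      (fun j => hM j (x, t) (mem_ball_prod_zero.2 ⟨hx, ht⟩)) i)
    (fun t => continuous_src_comp hr (fun j => (hu.c2 j t).continuous) i)
    (fun x => continuous_src_comp hr (fun j => (hu.c1 j x).continuous) i)
    (contDiff_infty.1 hψd 2) hψs
  have hη1 : ContDiff ℝ 1 η := hη.of_le (by exact_mod_cast le_top)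
  rw [spaceLap_mollify hη hηc hg, td, dirDeriv_mollify hη1 hηc hg, mollify, mollify,
    ← integral_sub (integrable_comp_sub_mul (continuous_dirDeriv hη1 _)
      (hasCompactSupport_dirDeriv hηc _) hg z) (integrable_comp_sub_mul
      (contDiff_spaceLap hη).continuous ?_ hg z)]
  · refine Eq.trans (integral_congr_ae (Eventually.of_forall fun w => ?_)) (key.trans
      (integral_congr_ae (Eventually.of_forall fun w => ?_)))
    · have e1 : dirDeriv (0, 1) ψ w = -dirDeriv (0, 1) η (z - w) := dirDeriv_comp_sub hηd z _ w
      have e2 : spaceLap ψ w = spaceLap η (z - w) := spaceLap_comp_sub hη z w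
      by_cases hw : w ∈ ball (0 : EuclideanSpace ℝ (Fin N) × ℝ) 1
      · simp only [e1, e2, cutOff_of_mem hw]
        ring
      · have hw' : w ∉ tsupport ψ := fun h => hw (hψs h)
        have e3 := dirDeriv_eq_zero_of_notMem hw' ((0 : EuclideanSpace ℝ (Fin N)), (1 : ℝ))
        have e4 := spaceLap_eq_zero_of_notMem hw'
        rw [e3] at e1
        rw [e4] at e2
        simp only [e3, e4, neg_eq_zero.1 e1.symm, e2.symm]
        ring
    · by_cases hw : w ∈ ball (0 : EuclideanSpace ℝ (Fin N) × ℝ) 1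
      · simp only [cutOff_of_mem hw]
        rw [mul_comm]
      · have hw' : ψ w = 0 := image_eq_zero_of_notMem_tsupport fun h => hw (hψs h)
        have hw'' : η (z - w) = 0 := hw'
        simp only [hw', hw'']
        simp
  · refine HasCompactSupport.intro hηc.isCompact fun w hw => spaceLap_eq_zero_of_notMem hw

set_option maxHeartbeats 1000000 in
/-- The interior integral estimate for bounded solutions. -/
theorem exists_integral_estimate (hN : 1 ≤ N) (hr : 0 < r) (hβ : ∀ i j, 0 ≤ β i j)
    (hsym : ∀ i j, β i j = β j i) {β₀ : ℝ} (hβ₀ : 0 < β₀) (hdiag : ∀ i, β₀ ≤ β i i)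
    (hpB : N = 1 ∨ (2 ≤ N ∧ 2 * r + 1 < ((N : ℝ) * (N + 2)) / ((N : ℝ) - 1) ^ 2)) :
    ∃ C : ℝ, 0 ≤ C ∧ ∀ u : Fin m → EuclideanSpace ℝ (Fin N) → ℝ → ℝ, IsPositiveSolution β r u →
      (∃ M, ∀ i, ∀ z ∈ ball (0 : EuclideanSpace ℝ (Fin N) × ℝ) 1, u i z.1 z.2 ≤ M) →
      ∫ z in ball (0 : EuclideanSpace ℝ (Fin N) × ℝ) (1 / 2),
        ∑ i, src β r (fun j => u j z.1 z.2) i ^ 2 ≤ C := by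
  set ξ : ContDiffBump (0 : EuclideanSpace ℝ (Fin N) × ℝ) := ⟨1 / 2, 3 / 4, by norm_num, by norm_num⟩
    with hξ
  have hξc : HasCompactSupport ξ := ξ.hasCompactSupport
  obtain ⟨k, hk⟩ := exists_nat_ge (1 / r)
  obtain ⟨C, hC, hest⟩ := exists_smooth_estimate hN hr hβ hsym hβ₀ hdiag hpB ξ.contDiff hξc
    (fun z => ξ.nonneg) (fun z => ξ.le_one) (k := k) ((div_le_iff₀ hr).1 hk)
  refine ⟨C, hC, fun u hu hMu => ?_⟩
  obtain ⟨M₀, hM₀⟩ := hMu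
  set M := max M₀ 1 with hMdef
  have hM1 : 1 ≤ M := le_max_right _ _
  have hM : ∀ i, ∀ z ∈ ball (0 : EuclideanSpace ℝ (Fin N) × ℝ) 1, u i z.1 z.2 ≤ M :=
    fun i z hz => (hM₀ i z hz).trans (le_max_left _ _)
  set B := ∑ i, ∑ j, β i j * M ^ r * M ^ (r + 1) with hB
  set g := cutOff u with hg
  have hgpos : ∀ i z, 0 < g i z := hu.cutOff_pos
  have hgM : ∀ i z, g i z ≤ M := cutOff_le hM1 hM
  have hgm : ∀ i, Measurable (g i) := hu.measurable_cutOff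
  have hgL : ∀ i, LocallyIntegrable (g i) := fun i =>
    locallyIntegrable_of_bounded (hgm i) (fun z => (hgpos i z).le) (hgM i)
  set f : Fin m → EuclideanSpace ℝ (Fin N) × ℝ → ℝ := fun i z => src β r (fun j => g j z) i with hf
  have hf0 : ∀ i z, 0 ≤ f i z := fun i z => src_nonneg hβ (fun j => hgpos j z) i
  have hfB : ∀ i z, f i z ≤ B := fun i z =>
    src_le hβ hr.le (fun j => hgpos j z) (fun j => hgM j z) i
  have hfm : ∀ i, Measurable (f i) := fun i =>
    (continuous_src hr.le i).measurable.comp (measurable_pi_lambda _ fun j => hgm j)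
  have hfL : ∀ i, LocallyIntegrable (f i) := fun i =>
    locallyIntegrable_of_bounded (hfm i) (hf0 i) (hfB i)
  set φ : ℕ → ContDiffBump (0 : EuclideanSpace ℝ (Fin N) × ℝ) := fun n =>
    ⟨1 / (16 * (n + 1)), 1 / (8 * (n + 1)), by positivity, by
      apply one_div_lt_one_div_of_lt <;> [positivity; linarith [Nat.cast_nonneg (α := ℝ) n]]⟩ with hφ
  set η : ℕ → EuclideanSpace ℝ (Fin N) × ℝ → ℝ := fun n => (φ n).normed volume with hη
  have hηd : ∀ n, ContDiff ℝ ∞ (η n) := fun n => (φ n).contDiff_normed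
  have hηc : ∀ n, HasCompactSupport (η n) := fun n => (φ n).hasCompactSupport_normed
  have hη0 : ∀ n z, 0 ≤ η n z := fun n z => (φ n).nonneg_normed z
  have hη1 : ∀ n, ∫ z, η n z = 1 := fun n => (φ n).integral_normed
  have hηs : ∀ n, Function.support (η n)
      ⊆ closedBall (0 : EuclideanSpace ℝ (Fin N) × ℝ) (1 / 8) := fun n => by
    rw [hη]
    simp only
    rw [(φ n).support_normed_eq]
    refine ball_subset_closedBall.trans (closedBall_subset_closedBall ?_)
    simp only [hφ]
    apply one_div_le_one_div_of_le (by norm_num)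
    linarith [Nat.cast_nonneg (α := ℝ) n]
  have hηp : ∀ n, 0 < η n 0 := fun n => by
    have : (0 : EuclideanSpace ℝ (Fin N) × ℝ) ∈ Function.support (η n) := by
      rw [hη]
      simp only
      rw [(φ n).support_normed_eq]
      exact mem_ball_self (φ n).rOut_pos
    exact lt_of_le_of_ne (hη0 n 0) (Ne.symm this)
  have hlim : ∀ h : EuclideanSpace ℝ (Fin N) × ℝ → ℝ, LocallyIntegrable h →
      ∀ᵐ z, Tendsto (fun n => mollify (η n) h z) atTop (𝓝 (h z)) := fun h hh => by
    simp only [mollify_eq_convolution]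
    refine ContDiffBump.ae_convolution_tendsto_right_of_locallyIntegrable (K := 2) ?_
      (Eventually.of_forall fun n => ?_) hh
    · simp only [hφ]
      have := tendsto_one_div_add_atTop_nhds_zero_nat (𝕜 := ℝ)
      have h2 := this.const_mul (1 / 8)
      rw [mul_zero] at h2
      refine h2.congr fun n => ?_
      field_simp
    · simp only [hφ]
      apply le_of_eq
      field_simp
      norm_num
  set v : ℕ → Fin m → EuclideanSpace ℝ (Fin N) × ℝ → ℝ := fun n i => mollify (η n) (g i) with hv
  have hvd : ∀ n i, ContDiff ℝ ∞ (v n i) := fun n i => contDiff_mollify (hηd n) (hηc n) (hgL i)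
  have hvp : ∀ n i z, 0 < v n i z := fun n i => mollify_pos (hηd n).continuous (hηc n) (hη0 n)
    (hηp n) (hgL i) (hgpos i)
  have hvM : ∀ n i z, v n i z ≤ M := fun n i => mollify_le (hηd n).continuous (hηc n) (hη0 n)
    (hη1 n) (hgL i) (hgM i)
  have hsB : ∀ n i z, src β r (fun j => v n j z) i ≤ B := fun n i z =>
    src_le hβ hr.le (fun j => hvp n j z) (fun j => hvM n j z) i
  have hs0 : ∀ n i z, 0 ≤ src β r (fun j => v n j z) i := fun n i z =>
    src_nonneg hβ (fun j => hvp n j z) i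
  have hmB : ∀ n i z, mollify (η n) (f i) z ≤ B := fun n i => mollify_le (hηd n).continuous (hηc n)
    (hη0 n) (hη1 n) (hfL i) (hfB i)
  have hm0 : ∀ n i z, 0 ≤ mollify (η n) (f i) z := fun n i => mollify_nonneg (hη0 n) (hf0 i)
  have hdef : ∀ n i z, ξ z ≠ 0 → defect β r (v n) i z
      = mollify (η n) (f i) z - src β r (fun j => v n j z) i := fun n i z hz => by
    rw [defect, hu.heat_mollify hr.le hβ hM1 hM (hηd n) (hηs n) i]
    have : z ∈ Function.support ξ := hz
    rw [ξ.support_eq] at this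
    exact ball_subset_closedBall this
  have hlimv : ∀ᵐ z, ∀ i, Tendsto (fun n => v n i z) atTop (𝓝 (g i z)) :=
    ae_all_iff.2 fun i => hlim _ (hgL i)
  have hlimf : ∀ᵐ z, ∀ i, Tendsto (fun n => mollify (η n) (f i) z) atTop (𝓝 (f i z)) :=
    ae_all_iff.2 fun i => hlim _ (hfL i)
  have hlims : ∀ᵐ z, ∀ i, Tendsto (fun n => src β r (fun j => v n j z) i) atTop (𝓝 (f i z)) := by
    filter_upwards [hlimv] with z hz i
    exact tendsto_src hr.le hz i
  have hξk : Integrable fun z => ξ z ^ (2 * k + 4) := by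
    refine (ξ.continuous.pow _).integrable_of_hasCompactSupport ?_
    refine HasCompactSupport.intro hξc.isCompact fun z hz => ?_
    simp [image_eq_zero_of_notMem_tsupport hz]
  have hξ0 : ∀ z, 0 ≤ ξ z ^ (2 * k + 4) := fun z => pow_nonneg ξ.nonneg _
  have hsum : ∀ a : Fin m → ℝ, (∀ i, |a i| ≤ B) → ‖∑ i, a i ^ 2‖ ≤ m * B ^ 2 := fun a ha => by
    rw [Real.norm_of_nonneg (Finset.sum_nonneg fun i _ => sq_nonneg _)]
    refine (Finset.sum_le_sum fun i _ => sq_le_sq' (abs_le.1 (ha i)).1 (abs_le.1 (ha i)).2).trans ?_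
    simp
  have hprod : ∀ z (a : Fin m → ℝ), (∀ i, |a i| ≤ B) →
      ‖ξ z ^ (2 * k + 4) * ∑ i, a i ^ 2‖ ≤ ξ z ^ (2 * k + 4) * (m * B ^ 2) := fun z a ha => by
    rw [norm_mul, Real.norm_of_nonneg (hξ0 z)]
    exact mul_le_mul_of_nonneg_left (hsum a ha) (hξ0 z)
  have T1 : Tendsto (fun n => ∫ z, ξ z ^ (2 * k + 4) * ∑ i, src β r (fun j => v n j z) i ^ 2) atTop
      (𝓝 (∫ z, ξ z ^ (2 * k + 4) * ∑ i, f i z ^ 2)) := by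
    refine tendsto_integral_of_dominated_convergence (fun z => ξ z ^ (2 * k + 4) * (m * B ^ 2))
      (fun n => ?_) (hξk.mul_const _) (fun n => Eventually.of_forall fun z => hprod z _ fun i => ?_) ?_
    · exact ((ξ.continuous.pow _).mul (continuous_finsetSum _ fun i _ =>
        ((contDiff_src (hvd n) (hvp n) i).continuous).pow 2)).aestronglyMeasurable
    · rw [abs_of_nonneg (hs0 n i z)]
      exact hsB n i z
    · filter_upwards [hlims] with z hz
      exact (tendsto_finsetSum _ fun i _ => (hz i).pow 2).const_mul _
  have T2 : Tendsto (fun n => ∫ z, ξ z ^ (2 * k + 4) * ∑ i, defect β r (v n) i z ^ 2) atTop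
      (𝓝 0) := by
    rw [show (0 : ℝ) = ∫ _ : EuclideanSpace ℝ (Fin N) × ℝ, (0 : ℝ) by simp]
    refine tendsto_integral_of_dominated_convergence (fun z => ξ z ^ (2 * k + 4) * (m * B ^ 2))
      (fun n => ?_) (hξk.mul_const _) (fun n => Eventually.of_forall fun z => ?_) ?_
    · exact ((ξ.continuous.pow _).mul (continuous_finsetSum _ fun i _ =>
        ((contDiff_defect (hvd n) (hvp n) i).continuous).pow 2)).aestronglyMeasurable
    · by_cases hz : ξ z = 0
      · simp [hz]
      · refine hprod z _ fun i => ?_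
        rw [hdef n i z hz, abs_le]
        constructor <;> linarith [hsB n i z, hs0 n i z, hmB n i z, hm0 n i z]
    · filter_upwards [hlims, hlimf] with z hz hz'
      by_cases h : ξ z = 0
      · simp [h]
      · have h2 := (tendsto_finsetSum (Finset.univ) fun i _ => ((hz' i).sub (hz i)).pow 2).const_mul
          (ξ z ^ (2 * k + 4))
        simp only [sub_self, ne_eq, OfNat.ofNat_ne_zero, not_false_eq_true, zero_pow,
          Finset.sum_const_zero, mul_zero] at h2
        refine h2.congr fun n => ?_
        congr 1
        exact Finset.sum_congr rfl fun i _ => by rw [hdef n i z h]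
  have h3 := le_of_tendsto_of_tendsto' T1 ((T2.add_const 1).const_mul C)
    fun n => hest (v n) (hvd n) (hvp n)
  rw [zero_add, mul_one] at h3
  refine le_trans ?_ h3
  rw [← integral_indicator measurableSet_ball]
  have h_integrable : Integrable fun z => ξ z ^ (2 * k + 4) * ∑ i, f i z ^ 2 := by
    refine (hξk.mul_const (m * B ^ 2)).mono' ?_ (Eventually.of_forall fun z => hprod z _ fun i => ?_)
    · exact ((ξ.continuous.pow _).measurable.mul (Finset.measurable_fun_sum _ fun i _ =>
        (hfm i).pow_const 2)).aestronglyMeasurable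
    · rw [abs_of_nonneg (hf0 i z)]
      exact hfB i z
  refine integral_mono_of_nonneg (Eventually.of_forall fun z => Set.indicator_nonneg (fun z _ =>
    Finset.sum_nonneg fun i _ => sq_nonneg _) z) h_integrable (Eventually.of_forall fun z => ?_)
  by_cases hz : z ∈ ball (0 : EuclideanSpace ℝ (Fin N) × ℝ) (1 / 2)
  · have h4 : ξ z = 1 := ξ.one_of_mem_closedBall (ball_subset_closedBall hz)
    have h5 : z ∈ ball (0 : EuclideanSpace ℝ (Fin N) × ℝ) 1 := ball_subset_ball (by norm_num) hz
    simp only [Set.indicator_of_mem hz, h4, one_pow, one_mul, hf, hg, cutOff_of_mem h5]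
    exact le_rfl
  · simp only [Set.indicator_of_notMem hz]
    exact mul_nonneg (hξ0 z) (Finset.sum_nonneg fun i _ => sq_nonneg _)

end IntegralEstimate

section MeanBound

open Filter Topology

variable {N m : ℕ} {β : Fin m → Fin m → ℝ} {r : ℝ}
  {u : Fin m → EuclideanSpace ℝ (Fin N) → ℝ → ℝ}

/-- The sum of the components. -/
noncomputable def total (u : Fin m → EuclideanSpace ℝ (Fin N) → ℝ → ℝ)
    (x : EuclideanSpace ℝ (Fin N)) (t : ℝ) : ℝ := ∑ i, u i x t

namespace IsPositiveSolution

lemma total_c2 (hu : IsPositiveSolution β r u) (t : ℝ) : ContDiff ℝ 2 fun x => total u x t :=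
  ContDiff.sum fun i _ => hu.c2 i t

lemma total_c1 (hu : IsPositiveSolution β r u) (x : EuclideanSpace ℝ (Fin N)) :
    ContDiff ℝ 1 fun t => total u x t :=
  ContDiff.sum fun i _ => hu.c1 i x

lemma total_pos (hu : IsPositiveSolution β r u) (hm : 0 < m) (x : EuclideanSpace ℝ (Fin N))
    (t : ℝ) : 0 < total u x t :=
  have : Nonempty (Fin m) := ⟨⟨0, hm⟩⟩
  Finset.sum_pos (fun i _ => hu.pos i x t) Finset.univ_nonempty

lemma le_total (hu : IsPositiveSolution β r u) (i : Fin m) (x : EuclideanSpace ℝ (Fin N)) (t : ℝ) :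
    u i x t ≤ total u x t :=
  Finset.single_le_sum (f := fun i => u i x t) (fun j _ => (hu.pos j x t).le) (Finset.mem_univ i)

lemma total_heat (hu : IsPositiveSolution β r u) (hm : 0 < m) (hβ : ∀ i j, 0 ≤ β i j) (hr : 0 ≤ r)
    (x : EuclideanSpace ℝ (Fin N)) (t : ℝ) :
    ∃ d, 0 ≤ d ∧ d ≤ m * (∑ i, ∑ j, β i j) * total u x t ^ (2 * r + 1) ∧
      HasHeatOpAt (total u) d x t := by
  refine ⟨∑ i, src β r (fun j => u j x t) i,
    Finset.sum_nonneg fun i _ => src_nonneg hβ (fun j => hu.pos j x t) i, ?_,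
    hasHeatOpAt_sum _ fun i _ => hu.heat i x t⟩
  have h : ∀ i ∈ Finset.univ, src β r (fun j => u j x t) i
      ≤ (∑ i, ∑ j, β i j) * total u x t ^ (2 * r + 1) := fun i _ => by
    refine (src_le hβ hr (fun j => hu.pos j x t) (fun j => hu.le_total j x t) i).trans
      (le_of_eq ?_)
    simp only [mul_assoc, ← Finset.sum_mul]
    rw [← Real.rpow_add (hu.total_pos hm x t)]
    ring_nf
  refine (Finset.sum_le_sum h).trans (le_of_eq ?_)
  simp [mul_assoc]

lemma posSuper_total (hu : IsPositiveSolution β r u) (hm : 0 < m) (hβ : ∀ i j, 0 ≤ β i j)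
    (hr : 0 ≤ r) (x₀ : EuclideanSpace ℝ (Fin N)) (ρ a b : ℝ) : PosSuper x₀ ρ a b (total u) where
  c2 := hu.total_c2
  c1 := hu.total_c1
  pos x _ t _ := hu.total_pos hm x t
  super x _ t _ := by
    obtain ⟨d, h0, -, h⟩ := hu.total_heat hm hβ hr x t
    exact ⟨d, h0, h⟩

lemma integrableOn_total (hu : IsPositiveSolution β r u) (x : EuclideanSpace ℝ (Fin N)) (ρ s : ℝ) :
    IntegrableOn (fun y => total u y s) (ball x ρ) :=
  ((hu.total_c2 s).continuous.continuousOn.integrableOn_compact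
    (isCompact_closedBall x ρ)).mono_set ball_subset_closedBall

lemma sq_total_rpow_le (hu : IsPositiveSolution β r u) (hm : 0 < m) (hβ : ∀ i j, 0 ≤ β i j)
    (hr : 0 ≤ r) {β₀ : ℝ} (hβ₀ : 0 < β₀) (hdiag : ∀ i, β₀ ≤ β i i)
    (x : EuclideanSpace ℝ (Fin N)) (t : ℝ) :
    (total u x t ^ (2 * r + 1)) ^ 2
      ≤ ((m : ℝ) ^ (2 * r + 1) * β₀⁻¹) ^ 2 * ∑ i, src β r (fun j => u j x t) i ^ 2 := by
  have : Nonempty (Fin m) := ⟨⟨0, hm⟩⟩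
  obtain ⟨i, -, hi⟩ := Finset.exists_max_image Finset.univ (fun i => u i x t) Finset.univ_nonempty
  have h1 : total u x t ≤ m * u i x t := by
    refine (Finset.sum_le_sum fun j hj => hi j hj).trans (le_of_eq ?_)
    simp
  have h0 := (hu.total_pos hm x t).le
  have hp : 0 ≤ 2 * r + 1 := by linarith
  have h2 : total u x t ^ (2 * r + 1) ≤ (m : ℝ) ^ (2 * r + 1) * u i x t ^ (2 * r + 1) := by
    rw [← Real.mul_rpow (Nat.cast_nonneg m) (hu.pos i x t).le]
    exact Real.rpow_le_rpow h0 h1 hp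
  have h3 : u i x t ^ (2 * r + 1) ≤ β₀⁻¹ * src β r (fun j => u j x t) i := by
    rw [← div_eq_inv_mul, le_div_iff₀ hβ₀, mul_comm]
    exact (mul_le_mul_of_nonneg_right (hdiag i) (Real.rpow_nonneg (hu.pos i x t).le _)).trans
      (le_src hβ (fun j => hu.pos j x t) i)
  have h4 : total u x t ^ (2 * r + 1)
      ≤ ((m : ℝ) ^ (2 * r + 1) * β₀⁻¹) * src β r (fun j => u j x t) i := by
    rw [mul_assoc]
    exact h2.trans (mul_le_mul_of_nonneg_left h3 (Real.rpow_nonneg (Nat.cast_nonneg m) _))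
  calc (total u x t ^ (2 * r + 1)) ^ 2
      ≤ (((m : ℝ) ^ (2 * r + 1) * β₀⁻¹) * src β r (fun j => u j x t) i) ^ 2 :=
        pow_le_pow_left₀ (Real.rpow_nonneg h0 _) h4 2
    _ = ((m : ℝ) ^ (2 * r + 1) * β₀⁻¹) ^ 2 * src β r (fun j => u j x t) i ^ 2 := mul_pow _ _ _
    _ ≤ _ := by
      gcongr
      exact Finset.single_le_sum (f := fun i => src β r (fun j => u j x t) i ^ 2)
        (fun j _ => sq_nonneg _) (Finset.mem_univ i)

lemma measurable_src_sq (hu : IsPositiveSolution β r u) (hr : 0 ≤ r) :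
    Measurable fun z : EuclideanSpace ℝ (Fin N) × ℝ =>
      ∑ i, src β r (fun j => u j z.1 z.2) i ^ 2 :=
  Finset.measurable_fun_sum _ fun i _ => ((continuous_src hr i).measurable.comp
    (measurable_pi_lambda _ fun j => hu.measurable j)).pow_const 2

lemma integrableOn_src_sq (hu : IsPositiveSolution β r u) (hβ : ∀ i j, 0 ≤ β i j) (hr : 0 ≤ r)
    {M : ℝ} {s : Set (EuclideanSpace ℝ (Fin N) × ℝ)} (hs : MeasurableSet s) (hsv : volume s ≠ ⊤)
    (hM : ∀ i, ∀ z ∈ s, u i z.1 z.2 ≤ M) :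
    IntegrableOn (fun z => ∑ i, src β r (fun j => u j z.1 z.2) i ^ 2) s := by
  refine Measure.integrableOn_of_bounded (M := m * (∑ i, ∑ j, β i j * M ^ r * M ^ (r + 1)) ^ 2) hsv
    (hu.measurable_src_sq hr).aestronglyMeasurable
    ((ae_restrict_iff' hs).2 (Eventually.of_forall fun z hz => ?_))
  rw [Real.norm_of_nonneg (Finset.sum_nonneg fun i _ => sq_nonneg _)]
  refine (Finset.sum_le_sum fun i _ => pow_le_pow_left₀ (src_nonneg hβ (fun j => hu.pos j _ _) i)
    (src_le hβ hr (fun j => hu.pos j _ _) (fun j => hM j z hz) i) 2).trans (le_of_eq ?_)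
  simp

/-- The space-time integral over a cylinder as an iterated integral. -/
lemma integral_src_sq_prod (hu : IsPositiveSolution β r u) (hβ : ∀ i j, 0 ≤ β i j) (hr : 0 ≤ r)
    {M : ℝ} (hM : ∀ i, ∀ z ∈ ball (0 : EuclideanSpace ℝ (Fin N) × ℝ) 1, u i z.1 z.2 ≤ M) :
    IntegrableOn (fun s => ∫ y in ball (0 : EuclideanSpace ℝ (Fin N)) (1 / 2),
      ∑ i, src β r (fun j => u j y s) i ^ 2) (Ioo (-(1 / 2)) (1 / 2)) ∧
    (∀ᵐ s ∂volume.restrict (Ioo (-(1 / 2) : ℝ) (1 / 2)), IntegrableOn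
      (fun y => ∑ i, src β r (fun j => u j y s) i ^ 2)
      (ball (0 : EuclideanSpace ℝ (Fin N)) (1 / 2))) ∧
    ∫ z in ball (0 : EuclideanSpace ℝ (Fin N) × ℝ) (1 / 2),
        ∑ i, src β r (fun j => u j z.1 z.2) i ^ 2 =
      ∫ s in Ioo (-(1 / 2) : ℝ) (1 / 2), ∫ y in ball (0 : EuclideanSpace ℝ (Fin N)) (1 / 2),
        ∑ i, src β r (fun j => u j y s) i ^ 2 := by
  have hb : ball (0 : EuclideanSpace ℝ (Fin N) × ℝ) (1 / 2)
      = ball (0 : EuclideanSpace ℝ (Fin N)) (1 / 2) ×ˢ Ioo (-(1 / 2) : ℝ) (1 / 2) := by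
    ext ⟨x, t⟩
    rw [mem_ball_prod_zero]
    rfl
  have hi := hu.integrableOn_src_sq hβ hr (s := ball 0 (1 / 2)) measurableSet_ball
    measure_ball_lt_top.ne fun i z hz => hM i z (ball_subset_ball (by norm_num) hz)
  rw [hb] at hi ⊢
  have hi' := hi
  rw [IntegrableOn, Measure.volume_eq_prod, ← Measure.prod_restrict] at hi'
  refine ⟨hi'.integral_prod_right, hi'.prod_left_ae, ?_⟩
  rw [Measure.volume_eq_prod, ← Measure.prod_restrict, integral_prod_symm _ hi']

end IsPositiveSolution

end MeanBound

section PointwiseMean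

open Filter Topology

variable {N m : ℕ} {β : Fin m → Fin m → ℝ} {r : ℝ}
  {u : Fin m → EuclideanSpace ℝ (Fin N) → ℝ → ℝ}

lemma le_add_mul_sq_rpow {V A p : ℝ} (hV : 0 ≤ V) (hA : 0 < A) (hp : 1 ≤ p) :
    V ≤ A + A / (A ^ p) ^ 2 * (V ^ p) ^ 2 := by
  have h1 : A / (A ^ p) ^ 2 * (V ^ p) ^ 2 = A * ((V / A) ^ p) ^ 2 := by
    rw [Real.div_rpow hV hA.le]; ring
  rw [h1]
  rcases le_total V A with h | h
  · nlinarith [mul_nonneg hA.le (sq_nonneg ((V / A) ^ p))]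
  · have h2 : 1 ≤ V / A := (one_le_div hA).2 h
    have h3 : V / A ≤ (V / A) ^ p := by
      simpa using Real.rpow_le_rpow_of_exponent_le h2 hp
    have h4 : V / A ≤ ((V / A) ^ p) ^ 2 := by nlinarith
    have h5 : V = A * (V / A) := by field_simp
    nlinarith [mul_le_mul_of_nonneg_left h4 hA.le]

lemma rpow_neg_half_le {θ lam τ : ℝ} (hθ : 0 < θ) (hlam : 0 < lam) (hτ : θ * lam ^ 2 / 2 ≤ τ) :
    lam ^ N * (4 * τ) ^ (-(N : ℝ) / 2) ≤ (2 * θ) ^ (-(N : ℝ) / 2) := by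
  have h1 : (4 * τ) ^ (-(N : ℝ) / 2) ≤ (2 * θ * lam ^ 2) ^ (-(N : ℝ) / 2) := by
    refine Real.rpow_le_rpow_of_nonpos (by positivity) (by linarith) ?_
    have : (0 : ℝ) ≤ N := Nat.cast_nonneg N
    linarith
  have h2 : (lam ^ 2) ^ (-(N : ℝ) / 2) = (lam ^ N)⁻¹ := by
    rw [← Real.rpow_natCast lam 2, ← Real.rpow_mul hlam.le, ← Real.rpow_natCast lam N,
      ← Real.rpow_neg hlam.le]
    congr 1
    push_cast; ring
  rw [Real.mul_rpow (x := 2 * θ) (by positivity) (by positivity), h2] at h1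
  calc lam ^ N * (4 * τ) ^ (-(N : ℝ) / 2)
      ≤ lam ^ N * ((2 * θ) ^ (-(N : ℝ) / 2) * (lam ^ N)⁻¹) := by gcongr
    _ = (2 * θ) ^ (-(N : ℝ) / 2) := by field_simp

lemma mem_ball_prod_of_le {lam τ : ℝ} (hlam : lam < 1) (hτ : τ < 1)
    {x : EuclideanSpace ℝ (Fin N)} (hx : x ∈ closedBall 0 lam) {t : ℝ} (ht : t ∈ Icc (-τ) (-τ + τ)) :
    ((x, t) : EuclideanSpace ℝ (Fin N) × ℝ) ∈ ball 0 1 := by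
  rw [mem_ball_prod_zero]
  refine ⟨closedBall_subset_ball hlam hx, by linarith [ht.1], by linarith [ht.2]⟩

/-- A local mean value bound at the origin on small cylinders. -/
lemma IsPositiveSolution.exists_mean_bound (hm : 0 < m) (hβ : ∀ i j, 0 ≤ β i j) (hr : 0 < r)
    {C₀ : ℝ} (hC₀ : 0 < C₀) :
    ∃ θ C, 0 < θ ∧ θ ≤ 1 / 2 ∧ 0 < C ∧ ∀ u : Fin m → EuclideanSpace ℝ (Fin N) → ℝ → ℝ,
      IsPositiveSolution β r u →
      (∀ z ∈ ball (0 : EuclideanSpace ℝ (Fin N) × ℝ) 1, total u z.1 z.2 ≤ C₀ * total u 0 0) →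
      ∀ lam τ, 0 < lam → lam < 1 → lam ≤ total u 0 0 ^ (-r) →
        θ * lam ^ 2 / 2 ≤ τ → τ ≤ θ * lam ^ 2 →
        lam ^ N * total u 0 0 ≤ C * ∫ y in ball (0 : EuclideanSpace ℝ (Fin N)) lam,
          total u y (-τ) := by
  set b : ℝ := m * ∑ i, ∑ j, β i j with hb
  have hb0 : 0 ≤ b := mul_nonneg (Nat.cast_nonneg m)
    (Finset.sum_nonneg fun i _ => Finset.sum_nonneg fun j _ => hβ i j)
  set L : ℝ := 2 * N * C₀ + b * C₀ ^ (2 * r + 1) with hL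
  have hL0 : 0 ≤ L := by positivity
  have hg := gaussMass_pos N
  set θ : ℝ := 1 / (2 * (L + 1)) with hθ
  have hθ0 : 0 < θ := by positivity
  have hθL : L * θ ≤ 1 / 2 := by
    rw [hθ, mul_one_div, div_le_div_iff₀ (by positivity) (by norm_num)]
    linarith
  have hθ1 : θ ≤ 1 / 2 := by
    rw [hθ, div_le_div_iff₀ (by positivity) (by norm_num)]
    linarith
  refine ⟨θ, 2 * ((gaussMass N)⁻¹ * (2 * θ) ^ (-(N : ℝ) / 2)), hθ0, hθ1, by positivity,
    fun u hu hsub lam τ hlam hlam1 hlamU hτ1 hτ2 => ?_⟩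
  have hU := hu.total_pos hm 0 0
  set U₀ := total u 0 0 with hU₀
  have hτ0 : 0 < τ := lt_of_lt_of_le (by positivity) hτ1
  have hτ3 : τ < 1 := by nlinarith
  have hmem := @mem_ball_prod_of_le N lam τ hlam1 hτ3
  have hΛ : ∀ x ∈ closedBall (0 : EuclideanSpace ℝ (Fin N)) lam, ∀ t ∈ Icc (-τ) (-τ + τ),
      total u x t ≤ C₀ * U₀ := fun x hx t ht => hsub (x, t) (hmem hx ht)
  have key := le_integral_of_subsolution (x₁ := 0) (s := -τ) (c := b * (C₀ * U₀) ^ (2 * r + 1))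
    hlam hτ0 (by positivity) hu.total_c2 hu.total_c1
    (fun x _ t _ => (hu.total_pos hm x t).le) hΛ (fun x hx t ht => by
      obtain ⟨d, -, hd, h⟩ := hu.total_heat hm hβ hr.le x t
      refine ⟨d, hd.trans ?_, h⟩
      exact mul_le_mul_of_nonneg_left (Real.rpow_le_rpow (hu.total_pos hm x t).le (hΛ x hx t ht)
        (by linarith)) hb0)
  rw [neg_add_cancel, ← hU₀] at key
  set I := ∫ y in ball (0 : EuclideanSpace ℝ (Fin N)) lam, total u y (-τ) with hI
  have hI0 : 0 ≤ I := integral_nonneg fun y => (hu.total_pos hm y _).le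
  have e1 : 2 * N * (C₀ * U₀) * τ / lam ^ 2 ≤ 2 * N * C₀ * θ * U₀ := by
    rw [div_le_iff₀ (by positivity)]
    calc 2 * N * (C₀ * U₀) * τ ≤ 2 * N * (C₀ * U₀) * (θ * lam ^ 2) := by gcongr
      _ = _ := by ring
  have e2 : U₀ ^ (2 * r + 1) * lam ^ 2 ≤ U₀ := by
    calc U₀ ^ (2 * r + 1) * lam ^ 2 ≤ U₀ ^ (2 * r + 1) * (U₀ ^ (-r)) ^ 2 := by gcongr
      _ = U₀ := by
        rw [← Real.rpow_natCast (U₀ ^ (-r)), ← Real.rpow_mul hU.le, ← Real.rpow_add hU]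
        have : 2 * r + 1 + -r * ((2 : ℕ) : ℝ) = 1 := by push_cast; ring
        rw [this, Real.rpow_one]
  have e3 : b * (C₀ * U₀) ^ (2 * r + 1) * τ ≤ b * C₀ ^ (2 * r + 1) * θ * U₀ := by
    rw [Real.mul_rpow hC₀.le hU.le]
    calc b * (C₀ ^ (2 * r + 1) * U₀ ^ (2 * r + 1)) * τ
        ≤ b * (C₀ ^ (2 * r + 1) * U₀ ^ (2 * r + 1)) * (θ * lam ^ 2) := by gcongr
      _ = b * C₀ ^ (2 * r + 1) * θ * (U₀ ^ (2 * r + 1) * lam ^ 2) := by ring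
      _ ≤ _ := by gcongr
  have e4 : L * θ * U₀ ≤ 1 / 2 * U₀ := by gcongr
  have e5 : L * θ * U₀ = 2 * N * C₀ * θ * U₀ + b * C₀ ^ (2 * r + 1) * θ * U₀ := by rw [hL]; ring
  have e6 : U₀ ≤ 2 * ((gaussMass N)⁻¹ * (4 * τ) ^ (-(N : ℝ) / 2) * I) := by linarith
  calc lam ^ N * U₀ ≤ lam ^ N * (2 * ((gaussMass N)⁻¹ * (4 * τ) ^ (-(N : ℝ) / 2) * I)) := by gcongr
    _ = 2 * ((gaussMass N)⁻¹ * (lam ^ N * (4 * τ) ^ (-(N : ℝ) / 2))) * I := by ring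
    _ ≤ 2 * ((gaussMass N)⁻¹ * (2 * θ) ^ (-(N : ℝ) / 2)) * I := by
      have := rpow_neg_half_le (N := N) hθ0 hlam hτ1
      gcongr

lemma exponent_pos (hr : 0 < r)
    (hpB : N = 1 ∨ (2 ≤ N ∧ 2 * r + 1 < ((N : ℝ) * (N + 2)) / ((N : ℝ) - 1) ^ 2)) :
    0 < 2 * (2 * r + 1) - r * (N + 2) := by
  rcases hpB with h | ⟨h2, h⟩
  · subst h; push_cast; linarith
  · have h3 : (2 : ℝ) ≤ N := by exact_mod_cast h2
    rw [lt_div_iff₀ (by nlinarith)] at h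
    nlinarith [sq_nonneg ((N : ℝ) - 2)]

/-- The bound on small balls in terms of the square of the source. -/
lemma IsPositiveSolution.mean_bound_sq (hu : IsPositiveSolution β r u) (hm : 0 < m)
    (hβ : ∀ i j, 0 ≤ β i j) (hr : 0 < r) {β₀ : ℝ} (hβ₀ : 0 < β₀) (hdiag : ∀ i, β₀ ≤ β i i)
    {C U₀ lam s : ℝ} (hC : 0 < C) (hU : 0 < U₀) (hlam : 0 < lam) (hlam1 : lam ≤ 1 / 2)
    {ω : ℝ} (hω : ω = volume.real (ball (0 : EuclideanSpace ℝ (Fin N)) 1))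
    {ε : ℝ} (hε : ε = 1 / (2 * C * (ω + 1)))
    (hmean : lam ^ N * U₀ ≤ C * ∫ y in ball (0 : EuclideanSpace ℝ (Fin N)) lam, total u y s)
    (h_integrable : IntegrableOn (fun y => ∑ i, src β r (fun j => u j y s) i ^ 2)
      (ball (0 : EuclideanSpace ℝ (Fin N)) (1 / 2))) :
    lam ^ N * ((ε * U₀) ^ (2 * r + 1)) ^ 2 ≤ 2 * C * ε * ((m : ℝ) ^ (2 * r + 1) * β₀⁻¹) ^ 2 *
      ∫ y in ball (0 : EuclideanSpace ℝ (Fin N)) (1 / 2),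
        ∑ i, src β r (fun j => u j y s) i ^ 2 := by
  have hω0 : 0 ≤ ω := hω ▸ measureReal_nonneg
  have hε0 : 0 < ε := by rw [hε]; positivity
  set A := ε * U₀ with hA
  have hA0 : 0 < A := by positivity
  set P := (A ^ (2 * r + 1)) ^ 2 with hP
  have hP0 : 0 < P := by positivity
  set K := ((m : ℝ) ^ (2 * r + 1) * β₀⁻¹) ^ 2 with hK
  have hK0 : 0 ≤ K := sq_nonneg _
  set F : EuclideanSpace ℝ (Fin N) → ℝ := fun y => ∑ i, src β r (fun j => u j y s) i ^ 2 with hF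
  have hF0 : ∀ y, 0 ≤ F y := fun y => Finset.sum_nonneg fun i _ => sq_nonneg _
  have h_integrable' : IntegrableOn F (ball 0 lam) := h_integrable.mono_set (ball_subset_ball hlam1)
  have h1 : ∫ y in ball (0 : EuclideanSpace ℝ (Fin N)) lam, total u y s
      ≤ ∫ y in ball (0 : EuclideanSpace ℝ (Fin N)) lam, (A + A / P * (K * F y)) := by
    refine integral_mono (hu.integrableOn_total 0 lam s)
      ((integrableOn_const (measure_ball_lt_top.ne)).add ((h_integrable'.const_mul K).const_mul (A / P)))
      fun y => ?_
    refine (le_add_mul_sq_rpow (hu.total_pos hm y s).le hA0 (by linarith : 1 ≤ 2 * r + 1)).trans ?_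
    have := hu.sq_total_rpow_le hm hβ hr.le hβ₀ hdiag y s
    simp only [hP] at *
    gcongr
  have h2 : ∫ y in ball (0 : EuclideanSpace ℝ (Fin N)) lam, (A + A / P * (K * F y))
      = A * (ω * lam ^ N) + A / P * (K * ∫ y in ball (0 : EuclideanSpace ℝ (Fin N)) lam, F y) := by
    have hc : IntegrableOn (fun _ : EuclideanSpace ℝ (Fin N) => A) (ball 0 lam) :=
      integrableOn_const measure_ball_lt_top.ne
    rw [integral_add hc.integrable ((h_integrable'.const_mul K).const_mul (A / P)), integral_const_mul (A / P), integral_const_mul K]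
    congr 1
    rw [setIntegral_const, Measure.real, Measure.addHaar_ball_of_pos _ _ hlam, smul_eq_mul, hω,
      Measure.real, ENNReal.toReal_mul, ENNReal.toReal_ofReal (by positivity)]
    simp
    ring
  have h3 : ∫ y in ball (0 : EuclideanSpace ℝ (Fin N)) lam, F y
      ≤ ∫ y in ball (0 : EuclideanSpace ℝ (Fin N)) (1 / 2), F y :=
    setIntegral_mono_set h_integrable (Eventually.of_forall hF0)
      (ball_subset_ball hlam1).eventuallyLE
  set J := ∫ y in ball (0 : EuclideanSpace ℝ (Fin N)) (1 / 2), F y with hJ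
  have h4 : lam ^ N * U₀ ≤ C * (A * (ω * lam ^ N) + A / P * (K * J)) := by
    refine hmean.trans ?_
    have := h1.trans_eq h2
    have h5 : A / P * (K * ∫ y in ball (0 : EuclideanSpace ℝ (Fin N)) lam, F y)
      ≤ A / P * (K * J) := by gcongr
    gcongr
    linarith
  have h5 : C * A * ω ≤ U₀ / 2 := by
    have : C * ε * ω ≤ 1 / 2 := by
      rw [hε]
      field_simp
      linarith
    calc C * A * ω = C * ε * ω * U₀ := by rw [hA]; ring
      _ ≤ 1 / 2 * U₀ := by gcongr
      _ = U₀ / 2 := by ring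
  have h6 : lam ^ N * U₀ ≤ lam ^ N * (U₀ / 2) + C * (A / P * (K * J)) := by
    have : lam ^ N * (C * A * ω) ≤ lam ^ N * (U₀ / 2) := by gcongr
    nlinarith
  have h7 : lam ^ N * U₀ * P ≤ 2 * C * A * K * J := by
    have e : C * (A / P * (K * J)) * P = C * A * K * J := by field_simp
    have := mul_le_mul_of_nonneg_right h6 hP0.le
    rw [add_mul, e] at this
    linarith
  have h8 : 2 * C * A * K * J = (2 * C * ε * K * J) * U₀ := by rw [hA]; ring
  rw [h8] at h7
  refine le_of_mul_le_mul_right ?_ hU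
  linarith

/-- If the value at the origin is comparable to the supremum, it is controlled by a spatial
mean at some earlier time. -/
lemma IsPositiveSolution.exists_le_mean (hN : 1 ≤ N) (hm : 0 < m) (hr : 0 < r)
    (hβ : ∀ i j, 0 ≤ β i j) (hsym : ∀ i j, β i j = β j i) {β₀ : ℝ} (hβ₀ : 0 < β₀)
    (hdiag : ∀ i, β₀ ≤ β i i)
    (hpB : N = 1 ∨ (2 ≤ N ∧ 2 * r + 1 < ((N : ℝ) * (N + 2)) / ((N : ℝ) - 1) ^ 2))
    {C₀ : ℝ} (hC₀ : 0 < C₀) :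
    ∃ C, 0 < C ∧ ∀ u : Fin m → EuclideanSpace ℝ (Fin N) → ℝ → ℝ, IsPositiveSolution β r u →
      (∀ z ∈ ball (0 : EuclideanSpace ℝ (Fin N) × ℝ) 1, total u z.1 z.2 ≤ C₀ * total u 0 0) →
      ∃ s ∈ Ioo (-1 : ℝ) 0, total u 0 0 ≤
        C * ∫ y in ball (0 : EuclideanSpace ℝ (Fin N)) 1, total u y s := by
  obtain ⟨CA, hCA, hA⟩ := exists_integral_estimate hN hr hβ hsym hβ₀ hdiag hpB
  obtain ⟨θ, C, hθ, hθ2, hC, hmean⟩ :=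
    IsPositiveSolution.exists_mean_bound (N := N) hm hβ hr hC₀
  have he := exponent_pos (N := N) hr hpB
  set e := 2 * (2 * r + 1) - r * (N + 2) with hedef
  set ω := volume.real (ball (0 : EuclideanSpace ℝ (Fin N)) 1) with hω
  have hω0 : 0 ≤ ω := measureReal_nonneg
  set ε : ℝ := 1 / (2 * C * (ω + 1)) with hε
  have hε0 : 0 < ε := by positivity
  set K₁ : ℝ := 2 * C * ε * ((m : ℝ) ^ (2 * r + 1) * β₀⁻¹) ^ 2 with hK₁
  have hK₁0 : 0 ≤ K₁ := by positivity
  set K₂ : ℝ := K₁ * CA / (θ / 2 * (ε ^ (2 * r + 1)) ^ 2) with hK₂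
  have hK₂0 : 0 ≤ K₂ := by positivity
  set K : ℝ := K₂ ^ (1 / e) + 1 with hK
  have hK0 : 0 < K := by positivity
  set b := min (1 / 4) (K ^ (-r)) with hb
  have hb0 : 0 < b := by positivity
  have bound : ∀ u : Fin m → EuclideanSpace ℝ (Fin N) → ℝ → ℝ, IsPositiveSolution β r u →
      (∀ z ∈ ball (0 : EuclideanSpace ℝ (Fin N) × ℝ) 1, total u z.1 z.2 ≤ C₀ * total u 0 0) →
      total u 0 0 ^ (-r) ≤ 1 / 4 → total u 0 0 ≤ K := by
    intro u hu hsub hsmall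
    have hU := hu.total_pos hm 0 0
    have hM : ∀ i, ∀ z ∈ ball (0 : EuclideanSpace ℝ (Fin N) × ℝ) 1,
        u i z.1 z.2 ≤ C₀ * total u 0 0 := fun i z hz => (hu.le_total i _ _).trans (hsub z hz)
    obtain ⟨hi1, hi2, hi3⟩ := hu.integral_src_sq_prod hβ hr.le hM
    have hCA' := hA u hu ⟨_, hM⟩
    rw [hi3] at hCA'
    set U₀ := total u 0 0 with hU₀
    set lam := U₀ ^ (-r) with hlam
    have hlam0 : 0 < lam := by positivity
    set G : ℝ → ℝ := fun s => ∫ y in ball (0 : EuclideanSpace ℝ (Fin N)) (1 / 2),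
      ∑ i, src β r (fun j => u j y s) i ^ 2 with hG
    have hG0 : ∀ s, 0 ≤ G s := fun s =>
      integral_nonneg fun y => Finset.sum_nonneg fun i _ => sq_nonneg _
    set T : Set ℝ := Ioo (-(θ * lam ^ 2)) (-(θ * lam ^ 2 / 2)) with hT
    have hθl : 0 < θ * lam ^ 2 := by positivity
    have hTs : T ⊆ Ioo (-(1 / 2)) (1 / 2) := by
      intro s hs
      have : θ * lam ^ 2 < 1 / 2 := by nlinarith
      exact ⟨by linarith [hs.1], by linarith [hs.2]⟩
    set c := lam ^ N * ((ε * U₀) ^ (2 * r + 1)) ^ 2 with hc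
    have h1 : ∫ _ in T, c ≤ ∫ s in T, K₁ * G s := by
      refine integral_mono_ae (integrableOn_const (by simp [hT])) ((hi1.mono_set hTs).const_mul _) ?_
      have h2 := ae_restrict_of_ae_restrict_of_subset hTs hi2
      filter_upwards [h2, ae_restrict_mem measurableSet_Ioo] with s hs hsT
      refine hu.mean_bound_sq hm hβ hr hβ₀ hdiag hC hU hlam0 (by linarith) hω hε ?_ hs
      have := hmean u hu hsub lam (-s) hlam0 (by linarith) le_rfl
        (by linarith [hsT.2]) (by linarith [hsT.1])
      rwa [neg_neg] at this
    have h2 : ∫ _ in T, c = θ * lam ^ 2 / 2 * c := by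
      rw [setIntegral_const, smul_eq_mul, hT, Real.volume_real_Ioo_of_le (by linarith)]
      ring
    have h3 : ∫ s in T, K₁ * G s ≤ K₁ * CA := by
      rw [integral_const_mul]
      refine mul_le_mul_of_nonneg_left (le_trans ?_ hCA') hK₁0
      exact setIntegral_mono_set hi1 (Eventually.of_forall hG0) hTs.eventuallyLE
    have h4 : lam ^ 2 * lam ^ N * (U₀ ^ (2 * r + 1)) ^ 2 = U₀ ^ e := by
      rw [← pow_add, hlam, ← Real.rpow_natCast, ← Real.rpow_natCast, ← Real.rpow_mul hU.le,
        ← Real.rpow_mul hU.le, ← Real.rpow_add hU]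
      congr 1
      rw [hedef]; push_cast; ring
    have h5 : θ * lam ^ 2 / 2 * c = θ / 2 * (ε ^ (2 * r + 1)) ^ 2 * U₀ ^ e := by
      rw [hc, Real.mul_rpow hε0.le hU.le, ← h4]; ring
    have h6 : U₀ ^ e ≤ K₂ := by
      rw [hK₂, le_div_iff₀ (by positivity), mul_comm, ← h5, ← h2]
      exact h1.trans h3
    have h7 := Real.rpow_le_rpow (by positivity) h6 (by positivity : 0 ≤ 1 / e)
    rw [← Real.rpow_mul hU.le, mul_one_div_cancel he.ne', Real.rpow_one] at h7
    linarith
  refine ⟨C / b ^ N, by positivity, fun u hu hsub => ?_⟩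
  have hU := hu.total_pos hm 0 0
  have bd := bound u hu hsub
  set U₀ := total u 0 0 with hU₀
  set lam := min (1 / 4) (U₀ ^ (-r)) with hlam
  have hlam0 : 0 < lam := by positivity
  have hlam1 : lam ≤ 1 / 4 := min_le_left _ _
  have hbl : b ≤ lam := by
    refine le_min (min_le_left _ _) ?_
    rcases _root_.le_total (U₀ ^ (-r)) (1 / 4) with h | h
    · exact (min_le_right _ _).trans (Real.rpow_le_rpow_of_nonpos hU (bd h) (by linarith))
    · exact (min_le_left _ _).trans h
  have hθl : 0 < θ * lam ^ 2 := by positivity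
  refine ⟨-(θ * lam ^ 2), ⟨by nlinarith, by linarith⟩, ?_⟩
  have h1 := hmean u hu hsub lam (θ * lam ^ 2) hlam0 (by linarith) (min_le_right _ _)
    (by linarith) le_rfl
  have h2 : ∫ y in ball (0 : EuclideanSpace ℝ (Fin N)) lam, total u y (-(θ * lam ^ 2))
      ≤ ∫ y in ball (0 : EuclideanSpace ℝ (Fin N)) 1, total u y (-(θ * lam ^ 2)) :=
    setIntegral_mono_set (hu.integrableOn_total 0 1 _)
      (Eventually.of_forall fun y => (hu.total_pos hm y _).le)
      (ball_subset_ball (by linarith)).eventuallyLE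
  rw [div_mul_eq_mul_div, le_div_iff₀ (by positivity), mul_comm]
  calc b ^ N * U₀ ≤ lam ^ N * U₀ := by gcongr
    _ ≤ _ := h1
    _ ≤ _ := by gcongr

end PointwiseMean

section LocalBound

open Filter Topology
open scoped Pointwise

variable {N m : ℕ} {β : Fin m → Fin m → ℝ} {r : ℝ}
  {u : Fin m → EuclideanSpace ℝ (Fin N) → ℝ → ℝ}

lemma rpow_one_div_rpow {R : ℝ} (hR : 0 < R) (hr : 0 < r) :
    (R ^ (1 / r)) ^ (2 * r + 1) = R ^ (1 / r) * R ^ 2 := by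
  rw [← Real.rpow_mul hR.le, ← Real.rpow_natCast R 2, ← Real.rpow_add hR]
  congr 1
  push_cast; field_simp; ring

lemma src_const_mul {c : ℝ} (hc : 0 < c) {w : Fin m → ℝ} (hw : ∀ i, 0 < w i) (i : Fin m) :
    src β r (fun j => c * w j) i = c ^ (2 * r + 1) * src β r w i := by
  simp only [src, Finset.mul_sum]
  refine Finset.sum_congr rfl fun j _ => ?_
  rw [Real.mul_rpow hc.le (hw i).le, Real.mul_rpow hc.le (hw j).le]
  have : c ^ (2 * r + 1) = c ^ r * c ^ (r + 1) := by
    rw [← Real.rpow_add hc]; ring_nf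
  rw [this]; ring

/-- The scaling invariance of the system. -/
lemma IsPositiveSolution.scale (hu : IsPositiveSolution β r u) (hr : 0 < r) {R : ℝ} (hR : 0 < R)
    (x₀ : EuclideanSpace ℝ (Fin N)) (t₀ : ℝ) :
    IsPositiveSolution β r fun i x t => R ^ (1 / r) * u i (x₀ + R • x) (t₀ + R ^ 2 * t) where
  pos i x t := mul_pos (by positivity) (hu.pos i _ _)
  c2 i t := contDiff_const.mul ((hu.c2 i _).comp (contDiff_const.add (contDiff_id.const_smul R)))
  c1 i x := contDiff_const.mul ((hu.c1 i _).comp (contDiff_const.add (contDiff_const.mul contDiff_id)))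
  heat i x t := by
    have h := ((hu.heat i (x₀ + R • x) (t₀ + R ^ 2 * t)).scale).const_mul (R ^ (1 / r))
    rw [src_const_mul (by positivity) (fun j => hu.pos j _ _), rpow_one_div_rpow hR hr, mul_assoc]
    exact h

lemma integral_ball_comp_affine (f : EuclideanSpace ℝ (Fin N) → ℝ)
    (x₀ : EuclideanSpace ℝ (Fin N)) {R : ℝ} (hR : 0 < R) (ρ : ℝ) :
    ∫ y in ball (0 : EuclideanSpace ℝ (Fin N)) ρ, f (x₀ + R • y)
      = (R ^ N)⁻¹ * ∫ y in ball x₀ (R * ρ), f y := by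
  rw [Measure.setIntegral_comp_smul_of_pos volume (fun y => f (x₀ + y)) _ hR, _root_.smul_ball hR.ne']
  have := (measurePreserving_add_left volume x₀).setIntegral_preimage_emb
    (measurableEmbedding_addLeft x₀) f (ball x₀ (R * ρ))
  rw [← this, preimage_add_ball]
  simp [abs_of_pos hR]

lemma integral_Ioo_comp_mul (f : ℝ → ℝ) {R : ℝ} (hR : 0 < R) (a b : ℝ) :
    ∫ s in Ioo a b, f (R * s) = R⁻¹ * ∫ s in Ioo (R * a) (R * b), f s := by
  have h := Measure.setIntegral_comp_smul_of_pos volume f (Ioo a b) hR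
  have h2 : R • Ioo a b = Ioo (R * a) (R * b) := LinearOrderedField.smul_Ioo hR
  rw [h2] at h
  simpa using h

lemma total_scale (R : ℝ) (x₀ : EuclideanSpace ℝ (Fin N)) (t₀ : ℝ) (x : EuclideanSpace ℝ (Fin N))
    (t : ℝ) : total (fun i x t => R ^ (1 / r) * u i (x₀ + R • x) (t₀ + R ^ 2 * t)) x t
      = R ^ (1 / r) * total u (x₀ + R • x) (t₀ + R ^ 2 * t) := by
  simp only [total, Finset.mul_sum]

/-- The set of points near which the solution is unbounded. -/
def blowUpSet (U : EuclideanSpace ℝ (Fin N) → ℝ → ℝ) :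
    Set (EuclideanSpace ℝ (Fin N) × ℝ) := {z | ¬ ∃ M, ∀ᶠ w in 𝓝 z, U w.1 w.2 ≤ M}

lemma isClosed_blowUpSet (U : EuclideanSpace ℝ (Fin N) → ℝ → ℝ) :
    IsClosed (blowUpSet U) := by
  rw [← isOpen_compl_iff, isOpen_iff_eventually]
  intro z hz
  obtain ⟨M, hM⟩ := not_not.1 hz
  filter_upwards [eventually_eventually_nhds.2 hM] with w hw
  exact not_not.2 ⟨M, hw⟩

lemma exists_bound_of_disjoint_blowUpSet {U : EuclideanSpace ℝ (Fin N) → ℝ → ℝ}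
    {K : Set (EuclideanSpace ℝ (Fin N) × ℝ)} (hK : IsCompact K) (h : ∀ z ∈ K, z ∉ blowUpSet U) :
    ∃ M, ∀ z ∈ K, U z.1 z.2 ≤ M := by
  refine hK.induction_on (p := fun s => ∃ M, ∀ z ∈ s, U z.1 z.2 ≤ M) ⟨0, by simp⟩
    (fun s t hst ⟨M, hM⟩ => ⟨M, fun z hz => hM z (hst hz)⟩)
    (fun s t ⟨M, hM⟩ ⟨M', hM'⟩ => ⟨max M M', ?_⟩) fun z hz => ?_
  · rintro z (hz | hz)
    · exact (hM z hz).trans (le_max_left _ _)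
    · exact (hM' z hz).trans (le_max_right _ _)
  · obtain ⟨M, hM⟩ := not_not.1 (h z hz)
    exact ⟨_, mem_nhdsWithin_of_mem_nhds hM, M, fun w hw => hw⟩

/-- By the Baire category theorem, a separately continuous function is uniformly bounded on
vertical segments through a relatively open part of any nonempty closed set. -/
lemma exists_uniform_of_isClosed {E : Type*} [MetricSpace E] [CompleteSpace E]
    {U : E → ℝ → ℝ} (hx : ∀ t, Continuous fun x => U x t) (ht : ∀ x, Continuous fun t => U x t)
    {S : Set (E × ℝ)} (hS : IsClosed S) (hne : S.Nonempty) :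
    ∃ z ∈ S, ∃ r₀ > 0, ∃ k : ℝ, ∀ w ∈ S, dist w z < r₀ → ∀ s, |s - w.2| < 1 → U w.1 s ≤ k := by
  have : CompleteSpace S := hS.completeSpace_coe
  have : Nonempty S := hne.to_subtype
  have hTc : ∀ k : ℕ, IsClosed {z : S | ∀ s, |s - z.1.2| < 1 → U z.1.1 s ≤ k} := by
    intro k
    have e : {z : S | ∀ s, |s - z.1.2| < 1 → U z.1.1 s ≤ k}
        = ⋂ s : ℝ, ({z : S | |s - z.1.2| < 1} ∩ {z : S | (k : ℝ) < U z.1.1 s})ᶜ := by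
      ext z
      simp only [mem_ofPred_eq, mem_iInter, mem_compl_iff, mem_inter_iff, not_and, not_lt]
    rw [e]
    refine isClosed_iInter fun s => (IsOpen.inter ?_ ?_).isClosed_compl
    · exact isOpen_lt (by fun_prop) continuous_const
    · exact isOpen_lt continuous_const
        ((hx s).comp (continuous_fst.comp continuous_subtype_val))
  have hTu : ⋃ k : ℕ, {z : S | ∀ s, |s - z.1.2| < 1 → U z.1.1 s ≤ k} = univ := by
    refine eq_univ_of_forall fun z => mem_iUnion.2 ?_
    obtain ⟨M, hM⟩ := (isCompact_Icc (a := z.1.2 - 1) (b := z.1.2 + 1)).bddAbove_image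
      (ht z.1.1).continuousOn
    obtain ⟨k, hk⟩ := exists_nat_ge M
    refine ⟨k, fun s hs => (hM ⟨s, ?_, rfl⟩).trans hk⟩
    rw [abs_lt] at hs
    exact ⟨by linarith [hs.1], by linarith [hs.2]⟩
  obtain ⟨k, z, hz⟩ := nonempty_interior_of_iUnion_of_closed hTc hTu
  obtain ⟨r₀, hr₀, hb⟩ := Metric.mem_nhds_iff.1 (mem_interior_iff_mem_nhds.1 hz)
  exact ⟨z.1, z.2, r₀, hr₀, k, fun w hw hd s hs =>
    hb (show (⟨w, hw⟩ : S) ∈ ball z r₀ from hd) s hs⟩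

namespace IsPositiveSolution

/-- The localized form of the mean bound on an arbitrary parabolic cylinder. -/
lemma exists_le_mean_cylinder (hN : 1 ≤ N) (hm : 0 < m) (hr : 0 < r)
    (hβ : ∀ i j, 0 ≤ β i j) (hsym : ∀ i j, β i j = β j i) {β₀ : ℝ} (hβ₀ : 0 < β₀)
    (hdiag : ∀ i, β₀ ≤ β i i)
    (hpB : N = 1 ∨ (2 ≤ N ∧ 2 * r + 1 < ((N : ℝ) * (N + 2)) / ((N : ℝ) - 1) ^ 2))
    {C₀ : ℝ} (hC₀ : 0 < C₀) :
    ∃ C, 0 < C ∧ ∀ u : Fin m → EuclideanSpace ℝ (Fin N) → ℝ → ℝ, IsPositiveSolution β r u →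
      ∀ x₁ t₁ δ, 0 < δ → (∀ x ∈ ball x₁ δ, ∀ t, |t - t₁| < δ ^ 2 →
        total u x t ≤ C₀ * total u x₁ t₁) →
      ∃ s ∈ Ioo (t₁ - δ ^ 2) t₁, δ ^ N * total u x₁ t₁ ≤ C * ∫ y in ball x₁ δ, total u y s := by
  obtain ⟨C, hC, h⟩ := exists_le_mean hN hm hr hβ hsym hβ₀ hdiag hpB hC₀
  refine ⟨C, hC, fun u hu x₁ t₁ δ hδ hsub => ?_⟩
  have hc : 0 < δ ^ (1 / r) := by positivity
  obtain ⟨s, hs, hs'⟩ := h _ (hu.scale hr hδ x₁ t₁) (by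
    rintro ⟨x, t⟩ hz
    rw [mem_ball_prod_zero] at hz
    simp only [total_scale, smul_zero, add_zero, mul_zero]
    rw [mul_left_comm]
    refine mul_le_mul_of_nonneg_left (hsub _ ?_ _ ?_) hc.le
    · have h1 : ‖x‖ < 1 := by simpa using hz.1
      simp only [mem_ball, dist_self_add_left, norm_smul, Real.norm_eq_abs, abs_of_pos hδ]
      nlinarith
    · have h1 : |t| < 1 := abs_lt.2 hz.2
      rw [add_sub_cancel_left, abs_mul, abs_of_pos (by positivity : 0 < δ ^ 2)]
      have : 0 < δ ^ 2 := by positivity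
      nlinarith)
  have hδ2 : 0 < δ ^ 2 := by positivity
  refine ⟨t₁ + δ ^ 2 * s, ⟨by nlinarith [hs.1], by nlinarith [hs.2]⟩, ?_⟩
  simp only [total_scale, smul_zero, add_zero, mul_zero, integral_const_mul] at hs'
  rw [integral_ball_comp_affine (fun y => total u y (t₁ + δ ^ 2 * s)) x₁ hδ 1, mul_one,
    mul_left_comm] at hs'
  have h2 := le_of_mul_le_mul_left hs' hc
  calc δ ^ N * total u x₁ t₁ ≤ δ ^ N * (C * ((δ ^ N)⁻¹ *
      ∫ y in ball x₁ δ, total u y (t₁ + δ ^ 2 * s))) := by gcongr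
    _ = _ := by field_simp

/-- A doubling argument: in a cylinder where the solution is bounded, its value at the centre is
controlled by the spatial means. -/
lemma exists_le_of_integral_le (hN : 1 ≤ N) (hm : 0 < m) (hr : 0 < r)
    (hβ : ∀ i j, 0 ≤ β i j) (hsym : ∀ i j, β i j = β j i) {β₀ : ℝ} (hβ₀ : 0 < β₀)
    (hdiag : ∀ i, β₀ ≤ β i i)
    (hpB : N = 1 ∨ (2 ≤ N ∧ 2 * r + 1 < ((N : ℝ) * (N + 2)) / ((N : ℝ) - 1) ^ 2)) :
    ∃ C, 0 < C ∧ ∀ u : Fin m → EuclideanSpace ℝ (Fin N) → ℝ → ℝ, IsPositiveSolution β r u →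
      ∀ x t ρ M J, 0 < ρ →
        (∀ y ∈ ball x ρ, ∀ s, |s - t| < ρ ^ 2 → total u y s ≤ M) →
        (∀ s, |s - t| < ρ ^ 2 → ∫ y in ball x ρ, total u y s ≤ J) →
        ρ ^ N * total u x t ≤ C * J := by
  obtain ⟨C, hC, h⟩ := exists_le_mean_cylinder hN hm hr hβ hsym hβ₀ hdiag hpB
    (by positivity : (0 : ℝ) < 2 ^ (N + 1))
  refine ⟨2 ^ (N + 1) * C, by positivity, fun u hu x t ρ M J hρ hM hJ => ?_⟩
  set d : EuclideanSpace ℝ (Fin N) × ℝ → ℝ := fun w => ρ - max (dist w.1 x) (√|w.2 - t|) with hd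
  set Q : Set (EuclideanSpace ℝ (Fin N) × ℝ) := {w | 0 < d w} with hQ
  have hQmem : ∀ w ∈ Q, w.1 ∈ ball x ρ ∧ |w.2 - t| < ρ ^ 2 := fun w hw => by
    have hw' : max (dist w.1 x) (√|w.2 - t|) < ρ := sub_pos.1 hw
    have h1 := max_lt_iff.1 hw'
    exact ⟨h1.1, (Real.sqrt_lt' hρ).1 h1.2⟩
  have hdρ : ∀ w, d w ≤ ρ := fun w => by
    have : 0 ≤ max (dist w.1 x) (√|w.2 - t|) := le_max_of_le_left dist_nonneg
    simp only [hd]; linarith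
  have hdz : d (x, t) = ρ := by simp [hd]
  have hzQ : (x, t) ∈ Q := by
    change 0 < d (x, t)
    rwa [hdz]
  set f : EuclideanSpace ℝ (Fin N) × ℝ → ℝ := fun w => d w ^ N * total u w.1 w.2 with hf
  have hfb : BddAbove (f '' Q) := by
    refine ⟨ρ ^ N * M, ?_⟩
    rintro _ ⟨w, hw, rfl⟩
    obtain ⟨h1, h2⟩ := hQmem w hw
    have h0 : 0 < d w := hw
    exact mul_le_mul (pow_le_pow_left₀ h0.le (hdρ w) N) (hM _ h1 _ h2)
      (hu.total_pos hm _ _).le (by positivity)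
  have hfz : f (x, t) = ρ ^ N * total u x t := by simp only [hf, hdz]
  have hfz0 : 0 < f (x, t) := by
    rw [hfz]
    exact mul_pos (by positivity) (hu.total_pos hm _ _)
  have hsup : f (x, t) ≤ sSup (f '' Q) := le_csSup hfb ⟨_, hzQ, rfl⟩
  obtain ⟨_, ⟨z, hz, rfl⟩, hz2⟩ := exists_lt_of_lt_csSup (⟨_, ⟨_, hzQ, rfl⟩⟩ : (f '' Q).Nonempty)
    (half_lt_self (hfz0.trans_le hsup))
  have hmax : ∀ w ∈ Q, f w ≤ 2 * f z := fun w hw => by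
    have := le_csSup hfb ⟨w, hw, rfl⟩
    linarith
  have hdz0 : 0 < d z := hz
  have hnear : ∀ y ∈ ball z.1 (d z / 2), ∀ s, |s - z.2| < (d z / 2) ^ 2 → d z / 2 ≤ d (y, s) := by
    intro y hy s hs
    have h1 : dist y x ≤ d z / 2 + dist z.1 x :=
      (dist_triangle y z.1 x).trans (add_le_add (mem_ball.1 hy).le le_rfl)
    have h2 : √|s - t| ≤ d z / 2 + √|z.2 - t| := by
      refine Real.sqrt_le_iff.2 ⟨by positivity, ?_⟩
      have h3 : |s - t| ≤ |s - z.2| + |z.2 - t| := abs_sub_le _ _ _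
      have h4 := Real.sq_sqrt (abs_nonneg (z.2 - t))
      have h5 : 0 ≤ d z / 2 * √|z.2 - t| := by positivity
      nlinarith
    have h3 : max (dist y x) √|s - t| ≤ d z / 2 + max (dist z.1 x) (√|z.2 - t|) :=
      max_le (h1.trans (add_le_add le_rfl (le_max_left _ _)))
        (h2.trans (add_le_add le_rfl (le_max_right _ _)))
    have h4 : d (y, s) = ρ - max (dist y x) √|s - t| := rfl
    have h5 : d z = ρ - max (dist z.1 x) (√|z.2 - t|) := rfl
    linarith
  obtain ⟨s, hs, hs'⟩ := h u hu z.1 z.2 (d z / 2) (by positivity) (by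
    intro y hy s hs
    have h1 := hnear y hy s hs
    have h2 : f (y, s) ≤ 2 * f z := hmax (y, s) (by change 0 < d (y, s); linarith)
    have h3 : (d z / 2) ^ N * total u y s ≤ f (y, s) := by
      have := (hu.total_pos hm y s).le
      simp only [hf]
      gcongr
    have h4 : 2 * f z = (d z / 2) ^ N * (2 ^ (N + 1) * total u z.1 z.2) := by
      simp only [hf]
      rw [div_pow]; field_simp; ring
    rw [h4] at h2
    exact le_of_mul_le_mul_left (h3.trans h2) (by positivity))
  have hb : ball z.1 (d z / 2) ⊆ ball x ρ := fun y hy => by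
    have h1 := hnear y hy z.2 (by simp; positivity)
    exact (hQmem (y, z.2) (by change 0 < d (y, z.2); linarith)).1
  have hst : |s - t| < ρ ^ 2 := by
    have h1 := hnear z.1 (mem_ball_self (by positivity)) s
      (by rw [abs_lt]; exact ⟨by linarith [hs.1], by have := hs.2; nlinarith [hs.2]⟩)
    exact (hQmem (z.1, s) (by change 0 < d (z.1, s); linarith)).2
  have hI : ∫ y in ball z.1 (d z / 2), total u y s ≤ J :=
    (setIntegral_mono_set (hu.integrableOn_total x ρ s)
      (Eventually.of_forall fun y => (hu.total_pos hm y s).le) hb.eventuallyLE).trans (hJ s hst)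
  have h6 := hmax _ hzQ
  rw [hfz] at h6
  have h7 : 2 * f z = 2 ^ (N + 1) * ((d z / 2) ^ N * total u z.1 z.2) := by
    simp only [hf]
    rw [div_pow]; field_simp; ring
  rw [h7] at h6
  rw [mul_assoc]
  refine h6.trans (mul_le_mul_of_nonneg_left (hs'.trans ?_) (by positivity))
  gcongr

/-- A cylinder free of blow-up points whose fourfold enlargement meets the blow-up set at a
controlled point: the value at its centre is controlled. -/
lemma le_of_cylinder (hu : IsPositiveSolution β r u) (hm : 0 < m) (hβ : ∀ i j, 0 ≤ β i j)
    (hr : 0 < r) {C : ℝ} {x x' : EuclideanSpace ℝ (Fin N)} {t t' ρ k : ℝ}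
    (hmean : ∀ J, (∀ s, |s - t| < ρ ^ 2 → ∫ y in ball x ρ, total u y s ≤ J) →
        ρ ^ N * total u x t ≤ C * J) (hρ : 0 < ρ) (hρ1 : 42 * ρ ^ 2 < 1)
    (hx : dist x' x < 4 * ρ) (ht : |t' - t| < (4 * ρ) ^ 2)
    (hk : ∀ s, |s - t'| < 1 → total u x' s ≤ k) :
    total u x t ≤ C * (2 * rexp 1 * gaussMass N * 2 ^ N * 5 ^ N * k) := by
  have hg := gaussMass_pos N
  have h := hmean (2 * rexp 1 * gaussMass N * 2 ^ N * (5 * ρ) ^ N * k) fun s hs => by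
    have h1 := (hu.posSuper_total hm hβ hr.le x' ((2 * N + 6) * (5 * ρ)) s
      (s + (5 * ρ) ^ 2)).integral_le (by positivity)
    have hsub : ball x ρ ⊆ ball x' (5 * ρ) := ball_subset_ball' (by
      rw [dist_comm]; linarith)
    have h2 : ∫ y in ball x ρ, total u y s ≤ ∫ y in ball x' (5 * ρ), total u y s :=
      setIntegral_mono_set (hu.integrableOn_total _ _ s)
        (Eventually.of_forall fun y => (hu.total_pos hm y _).le) hsub.eventuallyLE
    refine h2.trans (h1.trans (mul_le_mul_of_nonneg_left (hk _ ?_) (by positivity)))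
    rw [abs_lt] at *
    constructor <;> nlinarith [hs.1, hs.2, ht.1, ht.2]
  have e : C * (2 * rexp 1 * gaussMass N * 2 ^ N * (5 * ρ) ^ N * k)
      = ρ ^ N * (C * (2 * rexp 1 * gaussMass N * 2 ^ N * 5 ^ N * k)) := by
    rw [mul_pow]; ring
  rw [e] at h
  exact le_of_mul_le_mul_left h (by positivity)

/-- Positive solutions are locally bounded. -/
lemma blowUpSet_eq_empty (hu : IsPositiveSolution β r u) (hN : 1 ≤ N) (hm : 0 < m) (hr : 0 < r)
    (hβ : ∀ i j, 0 ≤ β i j) (hsym : ∀ i j, β i j = β j i) {β₀ : ℝ} (hβ₀ : 0 < β₀)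
    (hdiag : ∀ i, β₀ ≤ β i i)
    (hpB : N = 1 ∨ (2 ≤ N ∧ 2 * r + 1 < ((N : ℝ) * (N + 2)) / ((N : ℝ) - 1) ^ 2)) :
    blowUpSet (total u) = ∅ := by
  by_contra hne
  obtain ⟨z, hz, r₀, hr₀, k, hk⟩ := exists_uniform_of_isClosed
    (fun t => (hu.total_c2 t).continuous) (fun x => (hu.total_c1 x).continuous)
    (isClosed_blowUpSet (total u)) (nonempty_iff_ne_empty.2 hne)
  obtain ⟨C, hC, hE⟩ := exists_le_of_integral_le hN hm hr hβ hsym hβ₀ hdiag hpB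
  set S := blowUpSet (total u) with hS
  set K := C * (2 * rexp 1 * gaussMass N * 2 ^ N * 5 ^ N * k) with hK
  refine hz ⟨max k K, ?_⟩
  set ρ₀ := min (1 / 20) (r₀ / 2) with hρ₀
  have hρ0 : 0 < ρ₀ := by positivity
  have hρ1 : ρ₀ ≤ 1 / 20 := min_le_left _ _
  have hρ2 : ρ₀ ≤ r₀ / 2 := min_le_right _ _
  filter_upwards [Metric.ball_mem_nhds z (by positivity : 0 < ρ₀ ^ 2)] with w hw
  rw [mem_ball, Prod.dist_eq, max_lt_iff] at hw
  have hsq : ρ₀ ^ 2 ≤ ρ₀ := by nlinarith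
  by_cases hwS : w ∈ S
  · refine (hk w hwS ?_ w.2 (by simp)).trans (le_max_left _ _)
    rw [Prod.dist_eq, max_lt_iff]
    exact ⟨by linarith [hw.1], by linarith [hw.2]⟩
  refine le_trans ?_ (le_max_right _ _)
  have hex : ∃ n : ℕ, ∀ v ∈ S, dist v.1 w.1 < ρ₀ / 2 ^ n → ¬ |v.2 - w.2| < (ρ₀ / 2 ^ n) ^ 2 := by
    obtain ⟨ε, hε, hb⟩ := Metric.isOpen_iff.1 (isClosed_blowUpSet (total u)).isOpen_compl w hwS
    obtain ⟨n, hn⟩ := exists_pow_lt_of_lt_one (div_pos hε hρ0) (by norm_num : (1 / 2 : ℝ) < 1)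
    have h1 : ρ₀ / 2 ^ n < ε := by
      rw [lt_div_iff₀ hρ0] at hn
      rw [one_div, inv_pow, inv_mul_eq_div] at hn
      exact hn
    have h2 : ρ₀ / 2 ^ n ≤ 1 := by
      refine (div_le_self hρ0.le (one_le_pow₀ (by norm_num))).trans (by linarith)
    have h3 : 0 < ρ₀ / 2 ^ n := by positivity
    refine ⟨n, fun v hv hv1 hv2 => ?_⟩
    suffices h : v ∈ ball w ε from hb h hv
    rw [mem_ball, Prod.dist_eq, max_lt_iff, Real.dist_eq]
    exact ⟨by linarith, by nlinarith⟩
  classical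
  obtain ⟨n, hn, hmin⟩ : ∃ n : ℕ, (∀ v ∈ S, dist v.1 w.1 < ρ₀ / 2 ^ n →
      ¬ |v.2 - w.2| < (ρ₀ / 2 ^ n) ^ 2) ∧ ∀ l < n, ¬ ∀ v ∈ S, dist v.1 w.1 < ρ₀ / 2 ^ l →
      ¬ |v.2 - w.2| < (ρ₀ / 2 ^ l) ^ 2 :=
    ⟨Nat.find hex, Nat.find_spec hex, fun l hl => Nat.find_min hex hl⟩
  rcases n with _ | n
  · exact absurd (by simpa [Real.dist_eq, abs_sub_comm] using hw.2)
      (by simpa using hn z hz (by rw [dist_comm]; simpa using hw.1.trans_le hsq))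
  have h0 := hmin n (Nat.lt_succ_self n)
  push Not at h0
  obtain ⟨v, hv, hv1, hv2⟩ := h0
  set ρ := ρ₀ / 2 ^ n / 4 with hρ
  have hρpos : 0 < ρ := by positivity
  have e1 : ρ₀ / 2 ^ n = 4 * ρ := by rw [hρ]; ring
  have e2 : ρ₀ / 2 ^ (n + 1) = 2 * ρ := by rw [hρ, pow_succ]; field_simp; ring
  have hρle : 4 * ρ ≤ ρ₀ := by
    rw [← e1]; exact div_le_self hρ0.le (one_le_pow₀ (by norm_num))
  rw [e1] at hv1 hv2
  rw [e2] at hn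
  obtain ⟨M, hM⟩ := exists_bound_of_disjoint_blowUpSet (U := total u)
    ((isCompact_closedBall w.1 ρ).prod (isCompact_Icc (a := w.2 - ρ ^ 2) (b := w.2 + ρ ^ 2)))
    (by
      rintro v ⟨h1, h2⟩ hvS
      refine hn v hvS ((mem_closedBall.1 h1).trans_lt (by linarith)) ?_
      have : 0 < ρ ^ 2 := by positivity
      rw [abs_lt]
      constructor <;> nlinarith [h2.1, h2.2])
  refine hu.le_of_cylinder hm hβ hr (x' := v.1) (t' := v.2) (fun J hJ =>
    hE u hu w.1 w.2 ρ M J hρpos (fun y hy s hs => hM (y, s) ⟨ball_subset_closedBall hy, ?_⟩) hJ)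
    hρpos (by nlinarith) hv1 hv2 (hk v hv ?_)
  · rw [abs_lt] at hs
    exact ⟨by linarith [hs.1], by linarith [hs.2]⟩
  · have h3 : |v.2 - w.2| < ρ₀ ^ 2 := hv2.trans_le (pow_le_pow_left₀ (by positivity) hρle 2)
    have h4 := dist_triangle v.1 w.1 z.1
    have h5 := dist_triangle v.2 w.2 z.2
    rw [Real.dist_eq v.2 w.2] at h5
    rw [Prod.dist_eq, max_lt_iff]
    have h6 : ρ₀ ^ 2 < ρ₀ := by nlinarith
    exact ⟨by linarith [hw.1], by linarith [hw.2]⟩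

end IsPositiveSolution

end LocalBound

section Rescaling

variable {N m : ℕ} {β : Fin m → Fin m → ℝ} {r : ℝ}
  {u : Fin m → EuclideanSpace ℝ (Fin N) → ℝ → ℝ}

namespace IsPositiveSolution

/-- Solutions are bounded on compact sets. -/
lemma exists_bound_of_isCompact (hu : IsPositiveSolution β r u) (hN : 1 ≤ N) (hm : 0 < m)
    (hr : 0 < r) (hβ : ∀ i j, 0 ≤ β i j) (hsym : ∀ i j, β i j = β j i) {β₀ : ℝ} (hβ₀ : 0 < β₀)
    (hdiag : ∀ i, β₀ ≤ β i i)
    (hpB : N = 1 ∨ (2 ≤ N ∧ 2 * r + 1 < ((N : ℝ) * (N + 2)) / ((N : ℝ) - 1) ^ 2))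
    {K : Set (EuclideanSpace ℝ (Fin N) × ℝ)} (hK : IsCompact K) :
    ∃ M, ∀ i, ∀ z ∈ K, u i z.1 z.2 ≤ M := by
  have he := hu.blowUpSet_eq_empty hN hm hr hβ hsym hβ₀ hdiag hpB
  obtain ⟨M, hM⟩ := exists_bound_of_disjoint_blowUpSet (U := total u) hK fun z _ => by
    rw [he]; exact notMem_empty z
  exact ⟨M, fun i z hz => (hu.le_total i _ _).trans (hM z hz)⟩

/-- The change of variables in the rescaled space-time integral. -/
lemma integral_src_sq_scale (hu : IsPositiveSolution β r u) (hr : 0 < r) {R : ℝ} (hR : 0 < R) :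
    ∫ s in Ioo (-(1 / 2) : ℝ) (1 / 2), ∫ y in ball (0 : EuclideanSpace ℝ (Fin N)) (1 / 2),
        ∑ i, src β r (fun j => R ^ (1 / r) * u j ((0 : EuclideanSpace ℝ (Fin N)) + R • y)
          (0 + R ^ 2 * s)) i ^ 2
      = R ^ (-((N : ℝ) + 2 - 4 * (2 * r + 1) / (2 * r + 1 - 1))) *
        ∫ s in Ioo (-(R ^ 2) / 2) (R ^ 2 / 2),
          ∫ y in ball (0 : EuclideanSpace ℝ (Fin N)) (R / 2),
            ∑ i, src β r (fun j => u j y s) i ^ 2 := by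
  have hR2 : 0 < R ^ 2 := by positivity
  have h1 : ∀ s, ∫ y in ball (0 : EuclideanSpace ℝ (Fin N)) (1 / 2),
      ∑ i, src β r (fun j => R ^ (1 / r) * u j ((0 : EuclideanSpace ℝ (Fin N)) + R • y)
        (0 + R ^ 2 * s)) i ^ 2
      = ((R ^ (1 / r) * R ^ 2) ^ 2 * (R ^ N)⁻¹) *
        ∫ y in ball (0 : EuclideanSpace ℝ (Fin N)) (R / 2),
          ∑ i, src β r (fun j => u j y (R ^ 2 * s)) i ^ 2 := by
    intro s
    have h2 : ∀ y : EuclideanSpace ℝ (Fin N),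
        ∑ i, src β r (fun j => R ^ (1 / r) * u j ((0 : EuclideanSpace ℝ (Fin N)) + R • y)
          (0 + R ^ 2 * s)) i ^ 2
        = (R ^ (1 / r) * R ^ 2) ^ 2 *
          ∑ i, src β r (fun j => u j ((0 : EuclideanSpace ℝ (Fin N)) + R • y) (R ^ 2 * s)) i ^ 2 := by
      intro y
      rw [zero_add (R ^ 2 * s), Finset.mul_sum]
      refine Finset.sum_congr rfl fun i _ => ?_
      rw [src_const_mul (by positivity) (fun j => hu.pos j _ _), rpow_one_div_rpow hR hr, mul_pow]
    simp only [h2]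
    rw [integral_const_mul, integral_ball_comp_affine
      (fun y => ∑ i, src β r (fun j => u j y (R ^ 2 * s)) i ^ 2) 0 hR (1 / 2), mul_assoc,
      mul_one_div]
  simp only [h1]
  rw [integral_const_mul, integral_Ioo_comp_mul (fun s =>
    ∫ y in ball (0 : EuclideanSpace ℝ (Fin N)) (R / 2),
      ∑ i, src β r (fun j => u j y s) i ^ 2) hR2, ← mul_assoc]
  have e1 : R ^ 2 * -(1 / 2) = -(R ^ 2) / 2 := by ring
  have e2 : R ^ 2 * (1 / 2) = R ^ 2 / 2 := by ring
  rw [e1, e2]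
  congr 1
  rw [← Real.rpow_natCast R 2, ← Real.rpow_natCast R N, ← Real.rpow_add hR, ← Real.rpow_neg hR.le,
    ← Real.rpow_neg hR.le, ← Real.rpow_natCast _ 2, ← Real.rpow_mul hR.le, ← Real.rpow_add hR,
    ← Real.rpow_add hR]
  congr 1
  push_cast; field_simp; ring

end IsPositiveSolution

end Rescaling

/-- rescaled integral bound for positive classical solutions of (S) on the
whole space `ℝ^N × ℝ`: the `L²` norm of the nonlinearity on `B_{R/2} × (−R²/2, R²/2)`
is bounded by `C R^{N+2−4p/(p−1)}`. -/
theorem rescaled_integral_bound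
    (N m : ℕ) (hN : 1 ≤ N) (hm : 2 ≤ m)
    (r : ℝ) (hr : 0 < r)
    (β : Fin m → Fin m → ℝ)
    (hsym : ∀ i j, β i j = β j i)
    (hoff : ∀ i j, i ≠ j → 0 ≤ β i j)
    (hdiag : ∀ i, 0 < β i i)
    (hpB : N = 1 ∨ (2 ≤ N ∧ 2 * r + 1 < ((N : ℝ) * (N + 2)) / ((N : ℝ) - 1) ^ 2)) :
    ∃ C : ℝ, 0 < C ∧
      ∀ (u : Fin m → EuclideanSpace ℝ (Fin N) → ℝ → ℝ),
        (∀ i (x : EuclideanSpace ℝ (Fin N)) (t : ℝ), 0 < u i x t) →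
        (∀ i t, ContDiff ℝ 2 (fun x => u i x t)) →
        (∀ i x, ContDiff ℝ 1 (fun t => u i x t)) →
        (∀ i x t, deriv (fun s => u i x s) t - lap (fun y => u i y t) x
          = ∑ j, β i j * u i x t ^ r * u j x t ^ (r + 1)) →
        ∀ R : ℝ, 0 < R →
          (∫ s in Ioo (-(R ^ 2) / 2) (R ^ 2 / 2),
              ∫ y in ball (0 : EuclideanSpace ℝ (Fin N)) (R / 2),
                ∑ i, (∑ j, β i j * u i y s ^ r * u j y s ^ (r + 1)) ^ 2)
            ≤ C * R ^ ((N : ℝ) + 2 - 4 * (2 * r + 1) / (2 * r + 1 - 1)) := by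
  have hm0 : 0 < m := by omega
  have : Nonempty (Fin m) := ⟨⟨0, hm0⟩⟩
  have hβ : ∀ i j, 0 ≤ β i j := fun i j => by
    rcases eq_or_ne i j with rfl | h
    · exact (hdiag i).le
    · exact hoff i j h
  obtain ⟨i₀, -, hi₀⟩ := Finset.exists_min_image Finset.univ (fun i => β i i)
    Finset.univ_nonempty
  have hβ₀ := hdiag i₀
  have hdiag' : ∀ i, β i₀ i₀ ≤ β i i := fun i => hi₀ i (Finset.mem_univ i)
  obtain ⟨C, hC, h⟩ := exists_integral_estimate hN hr hβ hsym hβ₀ hdiag' hpB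
  refine ⟨C + 1, by positivity, fun u hpos hx ht heq R hR => ?_⟩
  have hu : IsPositiveSolution β r u := ⟨hpos, hx, ht, fun i x t => by
    have := hasHeatOpAt_of_contDiff (hx i) (ht i) x t
    rw [heq] at this
    exact this⟩
  have hv := hu.scale hr hR 0 0
  obtain ⟨M, hM⟩ := hv.exists_bound_of_isCompact hN hm0 hr hβ hsym hβ₀ hdiag' hpB
    (isCompact_closedBall (0 : EuclideanSpace ℝ (Fin N) × ℝ) 1)
  have hM' := fun i z hz => hM i z (ball_subset_closedBall hz)
  have key := h _ hv ⟨M, hM'⟩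
  rw [(hv.integral_src_sq_prod hβ hr.le hM').2.2, hu.integral_src_sq_scale hr hR,
    Real.rpow_neg hR.le, inv_mul_le_iff₀ (by positivity), mul_comm] at key
  refine le_trans key ?_
  gcongr
  linarith
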